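/- arXiv:2503.13112 — 4 statements merged into one kernel-verified Lean document; each statement's English description precedes it below -/
import Mathlib

section
/- Let G be a k-connected graph, let c_1, …, c_k be k distinct vertices of G, and let n_1, …, n_k be positive integers with n_1 + … + n_k = |V(G)|. Then there exists a partition of V(G) into sets V_1, …, V_k such that for every i ∈ {1,…,k}: |V_i| = n_i, c_i ∈ V_i, and the induced subgraph G[V_i] is connected. -/
/-- A graph `G` is `k`-connected: it has more than `k` vertices and deleting any
set of fewer than `k` vertices leaves a connected graph. -/
def KConnected {V : Type} [Fintype V] (G : SimpleGraph V) (k : ℕ) : Prop :=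
  k < Fintype.card V ∧
    ∀ S : Finset V, S.card < k → (G.induce ((↑S : Set V)ᶜ)).Connected

namespace GyoriLovasz

variable {V : Type*} {ι : Type*}

/-- The vertex set of the component of `G[S]` containing `c`; it is empty when `c ∉ S`. -/
def component (G : SimpleGraph V) (S : Set V) (c : V) : Set V :=
  {u | c ∈ S ∧ Relation.ReflTransGen (fun x y => G.Adj x y ∧ y ∈ S) c u}

section Component

variable {G : SimpleGraph V} {S T A : Set V} {c w x y : V}

lemma component_subset : component G S c ⊆ S := by
  rintro u ⟨hc, hu⟩
  induction hu with
  | refl => exact hc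
  | tail _ h _ => exact h.2

lemma root_mem_component (hc : c ∈ S) : c ∈ component G S c :=
  ⟨hc, Relation.ReflTransGen.refl⟩

lemma component_closed (hx : x ∈ component G S c) (hxy : G.Adj x y) (hy : y ∈ S) :
    y ∈ component G S c :=
  ⟨hx.1, hx.2.tail ⟨hxy, hy⟩⟩

lemma component_subset_of_closed (hc : c ∈ S → c ∈ T)
    (h : ∀ x ∈ component G S c, x ∈ T → ∀ y ∈ S, G.Adj x y → y ∈ T) :
    component G S c ⊆ T := by
  rintro u ⟨hcS, hu⟩
  induction hu with
  | refl => exact hc hcS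
  | tail hab hbc ih => exact h _ ⟨hcS, hab⟩ ih _ hbc.2 hbc.1

lemma component_subset_component (hT : component G S c ⊆ T) :
    component G S c ⊆ component G T c :=
  component_subset_of_closed (fun hc => root_mem_component (hT (root_mem_component hc)))
    fun _ hx hxT _ hy hxy => component_closed hxT hxy (hT (component_closed hx hxy hy))

lemma component_mono (h : S ⊆ T) : component G S c ⊆ component G T c :=
  component_subset_component (component_subset.trans h)

lemma component_congr (hT : component G S c ⊆ T) (hc : c ∈ T → c ∈ S)
    (h : ∀ x ∈ component G S c, ∀ y ∈ T, G.Adj x y → y ∈ S) :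
    component G T c = component G S c :=
  (component_subset_of_closed (fun hcT => root_mem_component (hc hcT))
    fun _ _ hx _ hy hxy => component_closed hx hxy (h _ hx _ hy hxy)).antisymm
    (component_subset_component hT)

lemma component_diff_root : component G (A \ {c}) c = ∅ :=
  Set.eq_empty_of_forall_notMem fun _ hu => hu.1.2 rfl

/-- Deleting a vertex `x` outside the component of `c` in `A - w` keeps that component, together
with `w`, attached to `c`. -/
lemma component_diff_nested (hA : A ⊆ component G A c) (hw : w ∈ A)
    (hx : x ∉ component G (A \ {w}) c) (hxw : x ≠ w) :
    insert w (component G (A \ {w}) c) ⊆ component G (A \ {x}) c := by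
  have hsub : component G (A \ {w}) c ⊆ component G (A \ {x}) c :=
    component_subset_component fun u hu =>
      ⟨(component_subset hu).1, fun h => hx (Set.mem_singleton_iff.1 h ▸ hu)⟩
  refine Set.insert_subset ?_ hsub
  have hwx : w ∈ A \ {x} := ⟨hw, fun h => hxw (Set.mem_singleton_iff.1 h).symm⟩
  by_cases hcw : w = c
  · subst hcw
    exact root_mem_component hwx
  by_contra hcon
  have hno : ∀ u ∈ component G (A \ {w}) c, ¬ G.Adj u w := fun u hu huw =>
    hcon (component_closed (hsub hu) huw hwx)
  have heq : component G A c = component G (A \ {w}) c := by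
    refine component_congr (component_subset.trans Set.sdiff_subset)
      (fun h => ⟨h, fun h' => hcw (Set.mem_singleton_iff.1 h').symm⟩) ?_
    intro u hu y hy huy
    refine ⟨hy, fun h => hno u hu ?_⟩
    rw [← Set.mem_singleton_iff.1 h]
    exact huy
  exact (component_subset (heq ▸ hA hw)).2 rfl

lemma exists_noncut [Finite V] (hA : A ⊆ component G A c) (hw : w ∈ A)
    (hne : (A \ insert w (component G (A \ {w}) c)).Nonempty) :
    ∃ x ∈ A \ insert w (component G (A \ {w}) c), A \ {x} ⊆ component G (A \ {x}) c := by
  obtain ⟨x, hx, hmax⟩ := (Set.toFinite (A \ insert w (component G (A \ {w}) c))).exists_maximalFor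
    (fun x => (component G (A \ {x}) c).ncard) _ hne
  refine ⟨x, hx, fun y hy => ?_⟩
  by_contra hyx
  have hxw : x ≠ w := fun h => hx.2 (h ▸ Set.mem_insert _ _)
  have h1 := component_diff_nested hA hw (fun h => hx.2 (Set.mem_insert_of_mem _ h)) hxw
  have h2 := component_diff_nested hA hx.1 hyx hy.2
  have hlt : (component G (A \ {x}) c).ncard < (component G (A \ {y}) c).ncard := by
    refine Set.ncard_lt_ncard ⟨(Set.subset_insert _ _).trans h2, fun h => ?_⟩ (Set.toFinite _)
    exact (component_subset (h (h2 (Set.mem_insert _ _)))).2 rfl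
  exact absurd (hmax ⟨hy.1, fun h => hyx (h1 h)⟩ hlt.le) (not_le.2 hlt)

lemma subset_component_insert {b a : V} (hA : A ⊆ component G A c) (ha : a ∈ A)
    (hab : G.Adj a b) : insert b A ⊆ component G (insert b A) c := by
  have h := hA.trans (component_mono (G := G) (c := c) (Set.subset_insert b A))
  exact Set.insert_subset (component_closed (h ha) hab (Set.mem_insert _ _)) h

lemma component_self_subset :
    component G S c ⊆ component G (component G S c) c :=
  component_subset_component subset_rfl

lemma connected_induce (hc : c ∈ A) (hA : A ⊆ component G A c) : (G.induce A).Connected := by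
  have key : ∀ u, Relation.ReflTransGen (fun x y => G.Adj x y ∧ y ∈ A) c u →
      ∀ hu : u ∈ A, (G.induce A).Reachable ⟨c, hc⟩ ⟨u, hu⟩ := by
    intro u h
    induction h with
    | refl => exact fun _ => SimpleGraph.Reachable.refl _
    | @tail p q hp hpq ih =>
      intro hq
      have hpA : p ∈ A := component_subset (G := G) (c := c) ⟨hc, hp⟩
      exact (ih hpA).trans (SimpleGraph.Adj.reachable (by simpa using hpq.1))
  have : Nonempty A := ⟨⟨c, hc⟩⟩
  exact ⟨fun u v => (key u (hA u.2).2 u.2).symm.trans (key v (hA v.2).2 v.2)⟩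

end Component

/-- Pairwise disjoint connected vertex sets `A i` of `G` with `c i ∈ A i`. -/
structure IsRootedFamily (G : SimpleGraph V) (c : ι → V) (A : ι → Set V) : Prop where
  disj : ∀ i j, i ≠ j → Disjoint (A i) (A j)
  root : ∀ i, c i ∈ A i
  conn : ∀ i, A i ⊆ component G (A i) (c i)

/-- The union of `A i₀` and, over `i ≠ i₀`, of the components of `A i - w r i` containing the
roots. -/
def captured (G : SimpleGraph V) (c : ι → V) (i₀ : ι) (A : ι → Set V) (w : ℕ → ι → V) (r : ℕ) :
    Set V :=
  {v | v ∈ A i₀ ∨ ∃ i, i ≠ i₀ ∧ v ∈ component G (A i \ {w r i}) (c i)}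

/-- A rooted family with a cascade in each part: in each step from `r` to `r + 1` the cut vertex
`w r i` of `A i` may be replaced by a vertex of `A i` that it separates from the root, provided
that the new vertex has a neighbour captured at level `r`. -/
structure IsCascade (G : SimpleGraph V) (c : ι → V) (i₀ : ι) (A : ι → Set V)
    (w : ℕ → ι → V) : Prop extends IsRootedFamily G c A where
  zero : w 0 = c
  step : ∀ r i, w (r + 1) i = w r i ∨
    (w (r + 1) i ∈ A i ∧ w (r + 1) i ∉ component G (A i \ {w r i}) (c i) ∧
      w (r + 1) i ≠ w r i ∧ ∃ a ∈ captured G c i₀ A w r, G.Adj a (w (r + 1) i))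

/-- The part `A i₀` can be enlarged by one vertex without changing the sizes of the other parts. -/
def Growable (G : SimpleGraph V) (c : ι → V) (i₀ : ι) (A : ι → Set V) : Prop :=
  ∃ A' : ι → Set V, IsRootedFamily G c A' ∧ (A' i₀).ncard = (A i₀).ncard + 1 ∧
    ∀ i, i ≠ i₀ → (A' i).ncard = (A i).ncard

/-- Some cascade with the same part sizes captures more vertices at a level `t ≤ r` and the same
vertices at all lower levels. -/
def Improvable (G : SimpleGraph V) (c : ι → V) (i₀ : ι) (A : ι → Set V) (w : ℕ → ι → V)
    (r : ℕ) : Prop :=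
  ∃ (A' : ι → Set V) (w' : ℕ → ι → V), IsCascade G c i₀ A' w' ∧
    (∀ i, (A' i).ncard = (A i).ncard) ∧
    ∃ t ≤ r, (∀ s < t, captured G c i₀ A' w' s = captured G c i₀ A w s) ∧
      captured G c i₀ A w t ⊂ captured G c i₀ A' w' t

section Cascade

variable {G : SimpleGraph V} {c : ι → V} {i₀ : ι} {A : ι → Set V} {w : ℕ → ι → V}

lemma Improvable.mono {r s : ℕ} (h : Improvable G c i₀ A w r) (hrs : r ≤ s) :
    Improvable G c i₀ A w s := by
  obtain ⟨A', w', hA', hn, t, ht, h⟩ := h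
  exact ⟨A', w', hA', hn, t, ht.trans hrs, h⟩

lemma captured_zero (hw : w 0 = c) : captured G c i₀ A w 0 = A i₀ := by
  ext v
  simp [captured, hw, component_diff_root]

lemma captured_subset_iUnion (r : ℕ) :
    captured G c i₀ A w r ⊆ ⋃ i, A i := by
  rintro v (hv | ⟨i, _, hv⟩)
  · exact Set.mem_iUnion.2 ⟨_, hv⟩
  · exact Set.mem_iUnion.2 ⟨i, (component_subset hv).1⟩

namespace IsCascade

lemma cut_mem (h : IsCascade G c i₀ A w) (r : ℕ) (i : ι) : w r i ∈ A i := by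
  induction r with
  | zero => rw [h.zero]; exact h.root i
  | succ r ih =>
    rcases h.step r i with h' | h'
    · rw [h']; exact ih
    · exact h'.1

lemma insert_cut_subset (h : IsCascade G c i₀ A w) {r s : ℕ} (hrs : r ≤ s) (i : ι) :
    insert (w r i) (component G (A i \ {w r i}) (c i)) ⊆
      insert (w s i) (component G (A i \ {w s i}) (c i)) := by
  induction s, hrs using Nat.le_induction with
  | base => exact subset_rfl
  | succ s _ ih =>
    refine ih.trans ?_
    rcases h.step s i with h' | ⟨_, h2, h3, _⟩
    · rw [h']
    · exact (component_diff_nested (h.conn i) (h.cut_mem s i) h2 h3).trans (Set.subset_insert _ _)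

lemma component_mono (h : IsCascade G c i₀ A w) {r s : ℕ} (hrs : r ≤ s) (i : ι) :
    component G (A i \ {w r i}) (c i) ⊆ component G (A i \ {w s i}) (c i) := by
  induction s, hrs using Nat.le_induction with
  | base => exact subset_rfl
  | succ s _ ih =>
    refine ih.trans ?_
    rcases h.step s i with h' | ⟨_, h2, h3, _⟩
    · rw [h']
    · exact (Set.subset_insert _ _).trans
        (component_diff_nested (h.conn i) (h.cut_mem s i) h2 h3)

lemma captured_mono (h : IsCascade G c i₀ A w) {r s : ℕ} (hrs : r ≤ s) :
    captured G c i₀ A w r ⊆ captured G c i₀ A w s := by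
  rintro v (hv | ⟨i, hi, hv⟩)
  · exact Or.inl hv
  · exact Or.inr ⟨i, hi, h.component_mono hrs i hv⟩

/-- Within a part other than `A i₀`, only the component of the root is captured. -/
lemma mem_component_of_mem_captured (h : IsCascade G c i₀ A w) {r : ℕ} {i : ι} {v : V}
    (hi : i ≠ i₀) (hv : v ∈ A i) (hc : v ∈ captured G c i₀ A w r) :
    v ∈ component G (A i \ {w r i}) (c i) := by
  rcases hc with hc | ⟨j, _, hc⟩
  · exact absurd hc (Set.disjoint_left.1 (h.disj i i₀ hi) hv)
  · by_cases hij : i = j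
    · subst hij; exact hc
    · exact absurd (component_subset hc).1 (Set.disjoint_left.1 (h.disj i j hij) hv)

end IsCascade

lemma IsRootedFamily.update [DecidableEq ι] (h : IsRootedFamily G c A) {j : ι} {B : Set V} {b : V}
    (hb : b ∉ ⋃ i, A i) (hB : B ⊆ insert b (A j)) (hcB : c j ∈ B)
    (hconn : B ⊆ component G B (c j)) : IsRootedFamily G c (Function.update A j B) := by
  have hdis : ∀ i, i ≠ j → Disjoint (A i) B := by
    intro i hij
    refine Set.disjoint_left.2 fun v hv hvB => ?_
    rcases hB hvB with rfl | hvj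
    · exact hb (Set.mem_iUnion.2 ⟨i, hv⟩)
    · exact Set.disjoint_left.1 (h.disj i j hij) hv hvj
  refine ⟨fun i l hil => ?_, fun i => ?_, fun i => ?_⟩
  · by_cases hi : i = j
    · subst hi
      simpa [Function.update_of_ne (Ne.symm hil)] using (hdis l (Ne.symm hil)).symm
    · by_cases hl : l = j
      · subst hl
        simpa [Function.update_of_ne hil] using hdis i hil
      · simpa [Function.update_of_ne hi, Function.update_of_ne hl] using h.disj i l hil
  · by_cases hi : i = j
    · subst hi; simpa using hcB
    · simpa [Function.update_of_ne hi] using h.root i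
  · by_cases hi : i = j
    · subst hi; simpa using hconn
    · simpa [Function.update_of_ne hi] using h.conn i

/-- Exchanging vertices of a part outside the component at level `r` with a vertex `b` that has no
neighbour captured at level `r` changes nothing up to that level. -/
lemma IsCascade.exchange [DecidableEq ι] (h : IsCascade G c i₀ A w) {j : ι} (hj : j ≠ i₀)
    {B : Set V} {b : V} {r q : ℕ}
    (hb : b ∉ ⋃ i, A i) (hB : B ⊆ insert b (A j)) (hcB : c j ∈ B)
    (hconn : B ⊆ component G B (c j)) (hRB : component G (A j \ {w r j}) (c j) ⊆ B)
    (hno : ∀ a ∈ captured G c i₀ A w r, ¬ G.Adj a b)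
    (hqr : q ≤ r + 1) (hwB : ∀ s ≤ q, w s j ∈ B) :
    IsCascade G c i₀ (Function.update A j B) (fun s => w (min s q)) ∧
      ∀ s ≤ r, s ≤ q →
        captured G c i₀ (Function.update A j B) (fun s => w (min s q)) s =
          captured G c i₀ A w s := by
  have hcomp : ∀ s ≤ r, ∀ i,
      component G (Function.update A j B i \ {w s i}) (c i) =
        component G (A i \ {w s i}) (c i) := by
    intro s hs i
    by_cases hi : i = j
    · subst hi
      rw [Function.update_self]
      refine component_congr (fun u hu => ⟨hRB (h.component_mono hs i hu), (component_subset hu).2⟩)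
        (fun hc => ⟨h.root i, hc.2⟩) ?_
      intro x hx y hy hxy
      rcases hB hy.1 with rfl | hyA
      · exact absurd hxy (hno x (Or.inr ⟨i, hj, h.component_mono hs i hx⟩))
      · exact ⟨hyA, hy.2⟩
    · rw [Function.update_of_ne hi]
  have hcap : ∀ s ≤ r, s ≤ q →
      captured G c i₀ (Function.update A j B) (fun s => w (min s q)) s =
        captured G c i₀ A w s := by
    intro s hs hsq
    ext v
    simp only [captured, min_eq_left hsq, hcomp s hs, Function.update_of_ne (Ne.symm hj)]
  refine ⟨⟨h.toIsRootedFamily.update hb hB hcB hconn, by simpa using h.zero, fun s i => ?_⟩, hcap⟩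
  by_cases hsq : q ≤ s
  · left
    rw [min_eq_right hsq, min_eq_right (hsq.trans (Nat.le_succ s))]
  · have hs1 : s + 1 ≤ q := by omega
    have hsr : s ≤ r := by omega
    rw [hcap s hsr (by omega), min_eq_left hs1, min_eq_left (by omega : s ≤ q), hcomp s hsr]
    refine (h.step s i).imp_right fun h' => ⟨?_, h'.2⟩
    by_cases hi : i = j
    · subst hi; simpa using hwB _ hs1
    · simpa [Function.update_of_ne hi] using h'.1

/-- A vertex outside all parts that has a captured neighbour yields progress. -/
lemma IsCascade.growable_or_improvable_of_free [Finite V] [DecidableEq ι]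
    (r : ℕ) : ∀ {A : ι → Set V} {w : ℕ → ι → V}, IsCascade G c i₀ A w →
    ∀ {a b : V}, b ∉ ⋃ i, A i → a ∈ captured G c i₀ A w r → G.Adj a b →
    Growable G c i₀ A ∨ Improvable G c i₀ A w r := by
  induction r with
  | zero =>
    intro A w h a b hb ha hab
    rw [captured_zero h.zero] at ha
    refine Or.inl ⟨Function.update A i₀ (insert b (A i₀)),
      h.toIsRootedFamily.update hb subset_rfl (Set.mem_insert_of_mem _ (h.root i₀))
        (subset_component_insert (h.conn i₀) ha hab), ?_, fun i hi => ?_⟩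
    · rw [Function.update_self, Set.ncard_insert_of_notMem
        (fun hbA => hb (Set.mem_iUnion.2 ⟨i₀, hbA⟩)) (Set.toFinite _)]
    · rw [Function.update_of_ne hi]
  | succ r ih =>
    intro A w h a b hb ha hab
    by_cases hex : ∃ a' ∈ captured G c i₀ A w r, G.Adj a' b
    · obtain ⟨a', ha', hab'⟩ := hex
      exact (ih h hb ha' hab').imp_right fun h' => h'.mono (Nat.le_succ r)
    have hno : ∀ a' ∈ captured G c i₀ A w r, ¬ G.Adj a' b := fun a' ha' hab' =>
      hex ⟨a', ha', hab'⟩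
    obtain ha | ⟨j, hj, ha⟩ := ha
    · exact absurd hab (hno a (Or.inl ha))
    obtain hw | ⟨hwA, hwR, hwne, a₁, ha₁, ha₁w⟩ := h.step r j
    · rw [hw] at ha
      exact absurd hab (hno a (Or.inr ⟨j, hj, ha⟩))
    have hbA : ∀ i, b ∉ A i := fun i hi => hb (Set.mem_iUnion.2 ⟨i, hi⟩)
    have hnest := component_diff_nested (h.conn j) (h.cut_mem r j) hwR hwne
    set x₀ := w (r + 1) j with hx₀
    set R := component G (A j \ {x₀}) (c j) with hR
    have hRA : R ⊆ A j := component_subset.trans Set.sdiff_subset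
    have hcR : c j ∈ R := root_mem_component ha.1
    have hx₀R : x₀ ∉ R := fun hx => (component_subset hx).2 rfl
    have hRr : component G (A j \ {w r j}) (c j) ⊆ R := (Set.subset_insert _ _).trans hnest
    have hwsR : ∀ s ≤ r, w s j ∈ R := fun s hs =>
      hnest (h.insert_cut_subset hs j (Set.mem_insert _ _))
    by_cases hne : (A j \ insert x₀ R).Nonempty
    · obtain ⟨x, hx, hxconn⟩ := exists_noncut (h.conn j) hwA hne
      have hRx : R ⊆ A j \ {x} := fun u hu =>
        ⟨hRA hu, fun hux => hx.2 (Set.mem_insert_of_mem _ (Set.mem_singleton_iff.1 hux ▸ hu))⟩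
      have hx₀x : x₀ ∈ A j \ {x} :=
        ⟨hwA, fun hux => hx.2 (Set.mem_singleton_iff.1 hux ▸ Set.mem_insert _ _)⟩
      obtain ⟨hC, hcap⟩ := h.exchange hj (B := insert b (A j \ {x})) (b := b) (r := r) (q := r + 1)
        hb (Set.insert_subset_insert Set.sdiff_subset) (Set.mem_insert_of_mem _ (hRx hcR))
        (subset_component_insert hxconn (hRx ha) hab)
        (hRr.trans (hRx.trans (Set.subset_insert _ _))) hno le_rfl (by
          intro s hs
          refine Set.mem_insert_of_mem _ ?_
          rcases Nat.le_succ_iff.1 hs with hs | rfl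
          · exact hRx (hwsR s hs)
          · exact hx₀x)
      refine Or.inr ⟨_, _, hC, fun i => ?_, r + 1, le_rfl,
        fun s hs => hcap s (by omega) (by omega), ?_⟩
      · by_cases hi : i = j
        · subst hi
          rw [Function.update_self, Set.ncard_insert_of_notMem (fun hb' => hbA i hb'.1)
            (Set.toFinite _), Set.ncard_sdiff_singleton_add_one hx.1 (Set.toFinite _)]
        · rw [Function.update_of_ne hi]
      · have hsub : R ⊆ component G (insert b (A j \ {x}) \ {x₀}) (c j) :=
          component_subset_component fun u hu =>
            ⟨Set.mem_insert_of_mem _ (hRx hu), (component_subset hu).2⟩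
        refine (Set.ssubset_iff_of_subset ?_).2 ⟨b, Or.inr ⟨j, hj, ?_⟩, fun hb' =>
          hb (captured_subset_iUnion _ hb')⟩
        · rintro v (hv | ⟨i, hi, hv⟩)
          · left; rwa [Function.update_of_ne (Ne.symm hj)]
          · refine Or.inr ⟨i, hi, ?_⟩
            simp only [min_self]
            by_cases hij : i = j
            · subst hij
              rw [Function.update_self]
              exact hsub hv
            · rwa [Function.update_of_ne hij]
        · simp only [min_self, Function.update_self]
          exact component_closed (hsub ha) hab
            ⟨Set.mem_insert _ _, fun hbx => hbA j (Set.mem_singleton_iff.1 hbx ▸ hwA)⟩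
    · have hAR : A j = insert x₀ R :=
        (Set.sdiff_eq_empty.1 (Set.not_nonempty_iff_eq_empty.1 hne)).antisymm
          (Set.insert_subset hwA hRA)
      obtain ⟨hC, hcap⟩ := h.exchange hj (B := insert b R) (b := b) (r := r) (q := r)
        hb (Set.insert_subset_insert hRA) (Set.mem_insert_of_mem _ hcR)
        (subset_component_insert component_self_subset ha hab)
        (hRr.trans (Set.subset_insert _ _)) hno (Nat.le_succ r)
        (fun s hs => Set.mem_insert_of_mem _ (hwsR s hs))
      have hcard : ∀ i, (Function.update A j (insert b R) i).ncard = (A i).ncard := by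
        intro i
        by_cases hi : i = j
        · subst hi
          rw [Function.update_self, hAR, Set.ncard_insert_of_notMem hx₀R (Set.toFinite _),
            Set.ncard_insert_of_notMem (fun hb' => hbA i (hRA hb')) (Set.toFinite _)]
        · rw [Function.update_of_ne hi]
      have hfree : x₀ ∉ ⋃ i, Function.update A j (insert b R) i := by
        intro hx
        obtain ⟨i, hx⟩ := Set.mem_iUnion.1 hx
        by_cases hi : i = j
        · subst hi
          rw [Function.update_self] at hx
          rcases hx with hx | hx
          · exact hbA i (hx ▸ hwA)
          · exact hx₀R hx
        · rw [Function.update_of_ne hi] at hx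
          exact Set.disjoint_left.1 (h.disj i j hi) hx hwA
      rw [← hcap r le_rfl le_rfl] at ha₁
      rcases ih hC hfree ha₁ ha₁w with ⟨A', hA', h0, hn⟩ | ⟨A', w', hA', hn, t, ht, hlt, hss⟩
      · exact Or.inl ⟨A', hA', h0.trans (by rw [hcard]), fun i hi => (hn i hi).trans (hcard i)⟩
      · refine Or.inr ⟨A', w', hA', fun i => (hn i).trans (hcard i), t, by omega,
          fun s hs => (hlt s hs).trans (hcap s (by omega) (by omega)), ?_⟩
        rwa [hcap t ht ht] at hss

/-- A vertex of a part beyond its current cut vertex that has a captured neighbour can become the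
next cut vertex. -/
lemma IsCascade.improvable_of_mem_part [DecidableEq ι] (h : IsCascade G c i₀ A w) {r : ℕ} {i : ι}
    (hi : i ≠ i₀) {a b : V} (hbA : b ∈ A i)
    (hbR : b ∉ component G (A i \ {w (r + 1) i}) (c i)) (hbw : b ≠ w (r + 1) i)
    (ha : a ∈ captured G c i₀ A w r) (hab : G.Adj a b) : Improvable G c i₀ A w (r + 1) := by
  set w' : ℕ → ι → V := fun s => if s ≤ r then w s else Function.update (w (r + 1)) i b with hw'
  have hle : ∀ s ≤ r, w' s = w s := fun s hs => if_pos hs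
  have hgt : ∀ s, ¬ s ≤ r → w' s = Function.update (w (r + 1)) i b := fun s hs => if_neg hs
  have hcap : ∀ s ≤ r, captured G c i₀ A w' s = captured G c i₀ A w s := by
    intro s hs
    simp only [captured, hle s hs]
  have hnest := component_diff_nested (h.conn i) (h.cut_mem (r + 1) i) hbR hbw
  refine ⟨A, w', ⟨h.toIsRootedFamily, by rw [hle 0 (Nat.zero_le r), h.zero], fun s l => ?_⟩,
    fun _ => rfl, r + 1, le_rfl, fun s hs => hcap s (by omega), ?_⟩
  · rcases lt_trichotomy s r with hs | rfl | hs
    · rw [hle s hs.le, hle (s + 1) hs, hcap s hs.le]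
      exact h.step s l
    · rw [hle s le_rfl, hgt (s + 1) (by omega), hcap s le_rfl]
      by_cases hl : l = i
      · subst hl
        rw [Function.update_self]
        refine Or.inr ⟨hbA, fun hb => hbR (h.component_mono (Nat.le_succ s) l hb), ?_, a, ha, hab⟩
        rintro rfl
        rcases h.insert_cut_subset (Nat.le_succ s) l (Set.mem_insert _ _) with hb | hb
        · exact hbw hb
        · exact hbR hb
      · rw [Function.update_of_ne hl]
        exact h.step s l
    · left
      rw [hgt s (by omega), hgt (s + 1) (by omega)]
  · have hw1 : w' (r + 1) = Function.update (w (r + 1)) i b := hgt _ (by omega)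
    refine (Set.ssubset_iff_of_subset ?_).2 ⟨w (r + 1) i, Or.inr ⟨i, hi, ?_⟩, fun hw => ?_⟩
    · rintro v (hv | ⟨l, hl, hv⟩)
      · exact Or.inl hv
      · refine Or.inr ⟨l, hl, ?_⟩
        rw [hw1]
        by_cases hli : l = i
        · subst hli
          rw [Function.update_self]
          exact hnest (Set.mem_insert_of_mem _ hv)
        · rwa [Function.update_of_ne hli]
    · rw [hw1, Function.update_self]
      exact hnest (Set.mem_insert _ _)
    · exact (component_subset (h.mem_component_of_mem_captured hi (h.cut_mem _ i) hw)).2 rfl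

end Cascade

section Growth

variable {V : Type} [Fintype V] {G : SimpleGraph V} {k : ℕ} {c : Fin k → V} {i₀ : Fin k}
  {A : Fin k → Set V} {w : ℕ → Fin k → V}

lemma IsCascade.exists_boundary (h : IsCascade G c i₀ A w) (hG : KConnected G k)
    (hA : ⋃ i, A i ≠ Set.univ) (r : ℕ) :
    ∃ a b, a ∈ captured G c i₀ A w r ∧ b ∉ captured G c i₀ A w r ∧
      (∀ i, i ≠ i₀ → b ≠ w r i) ∧ G.Adj a b := by
  classical
  obtain ⟨z, hz⟩ := (Set.ne_univ_iff_exists_notMem _).1 hA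
  set S : Finset V := (Finset.univ.erase i₀).image (w r) with hS
  have hcard : S.card < k := by
    have h1 : S.card ≤ (Finset.univ.erase i₀).card := Finset.card_image_le
    rw [Finset.card_erase_of_mem (Finset.mem_univ _), Finset.card_univ, Fintype.card_fin] at h1
    have := i₀.pos
    omega
  have hmem : ∀ v, v ∈ S ↔ ∃ i, i ≠ i₀ ∧ w r i = v := by
    intro v; simp [hS]
  have hcS : c i₀ ∈ ((S : Set V)ᶜ) := by
    intro hc
    obtain ⟨i, hi, hwi⟩ := (hmem _).1 (Finset.mem_coe.1 hc)
    exact Set.disjoint_left.1 (h.disj i i₀ hi) (hwi ▸ h.cut_mem r i) (h.root i₀)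
  have hzS : z ∈ ((S : Set V)ᶜ) := by
    intro hc
    obtain ⟨i, hi, hwi⟩ := (hmem _).1 (Finset.mem_coe.1 hc)
    exact hz (Set.mem_iUnion.2 ⟨i, hwi ▸ h.cut_mem r i⟩)
  obtain ⟨p⟩ := (hG.2 S hcard).preconnected ⟨c i₀, hcS⟩ ⟨z, hzS⟩
  obtain ⟨d, _, hd1, hd2⟩ := p.exists_boundary_dart (Subtype.val ⁻¹' captured G c i₀ A w r)
    (Or.inl (h.root i₀)) (fun hz' => hz (captured_subset_iUnion r hz'))
  refine ⟨d.fst, d.snd, hd1, hd2, fun i hi hb => d.snd.2 ?_, d.adj⟩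
  exact Finset.mem_coe.2 ((hmem _).2 ⟨i, hi, hb.symm⟩)

lemma IsCascade.growable_or_improvable (h : IsCascade G c i₀ A w) (hG : KConnected G k)
    (hA : ⋃ i, A i ≠ Set.univ) :
    Growable G c i₀ A ∨ Improvable G c i₀ A w (Fintype.card V) := by
  obtain ⟨r, hr, heq⟩ : ∃ r < Fintype.card V,
      captured G c i₀ A w (r + 1) = captured G c i₀ A w r := by
    by_contra! hcon
    have hlt : ∀ r ≤ Fintype.card V, r < (captured G c i₀ A w r).ncard := by
      intro r
      induction r with
      | zero =>
        exact fun _ => (Set.ncard_pos (Set.toFinite _)).2 ⟨c i₀, Or.inl (h.root i₀)⟩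
      | succ r ih =>
        intro hr
        have := Set.ncard_lt_ncard ((h.captured_mono (Nat.le_add_right r 1)).ssubset_of_ne
          (hcon r hr).symm) (Set.toFinite _)
        have := ih (by omega)
        omega
    have h1 := hlt _ le_rfl
    have h2 := Set.ncard_le_card (captured G c i₀ A w (Fintype.card V))
    rw [Nat.card_eq_fintype_card] at h2
    omega
  obtain ⟨a, b, ha, hb, hbw, hab⟩ := h.exists_boundary hG hA r
  by_cases hfree : b ∈ ⋃ i, A i
  · obtain ⟨i, hbi⟩ := Set.mem_iUnion.1 hfree
    have hi : i ≠ i₀ := by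
      rintro rfl
      exact hb (Or.inl hbi)
    refine Or.inr (Improvable.mono (h.improvable_of_mem_part hi hbi ?_ ?_ ha hab) hr)
    · exact fun hbR => hb (heq ▸ Or.inr ⟨i, hi, hbR⟩)
    · rcases h.step r i with hw | ⟨_, h2, h3, _⟩
      · rw [hw]; exact hbw i hi
      · have hmem : w r i ∈ captured G c i₀ A w (r + 1) := Or.inr ⟨i, hi,
          component_diff_nested (h.conn i) (h.cut_mem r i) h2 h3 (Set.mem_insert _ _)⟩
        rw [heq] at hmem
        exact absurd rfl (component_subset
          (h.mem_component_of_mem_captured hi (h.cut_mem r i) hmem)).2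
  · exact (h.growable_or_improvable_of_free r hfree ha hab).imp_right fun h' => h'.mono hr.le

lemma IsRootedFamily.growable (h : IsRootedFamily G c A) (hG : KConnected G k)
    (hA : ∑ i, (A i).ncard < Fintype.card V) (i₀ : Fin k) : Growable G c i₀ A := by
  by_contra hgrow
  set N := Fintype.card V with hN
  have hle : ∀ S : Set V, S.ncard < N + 1 := fun S => by
    have := Set.ncard_le_card S
    rw [Nat.card_eq_fintype_card] at this
    omega
  let X := {C : (Fin k → Set V) × (ℕ → Fin k → V) //
    IsCascade G c i₀ C.1 C.2 ∧ ∀ i, (C.1 i).ncard = (A i).ncard}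
  let f : X → Lex (Fin (N + 1) → Fin (N + 1)) := fun C => toLex fun s =>
    ⟨(captured G c i₀ C.1.1 C.1.2 s).ncard, hle _⟩
  have : Nonempty X := ⟨⟨(A, fun _ => c), ⟨h, rfl, fun _ _ => Or.inl rfl⟩, fun _ => rfl⟩⟩
  have : Finite (Lex (Fin (N + 1) → Fin (N + 1))) :=
    inferInstanceAs (Finite (Fin (N + 1) → Fin (N + 1)))
  obtain ⟨_, ⟨⟨⟨B, w⟩, hC, hcard⟩, rfl⟩, hmax⟩ :=
    (Set.toFinite (Set.range f)).exists_maximal (Set.range_nonempty f)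
  dsimp only at hC hcard
  have hB : ⋃ i, B i ≠ Set.univ := by
    intro hun
    have := Set.ncard_iUnion_le_of_fintype B
    rw [hun, Set.ncard_univ, Nat.card_eq_fintype_card] at this
    simp only [hcard] at this
    omega
  rcases hC.growable_or_improvable hG hB with ⟨A', hA', h0, hn⟩ | ⟨A', w', hC', hn, t, ht, hlt, hss⟩
  · exact hgrow ⟨A', hA', h0.trans (by rw [hcard]), fun i hi => (hn i hi).trans (hcard i)⟩
  · have hlex : f ⟨(B, w), hC, hcard⟩ < f ⟨(A', w'), hC', fun i => (hn i).trans (hcard i)⟩ := by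
      refine ⟨⟨t, Nat.lt_succ_of_le ht⟩, fun s hs => ?_, ?_⟩
      · exact Fin.ext (congrArg Set.ncard (hlt s hs).symm)
      · exact Fin.mk_lt_mk.2 (Set.ncard_lt_ncard hss (Set.toFinite _))
    exact absurd (hmax ⟨_, rfl⟩ hlex.le) (not_le.2 hlex)

end Growth

end GyoriLovasz

/-- **Győri–Lovász theorem.** -/
theorem gyori_lovasz {V : Type} [Fintype V] [DecidableEq V] (G : SimpleGraph V) (k : ℕ)
    (c : Fin k → V) (hc : Function.Injective c)
    (n : Fin k → ℕ) (hpos : ∀ i, 0 < n i)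
    (hsum : ∑ i, n i = Fintype.card V)
    (hconn : KConnected G k) :
    ∃ P : Fin k → Set V,
      (Pairwise fun i j => Disjoint (P i) (P j)) ∧
      (⋃ i, P i) = Set.univ ∧
      ∀ i, (P i).ncard = n i ∧ c i ∈ P i ∧ (G.induce (P i)).Connected := by
  have key : ∀ m, m ≤ ∑ i, n i → ∃ A : Fin k → Set V, GyoriLovasz.IsRootedFamily G c A ∧
      (∀ i, (A i).ncard ≤ n i) ∧ m ≤ ∑ i, (A i).ncard := by
    intro m
    induction m with
    | zero =>
      refine fun _ => ⟨fun i => {c i}, ⟨fun i j hij => ?_, fun i => rfl, fun i => ?_⟩,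
        fun i => ?_, Nat.zero_le _⟩
      · simpa using hc.ne hij
      · simpa using GyoriLovasz.root_mem_component (Set.mem_singleton (c i))
      · simpa [Nat.one_le_iff_ne_zero] using (hpos i).ne'
    | succ m ih =>
      intro hm
      obtain ⟨A, hA, hle, hmA⟩ := ih (by omega)
      by_cases hlt : ∑ i, (A i).ncard < ∑ i, n i
      · obtain ⟨i₀, -, hi₀⟩ := Finset.exists_lt_of_sum_lt hlt
        obtain ⟨A', hA', h0, hn⟩ := hA.growable hconn (hsum ▸ hlt) i₀
        refine ⟨A', hA', fun i => ?_, Nat.succ_le_of_lt (hmA.trans_lt ?_)⟩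
        · by_cases hi : i = i₀
          · subst hi; omega
          · rw [hn i hi]; exact hle i
        · refine Finset.sum_lt_sum (fun i _ => ?_) ⟨i₀, Finset.mem_univ _, by omega⟩
          by_cases hi : i = i₀
          · subst hi; omega
          · exact (hn i hi).ge
      · exact ⟨A, hA, hle, by omega⟩
  obtain ⟨P, hP, hle, hPsum⟩ := key _ le_rfl
  have hcard : ∀ i, (P i).ncard = n i := fun i =>
    (Finset.sum_eq_sum_iff_of_le fun i _ => hle i).1
      ((Finset.sum_le_sum fun i _ => hle i).antisymm hPsum) i (Finset.mem_univ i)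
  refine ⟨P, fun i j hij => hP.disj i j hij, ?_, fun i => ⟨hcard i, hP.root i,
    GyoriLovasz.connected_induce (hP.root i) (hP.conn i)⟩⟩
  rw [Set.eq_univ_iff_ncard, Nat.card_eq_fintype_card,
    Set.ncard_iUnion_of_finite (fun i => Set.toFinite _) (fun i j hij => hP.disj i j hij),
    finsum_eq_sum_of_fintype, ← hsum]
  exact Finset.sum_congr rfl fun i _ => hcard i
end

section
/- Let G be a graph that admits a CDS partition of size k, let c_1, …, c_k be k distinct vertices of G, and let n_1, …, n_k be positive integers with n_1 + … + n_k = |V(G)|. Then there exists a partition of V(G) into sets V_1, …, V_k such that for every i ∈ {1,…,k}: |V_i| = n_i, c_i ∈ V_i, and the induced subgraph G[V_i] is connected. -/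
/-- `D` is a connected dominating set of `G`: the induced subgraph is connected
and every vertex of `G` is in `D` or adjacent to a vertex of `D`. -/
def IsCDS {V : Type} (G : SimpleGraph V) (D : Set V) : Prop :=
  (G.induce D).Connected ∧ ∀ v : V, v ∈ D ∨ ∃ u ∈ D, G.Adj v u

/-- `G` admits a CDS partition of size `k`: a partition of the vertex set into `k`
parts, each of which is a connected dominating set of `G`. -/
def HasCDSPartition {V : Type} (G : SimpleGraph V) (k : ℕ) : Prop :=
  ∃ D : Fin k → Set V,
    (Pairwise fun i j => Disjoint (D i) (D j)) ∧
    (⋃ i, D i) = Set.univ ∧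
    ∀ i, IsCDS G (D i)

open Finset

section Connectivity

variable {V : Type*} {G : SimpleGraph V}

/-- A connected vertex set has an edge across every proper nonempty part of it. -/
theorem exists_adj_boundary_of_connected_induce {S T : Set V} (hS : (G.induce S).Connected)
    {a b : V} (ha : a ∈ S) (haT : a ∈ T) (hb : b ∈ S) (hbT : b ∉ T) :
    ∃ u ∈ S, u ∈ T ∧ ∃ v ∈ S, v ∉ T ∧ G.Adj u v := by
  obtain ⟨p⟩ := hS.preconnected ⟨a, ha⟩ ⟨b, hb⟩
  obtain ⟨d, -, h1, h2⟩ := p.exists_boundary_dart {x | (x : V) ∈ T} haT hbT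
  exact ⟨d.fst, d.fst.2, h1, d.snd, d.snd.2, h2, d.adj⟩

theorem connected_induce_singleton (v : V) : (G.induce {v}).Connected := by
  have : Subsingleton ({v} : Set V) := by simp
  exact { preconnected := SimpleGraph.Preconnected.of_subsingleton, nonempty := ⟨⟨v, rfl⟩⟩ }

theorem connected_induce_insert {S : Set V} (hS : (G.induce S).Connected) {u v : V}
    (hu : u ∈ S) (h : G.Adj u v) : (G.induce (insert v S)).Connected := by
  rw [Set.insert_eq, Set.union_comm]
  exact SimpleGraph.connected_induce_union hS.preconnected
    (connected_induce_singleton v).preconnected hu rfl h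

/-- Attaching pendant vertices to a connected set keeps it connected. -/
theorem connected_induce_of_attached {S T : Set V} (hS : (G.induce S).Connected) (hST : S ⊆ T)
    (h : ∀ v ∈ T, v ∈ S ∨ ∃ u ∈ S, G.Adj v u) : (G.induce T).Connected := by
  obtain ⟨s, hs⟩ := hS.nonempty
  refine G.induce_connected_of_patches s (hST hs) fun {v} hv => ?_
  rcases h v hv with hvS | ⟨u, hu, huv⟩
  · exact ⟨S, hST, hs, hvS, hS.preconnected _ _⟩
  · exact ⟨insert v S, Set.insert_subset hv hST, Set.mem_insert_of_mem _ hs, Set.mem_insert _ _,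
      (connected_induce_insert hS hu huv.symm).preconnected _ _⟩

/-- A connected set can be trimmed to any smaller positive size around a given vertex. -/
theorem exists_connected_subset_card_eq [DecidableEq V] {S : Finset V}
    (hS : (G.induce (S : Set V)).Connected) {a : V} (ha : a ∈ S) {m : ℕ} (hm : 0 < m)
    (hmS : m ≤ #S) :
    ∃ T ⊆ S, a ∈ T ∧ #T = m ∧ (G.induce (T : Set V)).Connected := by
  induction m, hm using Nat.le_induction with
  | base =>
    exact ⟨{a}, by simpa using ha, by simp, by simp,
      by rw [coe_singleton]; exact connected_induce_singleton a⟩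
  | succ m hm ih =>
    obtain ⟨T, hTS, haT, hT, hc⟩ := ih (by omega)
    obtain ⟨b, hb, hbT⟩ := exists_mem_notMem_of_card_lt_card (show #T < #S by omega)
    obtain ⟨u, -, hu, v, hv, hvT, huv⟩ :=
      exists_adj_boundary_of_connected_induce (T := T) hS ha haT hb hbT
    refine ⟨insert v T, insert_subset hv hTS, mem_insert_of_mem haT, ?_, ?_⟩
    · rw [card_insert_of_notMem hvT, hT]
    · rw [coe_insert]
      exact connected_induce_insert hc hu huv

/-- A connected set splits into connected parts, one around each of some given vertices. -/
theorem exists_connected_parts {ι : Type*} [Finite V] [DecidableEq V] [Finite ι] [DecidableEq ι]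
    {E : Finset V} (hE : (G.induce (E : Set V)).Connected) {I : Finset ι} (hI : I.Nonempty)
    {c : ι → V} (hc : Function.Injective c) (hcE : ∀ i ∈ I, c i ∈ E) :
    ∃ A : ι → Finset V, (∀ i ∈ I, A i ⊆ E ∧ c i ∈ A i ∧ (G.induce (A i : Set V)).Connected) ∧
      (∀ i ∈ I, ∀ j ∈ I, ∀ v ∈ A i, v ∈ A j → i = j) ∧ ∀ v ∈ E, ∃ i ∈ I, v ∈ A i := by
  obtain ⟨A, ⟨hA, hdisj⟩, hmax⟩ := Set.exists_max_image
    {A : ι → Finset V |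
      (∀ i ∈ I, A i ⊆ E ∧ c i ∈ A i ∧ (G.induce (A i : Set V)).Connected) ∧
      ∀ i ∈ I, ∀ j ∈ I, ∀ v ∈ A i, v ∈ A j → i = j}
    (fun A => ∑ i ∈ I, #(A i)) (Set.toFinite _)
    ⟨fun i => {c i}, fun i hi => ⟨by simpa using hcE i hi, by simp,
      by rw [coe_singleton]; exact connected_induce_singleton (c i)⟩, fun i _ j _ v hv hv' => by
        simp only [mem_singleton] at hv hv'
        exact hc (hv.symm.trans hv')⟩
  refine ⟨A, hA, hdisj, ?_⟩
  by_contra! hcov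
  obtain ⟨w, hwE, hw⟩ := hcov
  obtain ⟨i₀, hi₀⟩ := hI
  obtain ⟨u, -, ⟨i, hi, hui⟩, v, hvE, hv, huv⟩ :=
    exists_adj_boundary_of_connected_induce (T := {x | ∃ i ∈ I, x ∈ A i}) hE
      (hcE i₀ hi₀) ⟨i₀, hi₀, (hA i₀ hi₀).2.1⟩ hwE (by simpa using hw)
  have hv' : ∀ j ∈ I, v ∉ A j := by simpa using hv
  have key := hmax (Function.update A i (insert v (A i))) ⟨fun j hj => ?_, ?_⟩
  · refine absurd key (not_le.2 (sum_lt_sum (fun j hj => ?_) ⟨i, hi, ?_⟩))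
    · rcases eq_or_ne j i with rfl | hji
      · simpa using card_le_card (subset_insert v (A j))
      · simp [hji]
    · simp [hv' i hi]
  · rcases eq_or_ne j i with rfl | hji
    · obtain ⟨h1, h2, h3⟩ := hA j hj
      rw [Function.update_self, coe_insert]
      exact ⟨insert_subset hvE h1, mem_insert_of_mem h2,
        connected_induce_insert h3 hui huv⟩
    · rw [Function.update_of_ne hji]
      exact hA j hj
  · intro j hj l hl x hx hx'
    have := hdisj j hj l hl x
    have h1 := hv' j hj
    have h2 := hv' l hl
    simp only [Function.update_apply] at hx hx'
    grind

end Connectivity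

section Growth

variable {V ι κ : Type*} [DecidableEq ι] {G : SimpleGraph V}

/-- A stage in growing connected sets around the vertices `c i`, `i ∈ I`. The set of `i` consists of
the vertices of `W` owned by `i`: a connected core `Q i` and vertices attached to this core. Cores
start inside `E`; the core of `i` may grow into the set `D d` once `i` has reserved it, which is
recorded as `b i = some d`, and from then on the set of `i` does not exceed its target `n i`. -/
structure IsGrowth (G : SimpleGraph V) (W E : Finset V) (I : Finset ι) (J : Finset κ)
    (D : κ → Finset V) (c : ι → V) (n : ι → ℕ)
    (f : V → ι) (Q : ι → Finset V) (b : ι → Option κ) : Prop where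
  owner_mem : ∀ v ∈ W, f v ∈ I
  owned : ∀ i ∈ I, ∀ v ∈ Q i, v ∈ W ∧ f v = i
  root_mem : ∀ i ∈ I, c i ∈ Q i
  connected : ∀ i ∈ I, (G.induce (Q i : Set V)).Connected
  attached : ∀ v ∈ W, v ∈ Q (f v) ∨ ∃ u ∈ Q (f v), G.Adj v u
  confined : ∀ i ∈ I, ∀ v ∈ Q i, v ∈ E ∨ ∃ d, b i = some d ∧ v ∈ D d
  card_core_le : ∀ i ∈ I, b i = none → #(Q i) ≤ n i
  card_owned_le : ∀ i ∈ I, b i ≠ none → #{v ∈ W | f v = i} ≤ n i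
  reserved_mem : ∀ i ∈ I, ∀ d, b i = some d → d ∈ J
  reserved_inj : ∀ i ∈ I, ∀ j ∈ I, ∀ d, b i = some d → b j = some d → i = j

/-- A measure of progress of a growth stage. -/
def growthRank (W : Finset V) (I : Finset ι) (f : V → ι) (Q : ι → Finset V)
    (b : ι → Option κ) : ℕ :=
  #{i ∈ I | b i ≠ none} + #{v ∈ W | b (f v) ≠ none} + ∑ i ∈ I, #(Q i)

variable {W E : Finset V} {I : Finset ι} {J : Finset κ}
  {D : κ → Finset V} {c : ι → V} {n : ι → ℕ} {f : V → ι} {Q : ι → Finset V} {b : ι → Option κ}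

/-- If some set is too small, then some set without a reservation is too large. -/
theorem IsGrowth.exists_excess (h : IsGrowth G W E I J D c n f Q b) (hsum : ∑ i ∈ I, n i ≤ #W)
    {j : ι} (hj : j ∈ I) (hlt : #{v ∈ W | f v = j} < n j) :
    ∃ i ∈ I, n i < #{v ∈ W | f v = i} ∧ b i = none := by
  have hW : #W = ∑ i ∈ I, #{v ∈ W | f v = i} := card_eq_sum_card_fiberwise h.owner_mem
  obtain ⟨i, hi, hlt'⟩ : ∃ i ∈ I, n i < #{v ∈ W | f v = i} := by
    by_contra! hle
    have := sum_lt_sum hle ⟨j, hj, hlt⟩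
    omega
  refine ⟨i, hi, hlt', ?_⟩
  by_contra hb
  exact absurd (h.card_owned_le i hi hb) (not_le.2 hlt')

/-- A set that is too small and has no reservation can reserve one of the `D d`. -/
theorem IsGrowth.reserve (h : IsGrowth G W E I J D c n f Q b) (hsum : ∑ i ∈ I, n i ≤ #W)
    (hIJ : #I ≤ #J + 1) {j : ι} (hj : j ∈ I) (hlt : #{v ∈ W | f v = j} < n j) (hbj : b j = none) :
    ∃ b' : ι → Option κ, IsGrowth G W E I J D c n f Q b' ∧
      growthRank W I f Q b < growthRank W I f Q b' := by
  obtain ⟨i, hi, hgt, hbi⟩ := h.exists_excess hsum hj hlt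
  have hij : i ≠ j := by
    rintro rfl
    omega
  obtain ⟨d, hdJ, hd⟩ : ∃ d ∈ J, ∀ l ∈ I, b l ≠ some d := by
    by_contra! hall
    have : Nonempty ι := ⟨j⟩
    choose! g hgI hg using hall
    have hle : #J ≤ #((I.erase i).erase j) := by
      refine card_le_card_of_injOn g (fun d hd => ?_) fun d hd d' hd' hdd => ?_
      · have := hg d hd
        have := hgI d hd
        simp only [coe_erase, Set.mem_sdiff, mem_coe, Set.mem_singleton_iff]
        grind
      · have h1 := hg d hd
        have h2 := hg d' hd'
        grind
    rw [card_erase_of_mem (by simp [hj, hij.symm]), card_erase_of_mem hi] at hle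
    have : 1 < #I := one_lt_card.2 ⟨i, hi, j, hj, hij⟩
    omega
  have hmono : ∀ l, b l ≠ none → Function.update b j (some d) l ≠ none := by
    intro l
    simp only [Function.update_apply]
    split_ifs <;> simp
  refine ⟨Function.update b j (some d), { h with
    confined := ?_, card_core_le := ?_, card_owned_le := ?_, reserved_mem := ?_,
    reserved_inj := ?_ }, ?_⟩
  · intro l hl v hv
    have := h.confined l hl v hv
    simp only [Function.update_apply]
    grind
  · intro l hl
    have := h.card_core_le l hl
    simp only [Function.update_apply]
    grind
  · intro l hl hbl
    rcases eq_or_ne l j with rfl | hlj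
    · exact hlt.le
    · exact h.card_owned_le l hl (by simpa [hlj] using hbl)
  · intro l hl e
    have := h.reserved_mem l hl e
    simp only [Function.update_apply]
    grind
  · intro l hl l' hl' e
    have := h.reserved_inj l hl l' hl' e
    simp only [Function.update_apply]
    grind
  · have h1 : #{l ∈ I | b l ≠ none} < #{l ∈ I | Function.update b j (some d) l ≠ none} := by
      refine card_lt_card (ssubset_iff_of_subset ?_ |>.2 ⟨j, by simp [hj], by simp [hbj]⟩)
      exact monotone_filter_right _ fun l _ => hmono l
    have h2 : #{v ∈ W | b (f v) ≠ none} ≤ #{v ∈ W | Function.update b j (some d) (f v) ≠ none} :=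
      card_le_card (monotone_filter_right _ fun v _ => hmono (f v))
    unfold growthRank
    omega

variable [DecidableEq V]

/-- Moving a vertex outside all other cores to a set with a reservation that is too small, given
that the new core contains the old one and dominates the moved vertex. -/
theorem IsGrowth.move (h : IsGrowth G W E I J D c n f Q b) {j : ι} (hj : j ∈ I)
    (hlt : #{v ∈ W | f v = j} < n j) (hbj : b j ≠ none) {v : V} (hvW : v ∈ W)
    (hvQ : ∀ i ∈ I, i ≠ j → v ∉ Q i) {R : Finset V} (hQR : Q j ⊆ R) (hRv : R ⊆ insert v (Q j))
    (hR : (G.induce (R : Set V)).Connected) (hRc : ∀ u ∈ R, u ∈ E ∨ ∃ d, b j = some d ∧ u ∈ D d)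
    (hv : v ∈ R ∨ ∃ u ∈ R, G.Adj v u) :
    IsGrowth G W E I J D c n (Function.update f v j) (Function.update Q j R) b := by
  have hQmono : ∀ l, Q l ⊆ Function.update Q j R l := by
    intro l
    rcases eq_or_ne l j with rfl | hl
    · simpa using hQR
    · simp [hl]
  refine { h with
    owner_mem := ?_, owned := ?_, root_mem := fun i hi => hQmono i (h.root_mem i hi),
    connected := ?_, attached := ?_, confined := ?_, card_core_le := ?_, card_owned_le := ?_ }
  · intro w hw
    have := h.owner_mem w hw
    simp only [Function.update_apply]
    grind
  · intro i hi w hw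
    have := h.owned i hi w
    have := hvQ i hi
    have := @hRv w
    simp only [Function.update_apply] at hw ⊢
    grind
  · intro i hi
    rcases eq_or_ne i j with rfl | hij
    · rwa [Function.update_self]
    · rw [Function.update_of_ne hij]
      exact h.connected i hi
  · intro w hw
    rcases eq_or_ne w v with rfl | hwv
    · simpa using hv
    · rw [Function.update_of_ne hwv]
      exact (h.attached w hw).imp (@hQmono _ _) fun ⟨u, hu, huw⟩ => ⟨u, hQmono _ hu, huw⟩
  · intro i hi w hw
    have := h.confined i hi w
    have := hRc w
    simp only [Function.update_apply] at hw
    grind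
  · intro i hi hbi
    rw [Function.update_of_ne (by rintro rfl; exact hbj hbi)]
    exact h.card_core_le i hi hbi
  · intro i hi hbi
    rcases eq_or_ne i j with rfl | hij
    · have : {w ∈ W | Function.update f v i w = i} ⊆ insert v {w ∈ W | f w = i} := by
        intro w
        simp only [Function.update_apply, mem_filter, mem_insert]
        grind
      have := (card_le_card this).trans (card_insert_le _ _)
      omega
    · refine (card_le_card ?_).trans (h.card_owned_le i hi hbi)
      intro w
      simp only [Function.update_apply, mem_filter]
      grind

/-- A growth stage with a set that is too small can be improved. -/
theorem IsGrowth.exists_growthRank_lt (h : IsGrowth G W E I J D c n f Q b)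
    (hsum : ∑ i ∈ I, n i ≤ #W) (hIJ : #I ≤ #J + 1)
    (hcD : ∀ i ∈ I, ∀ d ∈ J, c i ∉ D d) (hDW : ∀ d ∈ J, D d ⊆ W)
    (hDE : ∀ d ∈ J, Disjoint (D d) E) (hDD : Pairwise fun d e => Disjoint (D d) (D e))
    (hDc : ∀ d ∈ J, (G.induce (D d : Set V)).Connected)
    (hdom : ∀ d ∈ J, ∀ v, v ∈ D d ∨ ∃ u ∈ D d, G.Adj v u)
    {j : ι} (hj : j ∈ I) (hlt : #{v ∈ W | f v = j} < n j) :
    ∃ f' Q' b', IsGrowth G W E I J D c n f' Q' b' ∧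
      growthRank W I f Q b < growthRank W I f' Q' b' := by
  rcases hbj : b j with _ | d
  · obtain ⟨b', hb', hr⟩ := h.reserve hsum hIJ hj hlt hbj
    exact ⟨f, Q, b', hb', hr⟩
  have hdJ := h.reserved_mem j hj d hbj
  have hbj' : b j ≠ none := by simp [hbj]
  have howned : ∀ v, {w ∈ W | b (f w) ≠ none} ⊆
      {w ∈ W | b (Function.update f v j w) ≠ none} := by
    intro v w
    simp only [Function.update_apply, mem_filter]
    grind
  by_cases hfull : D d ⊆ Q j
  · obtain ⟨i, hi, hgt, hbi⟩ := h.exists_excess hsum hj hlt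
    obtain ⟨v, hv, hvQ⟩ :=
      exists_mem_notMem_of_card_lt_card ((h.card_core_le i hi hbi).trans_lt hgt)
    obtain ⟨hvW, hfv⟩ := mem_filter.1 hv
    have hvQ' : ∀ l ∈ I, l ≠ j → v ∉ Q l := by
      intro l hl _ hvl
      obtain rfl := (h.owned l hl v hvl).2.symm.trans hfv
      exact hvQ hvl
    refine ⟨_, _, b, h.move hj hlt hbj' hvW hvQ' subset_rfl (subset_insert _ _)
      (h.connected j hj) (h.confined j hj) ?_, ?_⟩
    · exact (hdom d hdJ v).imp (@hfull _) fun ⟨u, hu, huv⟩ => ⟨u, hfull hu, huv⟩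
    · have : #{w ∈ W | b (f w) ≠ none} < #{w ∈ W | b (Function.update f v j w) ≠ none} :=
        card_lt_card (ssubset_iff_of_subset (howned v) |>.2
          ⟨v, by simp [hvW, hbj], by simp [hfv, hbi]⟩)
      rw [Function.update_eq_self]
      unfold growthRank
      omega
  · obtain ⟨w, hwD, hwQ⟩ := not_subset.1 hfull
    obtain ⟨u, huQ, v, hvD, hvQ, huv⟩ : ∃ u ∈ Q j, ∃ v ∈ D d, v ∉ Q j ∧ G.Adj u v := by
      rcases hdom d hdJ (c j) with hc | ⟨u, hu, hcu⟩
      · exact absurd hc (hcD j hj d hdJ)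
      · by_cases huQ : u ∈ Q j
        · obtain ⟨x, -, hx, y, hy, hyQ, hxy⟩ :=
            exists_adj_boundary_of_connected_induce (T := Q j) (hDc d hdJ) hu huQ hwD hwQ
          exact ⟨x, hx, y, hy, hyQ, hxy⟩
        · exact ⟨c j, h.root_mem j hj, u, hu, huQ, hcu⟩
    have hvQ' : ∀ l ∈ I, l ≠ j → v ∉ Q l := by
      intro l hl hlj hvl
      rcases h.confined l hl v hvl with hvE | ⟨e, he, hve⟩
      · exact disjoint_left.1 (hDE d hdJ) hvD hvE
      · have hed : e = d := by
          by_contra hne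
          exact disjoint_left.1 (hDD hne) hve hvD
        exact hlj (h.reserved_inj l hl j hj d (hed ▸ he) hbj)
    refine ⟨_, _, b, h.move hj hlt hbj' (hDW d hdJ hvD) hvQ' (subset_insert v _) subset_rfl
      ?_ ?_ (Or.inl (mem_insert_self _ _)), ?_⟩
    · rw [coe_insert]
      exact connected_induce_insert (h.connected j hj) huQ huv
    · intro x hx
      rcases mem_insert.1 hx with rfl | hx
      · exact Or.inr ⟨d, hbj, hvD⟩
      · exact h.confined j hj x hx
    · have h1 : ∑ i ∈ I, #(Q i) < ∑ i ∈ I, #(Function.update Q j (insert v (Q j)) i) := by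
        refine sum_lt_sum (fun i _ => ?_) ⟨j, hj, by simp [hvQ]⟩
        rcases eq_or_ne i j with rfl | hij
        · simpa using card_le_card (subset_insert v (Q i))
        · simp [hij]
      have h2 := card_le_card (howned v)
      unfold growthRank
      omega

end Growth

section Packing

variable {V ι κ : Type*} {G : SimpleGraph V}

/-- The sets `P i`, `i ∈ I`, are disjoint connected subsets of `W` of sizes `n i`, each containing
the prescribed vertex `c i`. -/
structure IsConnectedPacking (G : SimpleGraph V) (W : Finset V) (I : Finset ι) (c : ι → V)
    (n : ι → ℕ) (P : ι → Finset V) : Prop where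
  subset : ∀ i ∈ I, P i ⊆ W
  root_mem : ∀ i ∈ I, c i ∈ P i
  card_eq : ∀ i ∈ I, #(P i) = n i
  connected : ∀ i ∈ I, (G.induce (P i : Set V)).Connected
  disjoint : ∀ i ∈ I, ∀ j ∈ I, i ≠ j → Disjoint (P i) (P j)

variable [DecidableEq V] {W E U : Finset V} {I I₁ : Finset ι} {J : Finset κ}
  {D : κ → Finset V} {c : ι → V} {n : ι → ℕ} {P : ι → Finset V}

theorem IsConnectedPacking.card_biUnion (h : IsConnectedPacking G W I c n P) :
    #(I.biUnion P) = ∑ i ∈ I, n i := by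
  rw [Finset.card_biUnion h.disjoint]
  exact sum_congr rfl h.card_eq

/-- A packing extends by a packing of the remaining vertices. -/
theorem IsConnectedPacking.extend [DecidableEq ι] {Q : ι → Finset V}
    (hP : IsConnectedPacking G U I₁ c n P) (hU : U ⊆ W)
    (hQ : IsConnectedPacking G (W \ I₁.biUnion P) (I \ I₁) c n Q) :
    IsConnectedPacking G W I c n (fun i => if i ∈ I₁ then P i else Q i) := by
  have hQP : ∀ i ∈ I, i ∉ I₁ → ∀ j ∈ I₁, Disjoint (Q i) (P j) := by
    intro i hi hi₁ j hj
    exact disjoint_of_subset_left (hQ.subset i (mem_sdiff.2 ⟨hi, hi₁⟩))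
      (disjoint_of_subset_right (subset_biUnion_of_mem P hj) sdiff_disjoint)
  constructor
  · intro i hi
    split_ifs with h
    · exact (hP.subset i h).trans hU
    · exact (hQ.subset i (mem_sdiff.2 ⟨hi, h⟩)).trans sdiff_subset
  · intro i hi
    split_ifs with h
    · exact hP.root_mem i h
    · exact hQ.root_mem i (mem_sdiff.2 ⟨hi, h⟩)
  · intro i hi
    split_ifs with h
    · exact hP.card_eq i h
    · exact hQ.card_eq i (mem_sdiff.2 ⟨hi, h⟩)
  · intro i hi
    by_cases h : i ∈ I₁
    · rw [if_pos h]
      exact hP.connected i h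
    · rw [if_neg h]
      exact hQ.connected i (mem_sdiff.2 ⟨hi, h⟩)
  · intro i hi j hj hij
    split_ifs with h h' h'
    · exact hP.disjoint i h j h' hij
    · exact (hQP j hj h' i h).symm
    · exact hQP i hi h j h'
    · exact hQ.disjoint i (mem_sdiff.2 ⟨hi, h⟩) j (mem_sdiff.2 ⟨hj, h'⟩) hij

/-- If a dominating set `E` is split into connected parts, none of them too large, around the
prescribed vertices, then these parts grow into a packing, using all but one as many disjoint
connected dominating sets outside `E` as there are parts. -/
theorem exists_connectedPacking_of_parts [Finite V] [Finite ι] [Finite κ]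
    {A : ι → Finset V}
    (hAE : ∀ i ∈ I, A i ⊆ E ∧ c i ∈ A i ∧ (G.induce (A i : Set V)).Connected)
    (hAdisj : ∀ i ∈ I, ∀ j ∈ I, ∀ v ∈ A i, v ∈ A j → i = j) (hcov : ∀ v ∈ E, ∃ i ∈ I, v ∈ A i)
    (hAn : ∀ i ∈ I, #(A i) ≤ n i) (hn : ∀ i, 0 < n i)
    (hEW : E ⊆ W) (hEdom : ∀ v, v ∈ E ∨ ∃ u ∈ E, G.Adj v u)
    (hsum : ∑ i ∈ I, n i ≤ #W) (hIJ : #I ≤ #J + 1) (hDW : ∀ d ∈ J, D d ⊆ W)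
    (hDE : ∀ d ∈ J, Disjoint (D d) E) (hDD : Pairwise fun d e => Disjoint (D d) (D e))
    (hDc : ∀ d ∈ J, (G.induce (D d : Set V)).Connected)
    (hdom : ∀ d ∈ J, ∀ v, v ∈ D d ∨ ∃ u ∈ D d, G.Adj v u) :
    ∃ P, IsConnectedPacking G W I c n P := by
  classical
  obtain ⟨f, hfI, hf⟩ : ∃ f : V → ι, (∀ v, f v ∈ I) ∧
      ∀ v, v ∈ A (f v) ∨ v ∉ E ∧ ∃ u ∈ A (f v), G.Adj v u := by
    have : ∀ v, ∃ i ∈ I, v ∈ A i ∨ v ∉ E ∧ ∃ u ∈ A i, G.Adj v u := by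
      intro v
      by_cases hv : v ∈ E
      · obtain ⟨i, hi, hvi⟩ := hcov v hv
        exact ⟨i, hi, Or.inl hvi⟩
      · obtain ⟨u, hu, hvu⟩ := (hEdom v).resolve_left hv
        obtain ⟨i, hi, hui⟩ := hcov u hu
        exact ⟨i, hi, Or.inr ⟨hv, u, hui, hvu⟩⟩
    choose f hfI hf using this
    exact ⟨f, hfI, hf⟩
  have hinit : IsGrowth G W E I J D c n f A fun _ => none :=
    { owner_mem := fun v _ => hfI v
      owned := fun i hi v hv => by
        have hvE := (hAE i hi).1 hv
        exact ⟨hEW hvE, hAdisj _ (hfI v) i hi v ((hf v).resolve_right fun h => h.1 hvE) hv⟩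
      root_mem := fun i hi => (hAE i hi).2.1
      connected := fun i hi => (hAE i hi).2.2
      attached := fun v _ => (hf v).imp_right And.right
      confined := fun i hi v hv => Or.inl ((hAE i hi).1 hv)
      card_core_le := fun i hi _ => hAn i hi
      card_owned_le := by simp
      reserved_mem := by simp
      reserved_inj := by simp }
  obtain ⟨⟨f, Q, b⟩, h, hmax⟩ := Set.exists_max_image
    {s : (V → ι) × (ι → Finset V) × (ι → Option κ) |
      IsGrowth G W E I J D c n s.1 s.2.1 s.2.2}
    (fun s => growthRank W I s.1 s.2.1 s.2.2) (Set.toFinite _) ⟨(f, A, fun _ => none), hinit⟩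
  replace h : IsGrowth G W E I J D c n f Q b := h
  have hlarge : ∀ i ∈ I, n i ≤ #{v ∈ W | f v = i} := by
    intro i hi
    by_contra! hlt
    obtain ⟨f', Q', b', h', hr⟩ := h.exists_growthRank_lt hsum hIJ
      (fun j hj d hd hcd => disjoint_left.1 (hDE d hd) hcd ((hAE j hj).1 (hAE j hj).2.1))
      hDW hDE hDD hDc hdom hi hlt
    exact absurd (hmax (f', Q', b') h') (not_le.2 hr)
  have htrim : ∀ i ∈ I, ∃ T ⊆ {v ∈ W | f v = i}, c i ∈ T ∧ #T = n i ∧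
      (G.induce (T : Set V)).Connected := by
    intro i hi
    have hsub : Q i ⊆ {v ∈ W | f v = i} := fun v hv => mem_filter.2 (h.owned i hi v hv)
    refine exists_connected_subset_card_eq ?_ (hsub (h.root_mem i hi)) (hn i) (hlarge i hi)
    refine connected_induce_of_attached (h.connected i hi) (coe_subset.2 hsub) fun v hv => ?_
    obtain ⟨hvW, rfl⟩ := mem_filter.1 (mem_coe.1 hv)
    exact h.attached v hvW
  choose! P hPsub hPc hPn hPconn using htrim
  refine ⟨P, fun i hi => (hPsub i hi).trans (filter_subset _ _), hPc, hPn, hPconn, ?_⟩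
  intro i hi j hj hij
  refine disjoint_left.2 fun v hv hv' => hij ?_
  exact (mem_filter.1 (hPsub i hi hv)).2.symm.trans (mem_filter.1 (hPsub j hj hv')).2

/-- Given as many disjoint connected dominating sets as prescribed vertices, all inside `W`, there
is a packing inside `W` for any sizes that fit. -/
theorem exists_connectedPacking [Finite V] [Finite ι] [Finite κ] [DecidableEq ι]
    (hc : Function.Injective c) (hn : ∀ i, 0 < n i)
    (hDD : Pairwise fun d e => Disjoint (D d) (D e))
    (hDc : ∀ d, (G.induce (D d : Set V)).Connected)
    (hdom : ∀ d v, v ∈ D d ∨ ∃ u ∈ D d, G.Adj v u)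
    (I : Finset ι) (J : Finset κ) (W : Finset V) (hIJ : #J = #I) (hcW : ∀ i ∈ I, c i ∈ W)
    (hDW : ∀ d ∈ J, D d ⊆ W) (hsum : ∑ i ∈ I, n i ≤ #W) :
    ∃ P, IsConnectedPacking G W I c n P := by
  classical
  induction I using Finset.strongInduction generalizing J W with | H I ih
  have step : ∀ I₁ ⊆ I, I₁.Nonempty → ∀ J₁ ⊆ J, #J₁ = #I₁ → ∀ U ⊆ W,
      (∀ i ∈ I \ I₁, c i ∉ U) → (∀ d ∈ J \ J₁, Disjoint (D d) U) →
      (∃ P, IsConnectedPacking G U I₁ c n P) → ∃ P, IsConnectedPacking G W I c n P := by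
    rintro I₁ hI₁ hne J₁ hJ₁ hcard U hU hcU hDU ⟨P, hP⟩
    have hPU : I₁.biUnion P ⊆ U := biUnion_subset.2 hP.subset
    obtain ⟨Q, hQ⟩ := ih (I \ I₁) (sdiff_ssubset hI₁ hne) (J \ J₁) (W \ I₁.biUnion P)
      (by rw [card_sdiff_of_subset hI₁, card_sdiff_of_subset hJ₁, hIJ, hcard])
      (fun i hi => mem_sdiff.2
        ⟨hcW i (mem_sdiff.1 hi).1, fun h => hcU i hi (hPU h)⟩)
      (fun d hd => subset_sdiff.2
        ⟨hDW d (mem_sdiff.1 hd).1, disjoint_of_subset_right hPU (hDU d hd)⟩)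
      (by
        rw [card_sdiff_of_subset (hPU.trans hU), hP.card_biUnion]
        have := sum_sdiff (f := n) hI₁
        omega)
    exact ⟨_, hP.extend hU hQ⟩
  rcases I.eq_empty_or_nonempty with rfl | hI
  · exact ⟨fun _ => ∅, by constructor <;> simp⟩
  obtain ⟨e, heJ, he⟩ : ∃ e ∈ J, (∃ d ∈ J, ∃ i ∈ I, c i ∈ D d) → ∃ i ∈ I, c i ∈ D e := by
    by_cases h : ∃ d ∈ J, ∃ i ∈ I, c i ∈ D d
    · obtain ⟨d, hd, h'⟩ := h
      exact ⟨d, hd, fun _ => h'⟩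
    · obtain ⟨d, hd⟩ : J.Nonempty := by
        rw [← card_pos, hIJ]
        exact hI.card_pos
      exact ⟨d, hd, fun h' => absurd h' h⟩
  by_cases hfree : ∀ d ∈ J, d ≠ e → ∀ i ∈ I, c i ∉ D d
  · set E := D e ∪ I.image c with hE
    have hEW : E ⊆ W := union_subset (hDW e heJ) (image_subset_iff.2 hcW)
    have hEconn : (G.induce (E : Set V)).Connected :=
      connected_induce_of_attached (hDc e) (coe_subset.2 subset_union_left) fun v _ => hdom e v
    have hDE : ∀ d ∈ J.erase e, Disjoint (D d) E := by
      intro d hd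
      obtain ⟨hde, hdJ⟩ := mem_erase.1 hd
      refine disjoint_union_right.2 ⟨hDD hde, disjoint_right.2 fun v hv => ?_⟩
      obtain ⟨i, hi, rfl⟩ := mem_image.1 hv
      exact hfree d hdJ hde i hi
    obtain ⟨A, hA, hAdisj, hAcov⟩ := exists_connected_parts hEconn hI hc
      fun i hi => mem_union_right _ (mem_image_of_mem c hi)
    by_cases hsmall : ∀ i ∈ I, #(A i) ≤ n i
    · refine exists_connectedPacking_of_parts (J := J.erase e) hA hAdisj hAcov hsmall hn hEW
        ?_ hsum ?_ (fun d hd => hDW d (mem_of_mem_erase hd)) hDE hDD (fun d _ => hDc d)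
        fun d _ => hdom d
      · exact fun v => (hdom e v).imp (mem_union_left _) fun ⟨u, hu, hvu⟩ =>
          ⟨u, mem_union_left _ hu, hvu⟩
      · rw [card_erase_of_mem heJ]
        omega
    · push Not at hsmall
      obtain ⟨i, hi, hlt⟩ := hsmall
      obtain ⟨hAE, hcA, hAc⟩ := hA i hi
      obtain ⟨T, hTA, hcT, hT, hTc⟩ := exists_connected_subset_card_eq hAc hcA (hn i) hlt.le
      refine step {i} (by simpa) (by simp) {e} (by simpa) rfl (A i) (hAE.trans hEW) ?_ ?_
        ⟨fun _ => T, ?_⟩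
      · intro j hj hcj
        rw [mem_sdiff, mem_singleton] at hj
        exact hj.2 (hAdisj j hj.1 i hi (c j) (hA j hj.1).2.1 hcj)
      · intro d hd
        rw [sdiff_singleton_eq_erase] at hd
        exact disjoint_of_subset_right hAE (hDE d hd)
      · constructor <;> simp_all
  · push Not at hfree
    obtain ⟨d₁, hd₁, hd₁e, i₁, hi₁, hcd₁⟩ := hfree
    obtain ⟨i₀, hi₀, hci₀⟩ := he ⟨d₁, hd₁, i₁, hi₁, hcd₁⟩
    have huniq : ∀ d d' v, v ∈ D d → v ∈ D d' → d = d' := by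
      intro d d' v hv hv'
      by_contra hne
      exact disjoint_left.1 (hDD hne) hv hv'
    set I₁ := {i ∈ I | c i ∈ D e} with hI₁
    set F := {d ∈ J | ∀ i ∈ I, c i ∉ D d} with hF
    have hI₁I : I₁ ⊆ I := filter_subset _ _
    have hI₁ne : I₁.Nonempty := ⟨i₀, by simp [hI₁, hi₀, hci₀]⟩
    have hi₁I₁ : i₁ ∈ I \ I₁ := by
      simp only [hI₁, mem_sdiff, mem_filter, not_and]
      exact ⟨hi₁, fun _ h => hd₁e (huniq _ _ _ hcd₁ h)⟩
    have hFJ : insert e F ⊆ J := insert_subset heJ (filter_subset _ _)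
    have hcardF : #I₁ ≤ #(insert e F) := by
      have hex : ∀ d ∈ J \ insert e F, ∃ i ∈ I, c i ∈ D d := by
        intro d hd
        simp only [hF, mem_sdiff, mem_insert, mem_filter] at hd
        grind
      have : Nonempty ι := ⟨i₀⟩
      choose! g hgI hg using hex
      have hle : #(J \ insert e F) ≤ #(I \ I₁) := by
        refine card_le_card_of_injOn g (fun d hd => ?_) fun d hd d' hd' hdd => ?_
        · refine mem_coe.2 (mem_sdiff.2 ⟨hgI d hd, fun h => ?_⟩)
          have := huniq _ _ _ (hg d hd) (mem_filter.1 h).2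
          rw [mem_coe, mem_sdiff, this] at hd
          exact hd.2 (mem_insert_self _ _)
        · exact huniq _ _ _ (hg d hd) (hdd ▸ hg d' hd')
      rw [card_sdiff_of_subset hFJ, card_sdiff_of_subset hI₁I] at hle
      have := card_le_card hI₁I
      have := card_le_card hFJ
      omega
    obtain ⟨J₁, heJ₁, hJ₁F, hJ₁⟩ := exists_subsuperset_card_eq
      (singleton_subset_iff.2 (mem_insert_self e F)) (by simpa using hI₁ne) hcardF
    have hJ₁J := hJ₁F.trans hFJ
    set U := J₁.biUnion D with hU
    have hUW : U ⊆ W := biUnion_subset.2 fun d hd => hDW d (hJ₁J hd)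
    have hcU : ∀ i ∈ I₁, c i ∈ U := fun i hi =>
      mem_biUnion.2 ⟨e, heJ₁ (mem_singleton_self e), (mem_filter.1 hi).2⟩
    have hcU' : ∀ i ∈ I \ I₁, c i ∉ U := by
      intro i hi hiU
      obtain ⟨d, hd, hcd⟩ := mem_biUnion.1 hiU
      obtain ⟨hiI, hiI₁⟩ := mem_sdiff.1 hi
      rcases mem_insert.1 (hJ₁F hd) with rfl | hdF
      · exact hiI₁ (mem_filter.2 ⟨hiI, hcd⟩)
      · exact (mem_filter.1 hdF).2 i hiI hcd
    have hDU : ∀ d ∈ J \ J₁, Disjoint (D d) U := by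
      intro d hd
      refine (disjoint_biUnion_right _ _ _).2 fun d' hd' => hDD ?_
      rintro rfl
      exact (mem_sdiff.1 hd).2 hd'
    have hI₁ss : I₁ ⊂ I := ssubset_iff_of_subset hI₁I |>.2 ⟨i₁, hi₁, (mem_sdiff.1 hi₁I₁).2⟩
    by_cases hs : ∑ i ∈ I₁, n i ≤ #U
    · exact step I₁ hI₁I hI₁ne J₁ hJ₁J hJ₁ U hUW hcU' hDU
        (ih I₁ hI₁ss J₁ U hJ₁ hcU (fun d hd => subset_biUnion_of_mem D hd) hs)
    · have hcard : #(J \ J₁) = #(I \ I₁) := by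
        rw [card_sdiff_of_subset hI₁I, card_sdiff_of_subset hJ₁J, hIJ, hJ₁]
      refine step (I \ I₁) sdiff_subset ⟨i₁, hi₁I₁⟩ (J \ J₁) sdiff_subset hcard (W \ U)
        sdiff_subset ?_ ?_ (ih (I \ I₁) (sdiff_ssubset hI₁I hI₁ne) (J \ J₁) (W \ U) hcard ?_ ?_ ?_)
      · intro i hi
        rw [Finset.sdiff_sdiff_eq_self hI₁I] at hi
        simp [hcU i hi]
      · intro d hd
        rw [Finset.sdiff_sdiff_eq_self hJ₁J] at hd
        exact disjoint_of_subset_left (subset_biUnion_of_mem D hd) disjoint_sdiff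
      · exact fun i hi => mem_sdiff.2 ⟨hcW i (mem_sdiff.1 hi).1, hcU' i hi⟩
      · exact fun d hd => subset_sdiff.2 ⟨hDW d (mem_sdiff.1 hd).1, hDU d hd⟩
      · rw [card_sdiff_of_subset hUW]
        have := sum_sdiff (f := n) hI₁I
        omega

end Packing

/-- A GL-partition exists whenever the graph admits a CDS partition of size `k`. -/
theorem gl_partition_of_cds_partition {V : Type} [Fintype V] [DecidableEq V]
    (G : SimpleGraph V) (k : ℕ)
    (c : Fin k → V) (hc : Function.Injective c)
    (n : Fin k → ℕ) (hpos : ∀ i, 0 < n i)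
    (hsum : ∑ i, n i = Fintype.card V)
    (hcds : HasCDSPartition G k) :
    ∃ P : Fin k → Set V,
      (Pairwise fun i j => Disjoint (P i) (P j)) ∧
      (⋃ i, P i) = Set.univ ∧
      ∀ i, (P i).ncard = n i ∧ c i ∈ P i ∧ (G.induce (P i)).Connected := by
  classical
  obtain ⟨D, hDD, -, hD⟩ := hcds
  obtain ⟨P, hP⟩ := exists_connectedPacking (G := G) (D := fun d => (D d).toFinset) hc hpos
    (fun d e hde => Set.disjoint_toFinset.2 (hDD hde))
    (fun d => by rw [Set.coe_toFinset]; exact (hD d).1)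
    (fun d v => by simpa using (hD d).2 v)
    univ univ univ rfl (by simp) (by simp) (by simp [hsum])
  have hcover : univ.biUnion P = univ := by
    rw [← card_eq_iff_eq_univ, hP.card_biUnion, hsum]
  refine ⟨fun i => P i,
    fun i j hij => disjoint_coe.2 (hP.disjoint i (mem_univ i) j (mem_univ j) hij), ?_,
    fun i => ⟨?_, hP.root_mem i (mem_univ i), hP.connected i (mem_univ i)⟩⟩
  · simpa using congrArg (fun s : Finset V => (s : Set V)) hcover
  · rw [Set.ncard_coe_finset]
    exact hP.card_eq i (mem_univ i)
end

section
/- There is a constant c > 0 such that every k-connected graph on n ≥ 2 vertices admits a CDS partition of size m for every positive integer m with m ≤ c · k / (log n)^2. -/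
namespace CDS

open Finset
open scoped Classical

section Expectation

/-- Expectation of `g` with respect to the weights `μ` on a finite type. -/
noncomputable def ex {Ω : Type*} [Fintype Ω] (μ : Ω → ℝ) (g : Ω → ℝ) : ℝ := ∑ w, μ w * g w

/-- The indicator of a proposition. -/
noncomputable def ind (p : Prop) : ℝ := if p then 1 else 0

/-- Probability of the event `E` with respect to the weights `μ`. -/
noncomputable def pr {Ω : Type*} [Fintype Ω] (μ : Ω → ℝ) (E : Ω → Prop) : ℝ :=
  ex μ fun w => ind (E w)

/-- The weights `μ` form a probability distribution. -/
structure IsProb {Ω : Type*} [Fintype Ω] (μ : Ω → ℝ) : Prop where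
  nonneg : ∀ w, 0 ≤ μ w
  sum_one : ∑ w, μ w = 1

/-- The product distribution. -/
def prodW {Ω Ω' : Type*} (μ : Ω → ℝ) (ν : Ω' → ℝ) : Ω × Ω' → ℝ := fun p => μ p.1 * ν p.2

/-- The distribution of independent labels, one for each `v : V`, each distributed like `ω`. -/
noncomputable def pw (V : Type*) [Fintype V] {Λ : Type*} (ω : Λ → ℝ) : (V → Λ) → ℝ :=
  fun f => ∏ v, ω (f v)

variable {Ω Ω' : Type*} [Fintype Ω] [Fintype Ω'] {μ : Ω → ℝ} {ν : Ω' → ℝ}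

lemma ind_of {p : Prop} (h : p) : ind p = 1 := if_pos h

lemma ind_of_not {p : Prop} (h : ¬ p) : ind p = 0 := if_neg h

lemma ind_nonneg (p : Prop) : 0 ≤ ind p := by
  by_cases h : p <;> simp [ind, h]

lemma ind_le_one (p : Prop) : ind p ≤ 1 := by
  by_cases h : p <;> simp [ind, h]

lemma ind_mono {p q : Prop} (h : p → q) : ind p ≤ ind q := by
  by_cases hp : p
  · simp [ind, hp, h hp]
  · simpa [ind, hp] using ind_nonneg q

lemma ex_mono (hμ : IsProb μ) {g h : Ω → ℝ} (hgh : ∀ w, g w ≤ h w) : ex μ g ≤ ex μ h :=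
  sum_le_sum fun w _ => mul_le_mul_of_nonneg_left (hgh w) (hμ.nonneg w)

lemma ex_const (hμ : IsProb μ) (c : ℝ) : ex μ (fun _ => c) = c := by
  simp [ex, ← sum_mul, hμ.sum_one]

lemma ex_add (g h : Ω → ℝ) : ex μ (fun w => g w + h w) = ex μ g + ex μ h := by
  simp [ex, mul_add, sum_add_distrib]

lemma ex_sub (g h : Ω → ℝ) : ex μ (fun w => g w - h w) = ex μ g - ex μ h := by
  simp [ex, mul_sub, sum_sub_distrib]

lemma ex_const_mul (c : ℝ) (g : Ω → ℝ) : ex μ (fun w => c * g w) = c * ex μ g := by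
  simp only [ex, mul_sum]
  exact sum_congr rfl fun w _ => by ring

lemma ex_sum {ι : Type*} (s : Finset ι) (g : ι → Ω → ℝ) :
    ex μ (fun w => ∑ i ∈ s, g i w) = ∑ i ∈ s, ex μ (g i) := by
  simp only [ex, mul_sum]
  exact sum_comm

lemma ex_comm (g : Ω → Ω' → ℝ) :
    ex μ (fun w => ex ν (g w)) = ex ν (fun w' => ex μ fun w => g w w') := by
  simp only [ex, mul_sum]
  rw [sum_comm]
  exact sum_congr rfl fun w _ => sum_congr rfl fun w' _ => by ring

lemma exists_le_ex (hμ : IsProb μ) (g : Ω → ℝ) : ∃ w, g w ≤ ex μ g := by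
  by_contra! h
  have h1 : ∀ w ∈ univ, μ w * ex μ g ≤ μ w * g w := fun w _ =>
    mul_le_mul_of_nonneg_left (h w).le (hμ.nonneg w)
  obtain ⟨w, hw⟩ : ∃ w, 0 < μ w := by
    by_contra! h0
    have := sum_nonpos fun w (_ : w ∈ univ) => h0 w
    rw [hμ.sum_one] at this
    linarith
  have h2 := sum_lt_sum h1 ⟨w, mem_univ w, mul_lt_mul_of_pos_left (h w) hw⟩
  rw [← sum_mul, hμ.sum_one, one_mul] at h2
  exact lt_irrefl _ h2

lemma pr_nonneg (hμ : IsProb μ) (E : Ω → Prop) : 0 ≤ pr μ E :=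
  sum_nonneg fun w _ => mul_nonneg (hμ.nonneg w) (ind_nonneg _)

lemma pr_mono (hμ : IsProb μ) {E F : Ω → Prop} (h : ∀ w, E w → F w) : pr μ E ≤ pr μ F :=
  ex_mono hμ fun w => ind_mono (h w)

lemma pr_exists_le (hμ : IsProb μ) {ι : Type*} (s : Finset ι) (E : ι → Ω → Prop) :
    pr μ (fun w => ∃ i ∈ s, E i w) ≤ ∑ i ∈ s, pr μ (E i) := by
  unfold pr
  rw [← ex_sum]
  refine ex_mono hμ fun w => ?_
  by_cases h : ∃ i ∈ s, E i w
  · rw [ind_of h]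
    obtain ⟨i, hi, hE⟩ := h
    rw [← ind_of hE]
    exact single_le_sum (f := fun i => ind (E i w)) (fun i _ => ind_nonneg _) hi
  · rw [ind_of_not h]
    exact sum_nonneg fun i _ => ind_nonneg _

lemma pr_compl_add (hμ : IsProb μ) (E : Ω → Prop) : pr μ (fun w => ¬ E w) + pr μ E = 1 := by
  unfold pr
  rw [← ex_add]
  convert ex_const hμ 1 using 2
  funext w
  by_cases h : E w <;> simp [ind, h]

lemma IsProb.prodW (hμ : IsProb μ) (hν : IsProb ν) : IsProb (prodW μ ν) where
  nonneg p := mul_nonneg (hμ.nonneg _) (hν.nonneg _)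
  sum_one := by
    rw [Fintype.sum_prod_type]
    simp [CDS.prodW, ← mul_sum, hν.sum_one, hμ.sum_one]

lemma ex_prodW (g : Ω × Ω' → ℝ) :
    ex (prodW μ ν) g = ex μ fun a => ex ν fun b => g (a, b) := by
  simp only [ex, prodW, Fintype.sum_prod_type, mul_sum]
  exact sum_congr rfl fun w _ => sum_congr rfl fun w' _ => by ring

lemma pr_prodW_and (E : Ω → Prop) (F : Ω' → Prop) :
    pr (prodW μ ν) (fun p => E p.1 ∧ F p.2) = pr μ E * pr ν F := by
  unfold pr
  rw [ex_prodW, mul_comm, ← ex_const_mul]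
  congr 1
  funext a
  rw [mul_comm, ← ex_const_mul]
  congr 1
  funext b
  by_cases hE : E a <;> by_cases hF : F b <;> simp [ind, hE, hF]

/-- If many events of probability at least `a` are pairwise almost independent, then one of them
happens with constant probability. -/
lemma pr_exists_ge (hμ : IsProb μ) {ι : Type*} (J : Finset ι) (E : ι → Ω → Prop) {a : ℝ}
    (ha0 : 0 < a) (ha : a ≤ 1 / 8) (hJ : 1 / 8 ≤ #J * a) (h1 : ∀ j ∈ J, a ≤ pr μ (E j))
    (h2 : ∀ j ∈ J, ∀ l ∈ J, j ≠ l → pr μ (fun w => E j w ∧ E l w) ≤ 4 * a ^ 2) :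
    3 / 32 ≤ pr μ (fun w => ∃ j ∈ J, E j w) := by
  set n : ℕ := ⌈1 / (8 * a)⌉₊ with hn
  have hna : 1 / 8 ≤ n * a := by
    have := Nat.le_ceil (1 / (8 * a))
    rw [← hn, div_le_iff₀ (by positivity)] at this
    linarith
  have hna' : n * a ≤ 1 / 4 := by
    have := (Nat.ceil_lt_add_one (a := 1 / (8 * a)) (by positivity)).le
    rw [← hn] at this
    have h3 := mul_le_mul_of_nonneg_right this ha0.le
    have h4 : (1 / (8 * a) + 1) * a = 1 / 8 + a := by field_simp
    linarith
  have hnJ : n ≤ #J := by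
    rw [hn, Nat.ceil_le, div_le_iff₀ (by positivity)]
    linarith
  obtain ⟨I, hIJ, hI⟩ := exists_subset_card_eq hnJ
  have key : ∀ w, (∑ i ∈ I, ind (E i w)) -
      1 / 2 * ∑ i ∈ I, ∑ j ∈ I.erase i, ind (E i w ∧ E j w) ≤
      ind (∃ j ∈ J, E j w) := by
    intro w
    have e1 : (∑ i ∈ I, ind (E i w)) = #(I.filter fun i => E i w) := by
      simp [ind]
    have e2 : ∑ i ∈ I, ∑ j ∈ I.erase i, ind (E i w ∧ E j w) =
        #(I.filter fun i => E i w) * (#(I.filter fun i => E i w) - 1) := by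
      have : ∀ i ∈ I, ∑ j ∈ I.erase i, ind (E i w ∧ E j w) =
          if E i w then ((#(I.filter fun i => E i w) : ℝ) - 1) else 0 := by
        intro i hi
        by_cases h : E i w
        · simp only [h, true_and, if_true]
          have := add_sum_erase I (fun j => ind (E j w)) hi
          rw [ind_of h] at this
          rw [← e1, ← this]
          ring
        · simp [ind, h]
      rw [sum_congr rfl this, ← sum_filter, sum_const, nsmul_eq_mul]
    rw [e1, e2]
    set c := #(I.filter fun i => E i w) with hc
    by_cases h : ∃ j ∈ J, E j w
    · rw [ind_of h]
      rcases Nat.lt_or_ge c 2 with h2 | h2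
      · interval_cases c <;> norm_num
      · have : (2 : ℝ) ≤ c := by exact_mod_cast h2
        nlinarith
    · have : c = 0 := by
        rw [hc, card_eq_zero, filter_eq_empty_iff]
        exact fun i hi hE => h ⟨i, hIJ hi, hE⟩
      simp [this, ind_of_not h]
  have h3 := ex_mono hμ key
  rw [ex_sub, ex_const_mul, ex_sum, ex_sum] at h3
  have h4 : (n : ℝ) * a ≤ ∑ i ∈ I, ex μ (fun w => ind (E i w)) := by
    have := card_nsmul_le_sum I _ a fun i hi => h1 i (hIJ hi)
    rwa [hI, nsmul_eq_mul] at this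
  have h5 : ∑ i ∈ I, ex μ (fun w => ∑ j ∈ I.erase i, ind (E i w ∧ E j w)) ≤
      n * (n * (4 * a ^ 2)) := by
    have : ∀ i ∈ I, ex μ (fun w => ∑ j ∈ I.erase i, ind (E i w ∧ E j w)) ≤
        n * (4 * a ^ 2) := by
      intro i hi
      rw [ex_sum]
      have h6 := sum_le_card_nsmul (I.erase i)
        (fun j => ex μ (fun w => ind (E i w ∧ E j w))) (4 * a ^ 2) fun j hj =>
        h2 i (hIJ hi) j (hIJ (mem_of_mem_erase hj)) (ne_of_mem_erase hj).symm
      rw [nsmul_eq_mul] at h6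
      refine h6.trans (mul_le_mul_of_nonneg_right ?_ (by positivity))
      rw [← hI]
      exact_mod_cast card_le_card (erase_subset _ _)
    have h7 := sum_le_card_nsmul I _ _ this
    rwa [hI, nsmul_eq_mul] at h7
  unfold pr
  nlinarith

variable {V : Type*} [Fintype V] {Λ : Type*} [Fintype Λ] {ω : Λ → ℝ}

lemma ex_pw_prod (h : V → Λ → ℝ) :
    ex (pw V ω) (fun f => ∏ v, h v (f v)) = ∏ v, ∑ a, ω a * h v a := by
  rw [prod_univ_sum]
  simp [ex, pw, ← prod_mul_distrib]

lemma isProb_pw (hω : IsProb ω) : IsProb (pw V ω) where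
  nonneg f := prod_nonneg fun v _ => hω.nonneg _
  sum_one := by
    have := ex_pw_prod (V := V) (ω := ω) fun _ _ => 1
    simpa [ex, hω.sum_one] using this

lemma pr_pw_forall (hω : IsProb ω) (K : Finset V) (P : V → Λ → Prop) :
    pr (pw V ω) (fun f => ∀ v ∈ K, P v (f v)) = ∏ v ∈ K, pr ω (P v) := by
  have h := ex_pw_prod (V := V) (ω := ω) fun v a => ind (v ∈ K → P v a)
  have e1 : ∀ f : V → Λ, (∏ v, ind (v ∈ K → P v (f v))) =
      ind (∀ v ∈ K, P v (f v)) := by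
    intro f
    by_cases hf : ∀ v ∈ K, P v (f v)
    · rw [ind_of hf]
      exact prod_eq_one fun v _ => ind_of (hf v)
    · rw [ind_of_not hf]
      push Not at hf
      obtain ⟨v, hv, hP⟩ := hf
      exact prod_eq_zero (mem_univ v) (ind_of_not fun h => hP (h hv))
  simp only [e1] at h
  rw [pr, h, ← prod_subset (subset_univ K)]
  · exact prod_congr rfl fun v hv => by simp [pr, ex, hv]
  · intro v _ hv
    simp [ind, hv, hω.sum_one]

/-- The law of a labelling obtained by combining two independent labellings. -/
lemma ex_pw_map₂ {Λ₁ Λ₂ : Type*} [Fintype Λ₁] [Fintype Λ₂] {ω₁ : Λ₁ → ℝ} {ω₂ : Λ₂ → ℝ}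
    (φ : Λ₁ → Λ₂ → Λ) (h : ∀ c, ω c = ∑ a, ∑ b, if φ a b = c then ω₁ a * ω₂ b else 0)
    (g : (V → Λ) → ℝ) :
    ex (pw V ω₁) (fun f₁ => ex (pw V ω₂) fun f₂ => g fun v => φ (f₁ v) (f₂ v)) =
      ex (pw V ω) g := by
  have h1 : ∀ k : V → Λ, pw V ω k = ∑ f₁ : V → Λ₁, ∑ f₂ : V → Λ₂,
      if (fun v => φ (f₁ v) (f₂ v)) = k then pw V ω₁ f₁ * pw V ω₂ f₂ else 0 := by
    intro k
    simp only [pw, h]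
    rw [prod_univ_sum]
    simp only [Fintype.piFinset_univ]
    refine sum_congr rfl fun f₁ _ => ?_
    rw [prod_univ_sum]
    simp only [Fintype.piFinset_univ]
    refine sum_congr rfl fun f₂ _ => ?_
    rw [prod_ite_zero]
    simp only [mem_univ, true_imp_iff, funext_iff, prod_mul_distrib]
  simp only [ex, h1, sum_mul, mul_sum]
  conv_rhs => rw [sum_comm]
  refine sum_congr rfl fun f₁ _ => ?_
  conv_rhs => rw [sum_comm]
  refine sum_congr rfl fun f₂ _ => ?_
  simp only [ite_mul, zero_mul]
  rw [sum_ite_eq]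
  simp [mul_assoc]

/-- The law of a labelling obtained by relabelling. -/
lemma ex_pw_map {Λ₁ : Type*} [Fintype Λ₁] {ω₁ : Λ₁ → ℝ} (φ : Λ₁ → Λ)
    (h : ∀ c, ω c = ∑ a, if φ a = c then ω₁ a else 0) (g : (V → Λ) → ℝ) :
    ex (pw V ω₁) (fun f₁ => g fun v => φ (f₁ v)) = ex (pw V ω) g := by
  have := ex_pw_map₂ (V := V) (ω := ω) (ω₁ := ω₁) (ω₂ := fun _ : Unit => 1)
    (fun a _ => φ a) (by simpa using h) g
  rw [← this]
  congr 1
  funext f₁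
  simp [ex, pw]

end Expectation

section Graph

variable {V : Type*} {G : SimpleGraph V}

/-- `A` splits `F` into two nonempty parts without edges between them. -/
def Cut (G : SimpleGraph V) (F : Finset V) (A : Set V) : Prop :=
  (∃ x ∈ F, x ∈ A) ∧ (∃ y ∈ F, y ∉ A) ∧ ∀ x ∈ F, ∀ y ∈ F, G.Adj x y → x ∈ A → y ∈ A

/-- The subgraph induced by `F` is connected. -/
def Conn (G : SimpleGraph V) (F : Finset V) : Prop :=
  F.Nonempty ∧ ∀ A, ¬ Cut G F A

/-- Every vertex has a neighbour in `F`. -/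
def TotDom (G : SimpleGraph V) (F : Finset V) : Prop := ∀ v, ∃ u ∈ F, G.Adj v u

/-- The partition of `F` into the components of the induced subgraph (and singletons outside). -/
def comps (G : SimpleGraph V) (F : Finset V) : Setoid V :=
  Relation.EqvGen.setoid fun x y => x ∈ F ∧ y ∈ F ∧ G.Adj x y

/-- The partition of the vertices into `A` and its complement. -/
def sides (A : Set V) : Setoid V := Setoid.ker fun x => x ∈ A

/-- The number of classes of `r` that meet `Q`. -/
noncomputable def numC (Q : Finset V) (r : Setoid V) : ℕ := #(Q.image (Quotient.mk r))

/-- The vertices with neighbours in `F` on both sides of `A`. -/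
noncomputable def crossing [Fintype V] (G : SimpleGraph V) (F : Finset V) (A : Set V) : Finset V :=
  univ.filter fun u => (∃ x ∈ F, x ∈ A ∧ G.Adj u x) ∧ ∃ y ∈ F, y ∉ A ∧ G.Adj u y

lemma TotDom.mono {F F' : Finset V} (h : TotDom G F) (hF : F ⊆ F') : TotDom G F' := fun v =>
  let ⟨u, hu, huv⟩ := h v
  ⟨u, hF hu, huv⟩

lemma comps_adj {F : Finset V} {x y : V} (hx : x ∈ F) (hy : y ∈ F) (h : G.Adj x y) :
    comps G F x y := Relation.EqvGen.rel _ _ ⟨hx, hy, h⟩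

lemma comps_le {F : Finset V} {r : Setoid V}
    (h : ∀ x ∈ F, ∀ y ∈ F, G.Adj x y → r x y) : comps G F ≤ r :=
  Setoid.eqvGen_le fun x y hxy => h x hxy.1 y hxy.2.1 hxy.2.2

lemma comps_mono {F F' : Finset V} (hF : F ⊆ F') : comps G F ≤ comps G F' :=
  comps_le fun _ hx _ hy h => comps_adj (hF hx) (hF hy) h

lemma sides_iff {A : Set V} {x y : V} : sides A x y ↔ (x ∈ A ↔ y ∈ A) :=
  Setoid.ker_def.trans eq_iff_iff

lemma Cut.comps_le {F : Finset V} {A : Set V} (h : Cut G F A) : comps G F ≤ sides A :=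
  CDS.comps_le fun x hx y hy hxy =>
    sides_iff.2 ⟨h.2.2 x hx y hy hxy, h.2.2 y hy x hx hxy.symm⟩

lemma Cut.restrict {F F' : Finset V} {A : Set V} (h : Cut G F' A) (hF : F ⊆ F')
    (hd : TotDom G F) : Cut G F A := by
  obtain ⟨⟨x, hx, hxA⟩, ⟨y, hy, hyA⟩, h3⟩ := h
  obtain ⟨x', hx', hxx⟩ := hd x
  obtain ⟨y', hy', hyy⟩ := hd y
  exact ⟨⟨x', hx', h3 x hx x' (hF hx') hxx hxA⟩,
    ⟨y', hy', fun h => hyA (h3 y' (hF hy') y hy hyy.symm h)⟩,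
    fun a ha b hb => h3 a (hF ha) b (hF hb)⟩

lemma Cut.two_le_numC {F : Finset V} {A : Set V} (h : Cut G F A) {r : Setoid V}
    (hr : r ≤ sides A) : 2 ≤ numC F r := by
  obtain ⟨⟨x, hx, hxA⟩, ⟨y, hy, hyA⟩, -⟩ := h
  refine one_lt_card.2 ⟨_, mem_image_of_mem _ hx, _, mem_image_of_mem _ hy, fun hxy => ?_⟩
  exact hyA ((sides_iff.1 (hr (Quotient.exact hxy))).1 hxA)

lemma crossing_mono [Fintype V] {F F' : Finset V} (hF : F ⊆ F') (A : Set V) :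
    crossing G F A ⊆ crossing G F' A := by
  intro u
  simp only [crossing, mem_filter, mem_univ, true_and]
  rintro ⟨⟨x, hx, h⟩, y, hy, h'⟩
  exact ⟨⟨x, hF hx, h⟩, y, hF hy, h'⟩

lemma Conn.superset {F F' : Finset V} (h : Conn G F) (hF : F ⊆ F')
    (hd : ∀ x ∈ F', x ∉ F → ∃ y ∈ F, G.Adj x y) : Conn G F' := by
  refine ⟨h.1.mono hF, ?_⟩
  rintro A ⟨⟨x, hx, hxA⟩, ⟨y, hy, hyA⟩, h3⟩
  refine h.2 A ⟨?_, ?_, fun a ha b hb => h3 a (hF ha) b (hF hb)⟩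
  · by_cases hxF : x ∈ F
    · exact ⟨x, hxF, hxA⟩
    · obtain ⟨x', hx', hxx⟩ := hd x hx hxF
      exact ⟨x', hx', h3 x hx x' (hF hx') hxx hxA⟩
  · by_cases hyF : y ∈ F
    · exact ⟨y, hyF, hyA⟩
    · obtain ⟨y', hy', hyy⟩ := hd y hy hyF
      exact ⟨y', hy', fun h => hyA (h3 y' (hF hy') y hy hyy.symm h)⟩

lemma conn_of_numC_le {F : Finset V} (hF : F.Nonempty) (h : numC F (comps G F) ≤ 1) :
    Conn G F := by
  refine ⟨hF, fun A hA => ?_⟩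
  have := hA.two_le_numC hA.comps_le
  omega

lemma numC_pos {Q : Finset V} (hQ : Q.Nonempty) (r : Setoid V) : 1 ≤ numC Q r :=
  card_pos.2 (hQ.image _)

lemma numC_le (Q : Finset V) (r : Setoid V) : numC Q r ≤ #Q := card_image_le

lemma two_mul_card_image_add_le {α β : Type*} [DecidableEq β] (s : Finset α) (f : α → β)
    [DecidablePred fun a => ∃ a' ∈ s, a' ≠ a ∧ f a' = f a] :
    2 * #(s.image f) + #(s.filter fun a => ∃ a' ∈ s, a' ≠ a ∧ f a' = f a) ≤ 2 * #s := by
  set t := s.filter fun a => ∃ a' ∈ s, a' ≠ a ∧ f a' = f a with ht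
  have h1 := card_eq_sum_card_image f s
  have h2 : #t = ∑ b ∈ s.image f, #(t.filter fun a => f a = b) :=
    card_eq_sum_card_fiberwise fun a ha => mem_image_of_mem _ (mem_filter.1 ha).1
  rw [h1, h2, mul_sum, mul_comm, card_eq_sum_ones, sum_mul, ← sum_add_distrib]
  refine sum_le_sum fun b hb => ?_
  have h3 : t.filter (fun a => f a = b) ⊆ s.filter (fun a => f a = b) :=
    filter_subset_filter _ (filter_subset _ _)
  have h4 := card_le_card h3
  obtain ⟨a, ha, rfl⟩ := mem_image.1 hb
  have h5 : 0 < #(s.filter fun x => f x = f a) := card_pos.2 ⟨a, by simp [ha]⟩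
  rcases (t.filter fun x => f x = f a).eq_empty_or_nonempty with h6 | ⟨c, hc⟩
  · rw [h6, card_empty]
    omega
  · simp only [ht, mem_filter] at hc
    obtain ⟨⟨hcs, c', hc', hne, hcc⟩, hca⟩ := hc
    have : 1 < #(s.filter fun x => f x = f a) :=
      one_lt_card.2 ⟨c, by simp [hcs, hca], c', by simp [hc', hcc, hca], hne.symm⟩
    omega

/-- The class of `q` gets joined to another class when passing from `r` to `r'`. -/
def Merged (Q : Finset V) (r r' : Setoid V) (q : Quotient r) : Prop :=
  ∃ x ∈ Q, ∃ y ∈ Q, Quotient.mk r x = q ∧ Quotient.mk r y ≠ q ∧ r' x y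

lemma two_mul_numC_add_le {Q Q' : Finset V} {r r' : Setoid V} (hr : r ≤ r')
    (h : ∀ x ∈ Q', ∃ y ∈ Q, r' x y) :
    2 * numC Q' r' + #((Q.image (Quotient.mk r)).filter (Merged Q r r')) ≤ 2 * numC Q r := by
  set f : Quotient r → Quotient r' := Quotient.map' id fun x y hxy => hr hxy with hf
  have h1 := two_mul_card_image_add_le (Q.image (Quotient.mk r)) f
  have h2 : Q'.image (Quotient.mk r') ⊆ (Q.image (Quotient.mk r)).image f := by
    intro q hq
    obtain ⟨x, hx, rfl⟩ := mem_image.1 hq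
    obtain ⟨y, hy, hxy⟩ := h x hx
    rw [image_image]
    exact mem_image.2 ⟨y, hy, Quotient.sound (Setoid.symm' r' hxy)⟩
  have h3 : (Q.image (Quotient.mk r)).filter (Merged Q r r') ⊆
      (Q.image (Quotient.mk r)).filter fun a =>
        ∃ a' ∈ Q.image (Quotient.mk r), a' ≠ a ∧ f a' = f a := by
    intro q hq
    obtain ⟨hq, x, hx, y, hy, rfl, hne, hxy⟩ := mem_filter.1 hq
    exact mem_filter.2 ⟨hq, _, mem_image_of_mem _ hy, hne,
      Quotient.sound (Setoid.symm' r' hxy)⟩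
  have h4 := card_le_card h2
  have h5 := card_le_card h3
  unfold numC
  linarith

/-- If every class has a chance to be merged, the expected number of classes drops. -/
lemma ex_numC_le {Ω : Type*} [Fintype Ω] {μ : Ω → ℝ} (hμ : IsProb μ) {Q : Finset V}
    (hQ : Q.Nonempty) {r : Setoid V} (Q' : Ω → Finset V) (r' : Ω → Setoid V)
    (hr : ∀ w, r ≤ r' w) (h : ∀ w, ∀ x ∈ Q' w, ∃ y ∈ Q, r' w x y)
    (hm : 2 ≤ numC Q r → ∀ x ∈ Q, 3 / 32 ≤ pr μ fun w => Merged Q r (r' w) (Quotient.mk r x)) :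
    ex μ (fun w => (numC (Q' w) (r' w) : ℝ) - 1) ≤ 61 / 64 * ((numC Q r : ℝ) - 1) := by
  have h1 : ∀ w, (numC (Q' w) (r' w) : ℝ) - 1 ≤ ((numC Q r : ℝ) - 1) -
      1 / 2 * ∑ q ∈ Q.image (Quotient.mk r), ind (Merged Q r (r' w) q) := by
    intro w
    have := two_mul_numC_add_le (hr w) (h w)
    have h2 : ∑ q ∈ Q.image (Quotient.mk r), ind (Merged Q r (r' w) q) =
        #((Q.image (Quotient.mk r)).filter (Merged Q r (r' w))) := by
      simp [ind]
    rw [h2]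
    have h3 : (2 : ℝ) * numC (Q' w) (r' w) +
      #((Q.image (Quotient.mk r)).filter (Merged Q r (r' w))) ≤ 2 * numC Q r := by
      exact_mod_cast this
    linarith
  refine (ex_mono hμ h1).trans ?_
  rw [ex_sub, ex_const_mul, ex_const hμ, ex_sum]
  have hN := numC_pos hQ r
  rcases Nat.lt_or_ge (numC Q r) 2 with h2 | h2
  · have h3 : (numC Q r : ℝ) = 1 := by
      have : numC Q r = 1 := by omega
      exact_mod_cast this
    have h4 : 0 ≤ ∑ q ∈ Q.image (Quotient.mk r), ex μ fun w => ind (Merged Q r (r' w) q) :=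
      sum_nonneg fun q _ => pr_nonneg hμ _
    rw [h3]
    linarith
  · have h3 : (numC Q r : ℝ) * (3 / 32) ≤
        ∑ q ∈ Q.image (Quotient.mk r), ex μ fun w => ind (Merged Q r (r' w) q) := by
      rw [← nsmul_eq_mul]
      refine card_nsmul_le_sum _ _ _ fun q hq => ?_
      obtain ⟨x, hx, rfl⟩ := mem_image.1 hq
      exact hm h2 x hx
    linarith

lemma exists_of_two_le_numC {Q : Finset V} {r : Setoid V} (h : 2 ≤ numC Q r) (x : V) :
    ∃ y ∈ Q, ¬ r x y := by
  by_contra! h'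
  have : Q.image (Quotient.mk r) ⊆ {Quotient.mk r x} := by
    intro q hq
    obtain ⟨y, hy, rfl⟩ := mem_image.1 hq
    exact mem_singleton.2 (Quotient.sound (Setoid.symm' r (h' y hy)))
  have := card_le_card this
  rw [card_singleton] at this
  unfold numC at h
  omega

/-- The partition obtained from `r` by adding the vertices in `a` to `Q` and by joining the
neighbours of those vertices in `c` that see only one class of `r`. -/
noncomputable def linkStep (G : SimpleGraph V) (Q : Finset V) (r : Setoid V) (a c : Finset V) :
    Setoid V :=
  (r ⊔ comps G (Q ∪ a)) ⊔ Relation.EqvGen.setoid fun x y => x ∈ Q ∪ a ∧ y ∈ Q ∪ a ∧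
    ∃ u ∈ c, (∀ z ∈ Q, ∀ z' ∈ Q, G.Adj u z → G.Adj u z' → r z z') ∧ G.Adj u x ∧ G.Adj u y

lemma le_linkStep (Q : Finset V) (r : Setoid V) (a c : Finset V) : r ≤ linkStep G Q r a c :=
  le_sup_left.trans le_sup_left

lemma comps_le_linkStep (Q : Finset V) (r : Setoid V) (a c : Finset V) :
    comps G (Q ∪ a) ≤ linkStep G Q r a c :=
  le_sup_right.trans le_sup_left

lemma link_linkStep {Q : Finset V} {r : Setoid V} {a c : Finset V} {x y u : V}
    (hx : x ∈ Q ∪ a) (hy : y ∈ Q ∪ a) (hu : u ∈ c)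
    (h : ∀ z ∈ Q, ∀ z' ∈ Q, G.Adj u z → G.Adj u z' → r z z') (hux : G.Adj u x)
    (huy : G.Adj u y) : linkStep G Q r a c x y :=
  (le_sup_right : _ ≤ linkStep G Q r a c) (Relation.EqvGen.rel _ _ ⟨hx, hy, u, hu, h, hux, huy⟩)

lemma merged_of_rel {Q : Finset V} {r r' : Setoid V} {x y z : V}
    (hy : y ∈ Q) (hz : z ∈ Q) (hxy : r x y) (hxz : ¬ r x z) (h : r' y z) :
    Merged Q r r' (Quotient.mk r x) :=
  ⟨y, hy, z, hz, Quotient.sound (Setoid.symm' r hxy),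
    fun h => hxz (Setoid.symm' r (Quotient.exact h)), h⟩

lemma one_le_numC_sub_one {Q F : Finset V} {r : Setoid V} {A : Set V} (hd : TotDom G Q)
    (hQF : Q ⊆ F) (hcut : Cut G F A) (hr : r ≤ sides A) : 1 ≤ (numC Q r : ℝ) - 1 := by
  have : (2 : ℝ) ≤ numC Q r := by exact_mod_cast (hcut.restrict hQF hd).two_le_numC hr
  linarith

/-- After the deletion of any `s - 1` vertices, `F` still is a total dominating set inducing a
connected subgraph. -/
def Good (G : SimpleGraph V) (s : ℕ) (F : Finset V) : Prop :=
  ∀ X : Finset V, #X < s → Conn G (F \ X) ∧ TotDom G (F \ X)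

lemma Good.mono {s : ℕ} {F F' : Finset V} (h : Good G s F) (hF : F ⊆ F') : Good G s F' := by
  intro X hX
  obtain ⟨h1, h2⟩ := h X hX
  have hsub : F \ X ⊆ F' \ X := sdiff_subset_sdiff hF subset_rfl
  exact ⟨h1.superset hsub fun x _ _ => h2 x, h2.mono hsub⟩

end Graph

section RandomSubset

variable {V : Type*} [Fintype V]

/-- The Bernoulli distribution. -/
def bern (p : ℝ) : Bool → ℝ := fun b => bif b then p else 1 - p

/-- The set of vertices labelled `true`. -/
def supp (f : V → Bool) : Finset V := univ.filter fun v => f v = true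

/-- The expectation of `g K` for a random set `K` containing each vertex independently with
probability `p`. -/
noncomputable def eb (p : ℝ) (g : Finset V → ℝ) : ℝ := ex (pw V (bern p)) fun f => g (supp f)

lemma isProb_bern {p : ℝ} (h0 : 0 ≤ p) (h1 : p ≤ 1) : IsProb (bern p) where
  nonneg b := by cases b <;> simp [bern, h0, h1]
  sum_one := by simp [bern]

lemma isProb_pw_bern {p : ℝ} (h0 : 0 ≤ p) (h1 : p ≤ 1) : IsProb (pw V (bern p)) :=
  isProb_pw (isProb_bern h0 h1)

lemma mem_supp {f : V → Bool} {v : V} : v ∈ supp f ↔ f v = true := by simp [supp]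

lemma eb_mono {p : ℝ} (h0 : 0 ≤ p) (h1 : p ≤ 1) {g h : Finset V → ℝ} (hgh : ∀ K, g K ≤ h K) :
    eb p g ≤ eb p h :=
  ex_mono (isProb_pw_bern h0 h1) fun _ => hgh _

lemma eb_const {p : ℝ} (h0 : 0 ≤ p) (h1 : p ≤ 1) (c : ℝ) : eb (V := V) p (fun _ => c) = c :=
  ex_const (isProb_pw_bern h0 h1) c

lemma eb_const_mul {p : ℝ} (c : ℝ) (g : Finset V → ℝ) : eb p (fun K => c * g K) = c * eb p g :=
  ex_const_mul c _

lemma eb_add {p : ℝ} (g h : Finset V → ℝ) : eb p (fun K => g K + h K) = eb p g + eb p h :=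
  ex_add _ _

lemma eb_union (p q : ℝ) (g : Finset V → ℝ) :
    eb p (fun K => eb q fun K' => g (K ∪ K')) = eb (1 - (1 - p) * (1 - q)) g := by
  have hs : ∀ f f' : V → Bool, supp f ∪ supp f' = supp fun v => f v || f' v := by
    intro f f'
    ext v
    simp [supp]
  simp only [eb, hs]
  refine ex_pw_map₂ (fun a b => a || b) ?_ fun f => g (supp f)
  rintro (_ | _) <;> simp [bern]
  ring

lemma eb_inter (p q : ℝ) (g : Finset V → ℝ) :
    eb p (fun K => eb q fun K' => g (K ∩ K')) = eb (p * q) g := by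
  have hs : ∀ f f' : V → Bool, supp f ∩ supp f' = supp fun v => f v && f' v := by
    intro f f'
    ext v
    simp [supp]
  simp only [eb, hs]
  refine ex_pw_map₂ (fun a b => a && b) ?_ fun f => g (supp f)
  rintro (_ | _) <;> simp [bern]
  ring

lemma pr_subset_supp {p : ℝ} (h0 : 0 ≤ p) (h1 : p ≤ 1) (S : Finset V) :
    pr (pw V (bern p)) (fun f => ∀ v ∈ S, v ∈ supp f) = p ^ #S := by
  simp only [mem_supp]
  rw [pr_pw_forall (isProb_bern h0 h1) S fun _ b => b = true]
  simp [pr, ex, bern, ind]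

lemma pr_disjoint_supp {p : ℝ} (h0 : 0 ≤ p) (h1 : p ≤ 1) (S : Finset V) :
    pr (pw V (bern p)) (fun f => ∀ v ∈ S, v ∉ supp f) = (1 - p) ^ #S := by
  simp only [mem_supp]
  rw [pr_pw_forall (isProb_bern h0 h1) S fun _ b => ¬ b = true]
  simp [pr, ex, bern, ind]

lemma eb_disjoint {p : ℝ} (h0 : 0 ≤ p) (h1 : p ≤ 1) (S : Finset V) :
    eb p (fun K => ind (∀ v ∈ S, v ∉ K)) = (1 - p) ^ #S := pr_disjoint_supp h0 h1 S

end RandomSubset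

section Matching

variable {V : Type*} [Fintype V] {G : SimpleGraph V}

/-- Two parts of a graph which remains connected after deleting few of the other vertices are
joined by many disjoint paths with at most two inner vertices. -/
lemma exists_pairs {C D O : Finset V} {s : ℕ} (hC : C.Nonempty) (hD : D.Nonempty)
    (hCD : Disjoint C D) (hCO : Disjoint C O) (hDO : Disjoint D O)
    (hne : ∀ x ∈ C, ∀ y ∈ D, ¬ G.Adj x y) (hO : ∀ o ∈ O, ∃ x ∈ C ∪ D, G.Adj o x)
    (hconn : ∀ X ⊆ O, #X < s → Conn G ((C ∪ D ∪ O) \ X)) :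
    ∃ J : Finset (V × V), s ≤ 2 * #J ∧
      (∀ p ∈ J, p.1 ∈ O ∧ p.2 ∈ O ∧ (∃ x ∈ C, G.Adj p.1 x) ∧ (∃ y ∈ D, G.Adj p.2 y) ∧
        (p.1 = p.2 ∨ (G.Adj p.1 p.2 ∧ ∀ y ∈ D, ¬ G.Adj p.1 y))) ∧
      ∀ p ∈ J, ∀ q ∈ J, p ≠ q → p.1 ≠ q.1 ∧ p.1 ≠ q.2 ∧ p.2 ≠ q.1 ∧ p.2 ≠ q.2 := by
  set P : Finset (V × V) → Prop := fun J =>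
    (∀ p ∈ J, p.1 ∈ O ∧ p.2 ∈ O ∧ (∃ x ∈ C, G.Adj p.1 x) ∧ (∃ y ∈ D, G.Adj p.2 y) ∧
      (p.1 = p.2 ∨ (G.Adj p.1 p.2 ∧ ∀ y ∈ D, ¬ G.Adj p.1 y))) ∧
    ∀ p ∈ J, ∀ q ∈ J, p ≠ q → p.1 ≠ q.1 ∧ p.1 ≠ q.2 ∧ p.2 ≠ q.1 ∧ p.2 ≠ q.2 with hP
  obtain ⟨J, hJ, hmax⟩ := exists_max_image (univ.filter P) card ⟨∅, by simp [hP]⟩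
  have hJP : P J := (mem_filter.1 hJ).2
  refine ⟨J, ?_, hJP.1, hJP.2⟩
  by_contra! hlt
  set X := J.image Prod.fst ∪ J.image Prod.snd with hX
  have hXO : X ⊆ O := by
    intro v hv
    simp only [hX, mem_union, mem_image] at hv
    rcases hv with ⟨p, hp, rfl⟩ | ⟨p, hp, rfl⟩
    · exact (hJP.1 p hp).1
    · exact (hJP.1 p hp).2.1
  have hXs : #X < s := by
    have h1 := card_union_le (J.image Prod.fst) (J.image Prod.snd)
    have h2 : #(J.image Prod.fst) ≤ #J := card_image_le
    have h3 : #(J.image Prod.snd) ≤ #J := card_image_le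
    rw [← hX] at h1
    omega
  have hadd : ∀ u w, u ∈ O → w ∈ O → u ∉ X → w ∉ X → (∃ x ∈ C, G.Adj u x) →
      (∃ y ∈ D, G.Adj w y) → ¬ (u = w ∨ (G.Adj u w ∧ ∀ y ∈ D, ¬ G.Adj u y)) := by
    intro u w hu hw huX hwX h1 h2 h3
    have hX' : ∀ v, v ∉ X → ∀ p ∈ J, v ≠ p.1 ∧ v ≠ p.2 := by
      intro v hv p hp
      constructor
      · rintro rfl
        exact hv (mem_union_left _ (mem_image_of_mem _ hp))
      · rintro rfl
        exact hv (mem_union_right _ (mem_image_of_mem _ hp))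
    have hnot : (u, w) ∉ J := fun h => (hX' u huX _ h).1 rfl
    have hnew : P (insert (u, w) J) := by
      refine ⟨?_, ?_⟩
      · intro p hp
        rcases mem_insert.1 hp with rfl | hp
        · exact ⟨hu, hw, h1, h2, h3⟩
        · exact hJP.1 p hp
      · intro p hp q hq hpq
        rcases mem_insert.1 hp with rfl | hp <;> rcases mem_insert.1 hq with rfl | hq
        · exact absurd rfl hpq
        · exact ⟨(hX' u huX q hq).1, (hX' u huX q hq).2, (hX' w hwX q hq).1, (hX' w hwX q hq).2⟩
        · exact ⟨(hX' u huX p hp).1.symm, (hX' w hwX p hp).1.symm, (hX' u huX p hp).2.symm,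
            (hX' w hwX p hp).2.symm⟩
        · exact hJP.2 p hp q hq hpq
    have := hmax (insert (u, w) J) (mem_filter.2 ⟨mem_univ _, hnew⟩)
    rw [card_insert_of_notMem hnot] at this
    omega
  set A : Set V := {v | v ∈ C ∨ (v ∈ O ∧ ∃ x ∈ C, G.Adj v x)} with hA
  refine (hconn X hXO hXs).2 A ⟨?_, ?_, ?_⟩
  · obtain ⟨x, hx⟩ := hC
    exact ⟨x, mem_sdiff.2 ⟨by simp [hx], fun h => disjoint_left.1 hCO hx (hXO h)⟩, Or.inl hx⟩
  · obtain ⟨y, hy⟩ := hD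
    refine ⟨y, mem_sdiff.2 ⟨by simp [hy], fun h => disjoint_left.1 hDO hy (hXO h)⟩, ?_⟩
    rintro (h | h)
    · exact disjoint_left.1 hCD h hy
    · exact disjoint_left.1 hDO hy h.1
  · intro x hx y hy hxy hxA
    by_contra hyA
    simp only [mem_sdiff, mem_union] at hx hy
    simp only [hA, Set.mem_ofPred_eq, not_or, not_and] at hyA
    obtain ⟨hyC, hyO⟩ := hyA
    rcases hxA with hxC | ⟨hxO, hxC⟩
    · rcases hy.1 with (h | h) | h
      · exact hyC h
      · exact hne x hxC y h hxy
      · exact hyO h ⟨x, hxC, hxy.symm⟩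
    · by_cases hxD : ∃ y ∈ D, G.Adj x y
      · exact hadd x x hxO hxO hx.2 hx.2 hxC hxD (Or.inl rfl)
      · rcases hy.1 with (h | h) | h
        · exact hyC h
        · exact hxD ⟨y, h, hxy⟩
        · obtain ⟨z, hz, hyz⟩ := hO y h
          refine hadd x y hxO h hx.2 hy.2 hxC ⟨z, ?_, hyz⟩ (Or.inr ⟨hxy, ?_⟩)
          · rcases mem_union.1 hz with hz | hz
            · exact absurd ⟨z, hz, hyz⟩ (hyO h)
            · exact hz
          · intro z hz hxz
            exact hxD ⟨z, hz, hxz⟩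

end Matching

section Crossing

variable {V : Type*} [Fintype V] {G : SimpleGraph V}

/-- The classes of `r` meeting a set around which the graph is robustly connected: there are
many disjoint short connections leaving the class of `x`. -/
lemma exists_pairs_class {Q O : Finset V} {r : Setoid V} {s : ℕ} (hQr : comps G Q ≤ r)
    (hd : TotDom G Q) (hQO : Disjoint Q O)
    (hconn : ∀ X ⊆ O, #X < s → Conn G ((Q ∪ O) \ X)) (h2 : 2 ≤ numC Q r) {x : V} (hx : x ∈ Q) :
    ∃ J : Finset (V × V), s ≤ 2 * #J ∧
      (∀ p ∈ J, p.1 ∈ O ∧ p.2 ∈ O ∧ (∃ y ∈ Q, r x y ∧ G.Adj p.1 y) ∧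
        (∃ y ∈ Q, ¬ r x y ∧ G.Adj p.2 y) ∧
        (p.1 = p.2 ∨ (G.Adj p.1 p.2 ∧ ∀ y ∈ Q, G.Adj p.1 y → r x y))) ∧
      ∀ p ∈ J, ∀ q ∈ J, p ≠ q → p.1 ≠ q.1 ∧ p.1 ≠ q.2 ∧ p.2 ≠ q.1 ∧ p.2 ≠ q.2 := by
  have hun : Q.filter (fun y => r x y) ∪ Q.filter (fun y => ¬ r x y) = Q :=
    filter_union_filter_not_eq _ _
  obtain ⟨y, hy, hxy⟩ := exists_of_two_le_numC h2 x
  obtain ⟨J, hJ, h3, h4⟩ := exists_pairs (G := G) (C := Q.filter fun y => r x y)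
    (D := Q.filter fun y => ¬ r x y) (O := O) (s := s)
    ⟨x, mem_filter.2 ⟨hx, Setoid.refl' r x⟩⟩ ⟨y, mem_filter.2 ⟨hy, hxy⟩⟩
    (disjoint_filter_filter_not _ _ _)
    (disjoint_of_subset_left (filter_subset _ _) hQO)
    (disjoint_of_subset_left (filter_subset _ _) hQO)
    (fun a ha b hb hab => by
      rw [mem_filter] at ha hb
      exact hb.2 (Setoid.trans' r ha.2 (hQr (comps_adj ha.1 hb.1 hab))))
    (fun o _ => by
      rw [hun]
      exact hd o)
    (by rwa [hun])
  refine ⟨J, hJ, fun p hp => ?_, h4⟩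
  obtain ⟨h5, h6, ⟨a, ha, hpa⟩, ⟨b, hb, hpb⟩, h7⟩ := h3 p hp
  rw [mem_filter] at ha hb
  refine ⟨h5, h6, ⟨a, ha.1, ha.2, hpa⟩, ⟨b, hb.1, hb.2, hpb⟩, h7.imp_right fun h => ⟨h.1, ?_⟩⟩
  intro z hz hpz
  by_contra hxz
  exact h.2 z (mem_filter.2 ⟨hz, hxz⟩) hpz

lemma pr_merged_linkStep {Q : Finset V} {r : Setoid V} {k : ℕ} (hk : 4 ≤ k)
    (hconn : ∀ X : Finset V, #X < k → Conn G (univ \ X)) (hQr : comps G Q ≤ r) (hd : TotDom G Q)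
    (h2 : 2 ≤ numC Q r) {x : V} (hx : x ∈ Q) :
    3 / 32 ≤ pr (prodW (pw V (bern (1 / (k : ℝ)))) (pw V (bern (1 / 2)))) fun w =>
      Merged Q r (linkStep G Q r (supp w.1) (supp w.2)) (Quotient.mk r x) := by
  have hkR : (4 : ℝ) ≤ k := by exact_mod_cast hk
  have hr0 : (0 : ℝ) ≤ 1 / k := by positivity
  have hr1 : 1 / (k : ℝ) ≤ 1 := by rw [div_le_one (by linarith)]; linarith
  have hp1 := isProb_pw_bern (V := V) hr0 hr1
  have hp2 := isProb_pw_bern (V := V) (p := 1 / 2) (by norm_num) (by norm_num)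
  obtain ⟨J, hJ, h3, h4⟩ := exists_pairs_class (O := univ \ Q) (s := k) hQr hd
    disjoint_sdiff (fun X _ hX => by
      rw [union_sdiff_of_subset (subset_univ _)]
      exact hconn X hX) h2 hx
  have hJR : (k : ℝ) ≤ 2 * #J := by exact_mod_cast hJ
  refine (pr_exists_ge (hp1.prodW hp2) J (fun p w => p.2 ∈ supp w.1 ∧ p.1 ∈ supp w.2)
    (a := 1 / k * (1 / 2)) (by positivity) ?_ ?_ ?_ ?_).trans (pr_mono (hp1.prodW hp2) ?_)
  · have : 1 / (k : ℝ) ≤ 1 / 4 := one_div_le_one_div_of_le (by norm_num) hkR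
    linarith
  · have : (k : ℝ) * (1 / k) = 1 := by field_simp
    nlinarith
  · intro p _
    rw [pr_prodW_and (fun w => p.2 ∈ supp w) (fun w => p.1 ∈ supp w)]
    have e1 := pr_subset_supp hr0 hr1 {p.2}
    have e2 := pr_subset_supp (p := 1 / 2) (by norm_num) (by norm_num) {p.1}
    simp only [mem_singleton, forall_eq, card_singleton, pow_one] at e1 e2
    rw [e1, e2]
  · intro p hp q hq hpq
    have e1 := pr_subset_supp hr0 hr1 {p.2, q.2}
    have e2 := pr_subset_supp (p := 1 / 2) (by norm_num) (by norm_num) {p.1, q.1}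
    rw [card_pair (h4 p hp q hq hpq).2.2.2] at e1
    rw [card_pair (h4 p hp q hq hpq).1] at e2
    refine (pr_mono (hp1.prodW hp2) (F := fun w =>
      (∀ v ∈ ({p.2, q.2} : Finset V), v ∈ supp w.1) ∧
        ∀ v ∈ ({p.1, q.1} : Finset V), v ∈ supp w.2) ?_).trans ?_
    · rintro w ⟨⟨h5, h6⟩, h7, h8⟩
      constructor <;> simp_all
    · rw [pr_prodW_and (fun w => ∀ v ∈ ({p.2, q.2} : Finset V), v ∈ supp w)
        (fun w => ∀ v ∈ ({p.1, q.1} : Finset V), v ∈ supp w), e1, e2, mul_pow]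
      have : (0 : ℝ) ≤ (1 / k) ^ 2 * (1 / 2) ^ 2 := by positivity
      linarith
  · rintro w ⟨p, hp, h5, h6⟩
    obtain ⟨-, -, ⟨y, hy, hxy, hpy⟩, ⟨z, hz, hxz, hpz⟩, h7⟩ := h3 p hp
    refine merged_of_rel hy hz hxy hxz ?_
    have hz1 : linkStep G Q r (supp w.1) (supp w.2) p.2 z :=
      comps_le_linkStep _ _ _ _
        (comps_adj (mem_union_right _ h5) (mem_union_left _ hz) hpz)
    refine Setoid.trans' _ ?_ hz1
    rcases h7 with h7 | ⟨h7, h8⟩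
    · rw [h7] at hpy
      exact comps_le_linkStep _ _ _ _
        (comps_adj (mem_union_left _ hy) (mem_union_right _ h5) hpy.symm)
    · exact link_linkStep (mem_union_left _ hy) (mem_union_right _ h5) h6
        (fun a ha b hb hpa hpb => Setoid.trans' r (Setoid.symm' r (h8 a ha hpa)) (h8 b hb hpb))
        hpy h7

/-- If `A F` is a cut of `F` that respects the partition `r`, this is the probability that a fair
coin comes up heads for every vertex that sees both sides of the cut in `F` but not in `Q`. -/
noncomputable def cost (G : SimpleGraph V) (A : Finset V → Set V) (Q : Finset V) (r : Setoid V)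
    (F : Finset V) : ℝ :=
  ind (Cut G F (A F) ∧ r ≤ sides (A F)) * (1 / 2) ^ #(crossing G F (A F) \ crossing G Q (A F))

lemma cost_le_eb (A : Finset V → Set V) (Q : Finset V) (r : Setoid V) (a F : Finset V)
    (hF : Q ∪ a ⊆ F) :
    cost G A Q r F ≤ eb (1 / 2) fun c => cost G A (Q ∪ a) (linkStep G Q r a c) F := by
  by_cases hcut : Cut G F (A F) ∧ r ≤ sides (A F)
  · set n₀ := crossing G F (A F) \ crossing G Q (A F) with hn₀
    set n₁ := crossing G F (A F) \ crossing G (Q ∪ a) (A F) with hn₁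
    have hsub : n₁ ⊆ n₀ := sdiff_subset_sdiff subset_rfl (crossing_mono subset_union_left _)
    have h1 : ∀ c, (1 / 2 : ℝ) ^ #n₁ * ind (∀ v ∈ n₀ \ n₁, v ∉ c) ≤
        cost G A (Q ∪ a) (linkStep G Q r a c) F := by
      intro c
      unfold cost
      rw [mul_comm]
      refine mul_le_mul_of_nonneg_right (ind_mono fun hc => ⟨hcut.1, ?_⟩) (by positivity)
      refine sup_le (sup_le hcut.2 ((comps_mono hF).trans hcut.1.comps_le)) ?_
      refine Setoid.eqvGen_le ?_
      have key : ∀ x y u, x ∈ Q ∪ a → y ∈ Q ∪ a → u ∈ c →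
          (∀ z ∈ Q, ∀ z' ∈ Q, G.Adj u z → G.Adj u z' → r z z') → G.Adj u x → G.Adj u y →
          x ∈ A F → y ∈ A F := by
        intro x y u hx hy hu h hux huy hxA
        by_contra hyA
        have hu1 : u ∈ crossing G (Q ∪ a) (A F) := by
          simp only [crossing, mem_filter, mem_univ, true_and]
          exact ⟨⟨x, hx, hxA, hux⟩, y, hy, hyA, huy⟩
        have hu0 : u ∉ crossing G Q (A F) := by
          simp only [crossing, mem_filter, mem_univ, true_and]
          rintro ⟨⟨z, hz, hzA, huz⟩, z', hz', hzA', huz'⟩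
          exact hzA' ((sides_iff.1 (hcut.2 (h z hz z' hz' huz huz'))).1 hzA)
        refine hc u ?_ hu
        rw [mem_sdiff, hn₀, hn₁, mem_sdiff, mem_sdiff]
        exact ⟨⟨crossing_mono hF _ hu1, hu0⟩, fun h => h.2 hu1⟩
      rintro x y ⟨hx, hy, u, hu, h, hux, huy⟩
      exact sides_iff.2 ⟨key x y u hx hy hu h hux huy, key y x u hy hx hu h huy hux⟩
    refine le_trans (le_of_eq ?_) (eb_mono (by norm_num) (by norm_num) h1)
    rw [eb_const_mul, eb_disjoint (by norm_num) (by norm_num), cost, ind_of hcut, one_mul,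
      ← hn₀, ← card_sdiff_add_card_eq_card hsub, pow_add, mul_comm]
    norm_num
  · rw [cost, ind_of_not hcut, zero_mul, ← eb_const (V := V) (p := 1 / 2) (by norm_num)
      (by norm_num) 0]
    exact eb_mono (by norm_num) (by norm_num) fun c =>
      mul_nonneg (ind_nonneg _) (by positivity)

lemma eb_cost_le [Nonempty V] {k : ℕ} (hk : 4 ≤ k)
    (hconn : ∀ X : Finset V, #X < k → Conn G (univ \ X)) (A : Finset V → Set V) (T : ℕ) :
    ∀ (Q : Finset V) (r : Setoid V), comps G Q ≤ r → TotDom G Q →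
      eb (1 - (1 - 1 / (k : ℝ)) ^ T) (fun K => cost G A Q r (Q ∪ K)) ≤
        (61 / 64) ^ T * ((numC Q r : ℝ) - 1) := by
  have hkR : (4 : ℝ) ≤ k := by exact_mod_cast hk
  have hr0 : (0 : ℝ) ≤ 1 / k := by positivity
  have hr1 : 1 / (k : ℝ) ≤ 1 := by rw [div_le_one (by linarith)]; linarith
  have hq0 : ∀ T : ℕ, (0 : ℝ) ≤ 1 - (1 - 1 / (k : ℝ)) ^ T := fun T => by
    have := pow_le_one₀ (n := T) (sub_nonneg.2 hr1) (by linarith)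
    linarith
  have hq1 : ∀ T : ℕ, 1 - (1 - 1 / (k : ℝ)) ^ T ≤ 1 := fun T => by
    have := pow_nonneg (sub_nonneg.2 hr1) T
    linarith
  have hp1 := isProb_pw_bern (V := V) hr0 hr1
  have hp2 := isProb_pw_bern (V := V) (p := 1 / 2) (by norm_num) (by norm_num)
  have hne : ∀ Q : Finset V, TotDom G Q → Q.Nonempty := fun Q hQ =>
    let ⟨u, hu, _⟩ := hQ (Classical.arbitrary V)
    ⟨u, hu⟩
  induction T with
  | zero =>
    intro Q r hQr hd
    rw [pow_zero (61 / 64 : ℝ), one_mul, ← eb_const (V := V) (hq0 0) (hq1 0) ((numC Q r : ℝ) - 1)]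
    refine eb_mono (hq0 0) (hq1 0) fun K => ?_
    by_cases hcut : Cut G (Q ∪ K) (A (Q ∪ K)) ∧ r ≤ sides (A (Q ∪ K))
    · refine le_trans ?_ (one_le_numC_sub_one hd subset_union_left hcut.1 hcut.2)
      rw [cost, ind_of hcut, one_mul]
      exact pow_le_one₀ (by norm_num) (by norm_num)
    · rw [cost, ind_of_not hcut, zero_mul]
      have : (1 : ℝ) ≤ numC Q r := by exact_mod_cast numC_pos (hne Q hd) r
      linarith
  | succ T ih =>
    intro Q r hQr hd
    have e1 : 1 - (1 - 1 / (k : ℝ)) ^ (T + 1) =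
        1 - (1 - 1 / (k : ℝ)) * (1 - (1 - (1 - 1 / (k : ℝ)) ^ T)) := by ring
    rw [e1, ← eb_union]
    have h1 : ∀ a : Finset V, eb (1 - (1 - 1 / (k : ℝ)) ^ T)
        (fun K => cost G A Q r (Q ∪ (a ∪ K))) ≤
        eb (1 / 2) fun c => (61 / 64) ^ T * ((numC (Q ∪ a) (linkStep G Q r a c) : ℝ) - 1) := by
      intro a
      have h2 : eb (1 - (1 - 1 / (k : ℝ)) ^ T) (fun K => cost G A Q r (Q ∪ (a ∪ K))) ≤
          eb (1 - (1 - 1 / (k : ℝ)) ^ T) fun K => eb (1 / 2) fun c =>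
            cost G A (Q ∪ a) (linkStep G Q r a c) (Q ∪ a ∪ K) := by
        refine eb_mono (hq0 T) (hq1 T) fun K => ?_
        rw [← union_assoc]
        exact cost_le_eb A Q r a _ subset_union_left
      refine h2.trans ?_
      unfold eb
      rw [ex_comm]
      exact ex_mono hp2 fun c => ih _ _ (comps_le_linkStep _ _ _ _)
        (hd.mono subset_union_left)
    refine (eb_mono hr0 hr1 h1).trans ?_
    simp only [eb_const_mul]
    rw [pow_succ, mul_assoc]
    refine mul_le_mul_of_nonneg_left ?_ (by positivity)
    have h3 := ex_numC_le (hp1.prodW hp2) (hne Q hd) (fun w => Q ∪ supp w.1)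
      (fun w => linkStep G Q r (supp w.1) (supp w.2)) (fun w => le_linkStep _ _ _ _) ?_
      (fun h2 x hx => pr_merged_linkStep hk hconn hQr hd h2 hx)
    · rwa [ex_prodW] at h3
    · intro w x hx
      obtain ⟨y, hy, hxy⟩ := hd x
      exact ⟨y, hy, comps_le_linkStep _ _ _ _ (comps_adj hx (mem_union_left _ hy) hxy)⟩

/-- With high probability every cut is crossed by many vertices. -/
lemma eb_few_crossing_le [Nonempty V] {k : ℕ} (hk : 4 ≤ k)
    (hconn : ∀ X : Finset V, #X < k → Conn G (univ \ X)) (s T : ℕ) {B : Finset V}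
    (hB : TotDom G B) :
    eb (1 - (1 - 1 / (k : ℝ)) ^ T)
      (fun K => ind (∃ A, Cut G (B ∪ K) A ∧ #(crossing G (B ∪ K) A) < s)) ≤
      2 ^ s * (61 / 64) ^ T * Fintype.card V := by
  have hkR : (4 : ℝ) ≤ k := by exact_mod_cast hk
  have hr1 : 1 / (k : ℝ) ≤ 1 := by rw [div_le_one (by linarith)]; linarith
  have hr0 : (0 : ℝ) ≤ 1 / k := by positivity
  have hq0 : (0 : ℝ) ≤ 1 - (1 - 1 / (k : ℝ)) ^ T := by
    have := pow_le_one₀ (n := T) (sub_nonneg.2 hr1) (by linarith)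
    linarith
  have hq1 : 1 - (1 - 1 / (k : ℝ)) ^ T ≤ 1 := by
    have := pow_nonneg (sub_nonneg.2 hr1) T
    linarith
  set A : Finset V → Set V := fun F =>
    if h : ∃ A, Cut G F A ∧ #(crossing G F A) < s then h.choose else ∅ with hA
  have h1 := eb_cost_le hk hconn A T B (comps G B) le_rfl hB
  have h2 : ∀ K, ind (∃ A, Cut G (B ∪ K) A ∧ #(crossing G (B ∪ K) A) < s) ≤
      2 ^ s * cost G A B (comps G B) (B ∪ K) := by
    intro K
    by_cases h : ∃ A, Cut G (B ∪ K) A ∧ #(crossing G (B ∪ K) A) < s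
    · obtain ⟨h3, h4⟩ := h.choose_spec
      have hAK : A (B ∪ K) = h.choose := by simp only [hA, dif_pos h]
      rw [← hAK] at h3 h4
      rw [ind_of h, cost, ind_of ⟨h3, (comps_mono subset_union_left).trans h3.comps_le⟩, one_mul]
      have h5 : #(crossing G (B ∪ K) (A (B ∪ K)) \ crossing G B (A (B ∪ K))) ≤ s :=
        (card_le_card sdiff_subset).trans h4.le
      have h6 : (1 / 2 : ℝ) ^ s ≤
          (1 / 2) ^ #(crossing G (B ∪ K) (A (B ∪ K)) \ crossing G B (A (B ∪ K))) :=
        pow_le_pow_of_le_one (by norm_num) (by norm_num) h5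
      have h7 : (2 : ℝ) ^ s * (1 / 2) ^ s = 1 := by
        rw [← mul_pow]
        norm_num
      exact h7.symm.trans_le (mul_le_mul_of_nonneg_left h6 (by positivity))
    · rw [ind_of_not h]
      exact mul_nonneg (by positivity) (mul_nonneg (ind_nonneg _) (by positivity))
  refine (eb_mono hq0 hq1 h2).trans ?_
  rw [eb_const_mul, mul_assoc]
  refine mul_le_mul_of_nonneg_left (h1.trans (mul_le_mul_of_nonneg_left ?_ (by positivity)))
    (by positivity)
  have : numC B (comps G B) ≤ Fintype.card V :=
    card_image_le.trans (card_le_univ B)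
  have : (numC B (comps G B) : ℝ) ≤ Fintype.card V := by exact_mod_cast this
  linarith

end Crossing

section Robust

variable {V : Type*} [Fintype V] {G : SimpleGraph V}

lemma one_sub_pow_mem {q : ℝ} (h0 : 0 ≤ q) (h1 : q ≤ 1) (T : ℕ) :
    0 ≤ 1 - (1 - q) ^ T ∧ 1 - (1 - q) ^ T ≤ 1 := by
  have h2 := pow_le_one₀ (n := T) (sub_nonneg.2 h1) (by linarith)
  have h3 := pow_nonneg (sub_nonneg.2 h1) T
  constructor <;> linarith

/-- If every cut is crossed by many vertices, adding random vertices makes the graph connected. -/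
lemma eb_not_conn_le [Nonempty V] {F : Finset V} (hd : TotDom G F) {s : ℕ} {q : ℝ} (hq0 : 0 < q)
    (hq : q ≤ 1 / 8) (hsq : 1 / 8 ≤ s * q) (hcut : ∀ A, Cut G F A → s ≤ #(crossing G F A))
    (T : ℕ) : ∀ Q : Finset V, F ⊆ Q →
      eb (1 - (1 - q) ^ T) (fun K => ind (¬ Conn G (Q ∪ K))) ≤
        (61 / 64) ^ T * ((numC Q (comps G Q) : ℝ) - 1) := by
  have hq1 : q ≤ 1 := by linarith
  have hT := fun T => one_sub_pow_mem hq0.le hq1 T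
  have hp := isProb_pw_bern (V := V) hq0.le hq1
  have hne : ∀ Q : Finset V, F ⊆ Q → Q.Nonempty := fun Q hQ =>
    let ⟨u, hu, _⟩ := hd (Classical.arbitrary V)
    ⟨u, hQ hu⟩
  induction T with
  | zero =>
    intro Q hFQ
    rw [pow_zero (61 / 64 : ℝ), one_mul,
      ← eb_const (V := V) (hT 0).1 (hT 0).2 ((numC Q (comps G Q) : ℝ) - 1)]
    refine eb_mono (hT 0).1 (hT 0).2 fun K => ?_
    by_cases h : Conn G (Q ∪ K)
    · rw [ind_of_not (not_not.2 h)]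
      have : (1 : ℝ) ≤ numC Q (comps G Q) := by exact_mod_cast numC_pos (hne Q hFQ) _
      linarith
    · refine (ind_le_one _).trans ?_
      have : ∃ A, Cut G (Q ∪ K) A := by
        by_contra! h'
        exact h ⟨(hne Q hFQ).mono subset_union_left, h'⟩
      obtain ⟨A, hA⟩ := this
      exact one_le_numC_sub_one (hd.mono hFQ) subset_union_left hA
        ((comps_mono subset_union_left).trans hA.comps_le)
  | succ T ih =>
    intro Q hFQ
    have e1 : 1 - (1 - q) ^ (T + 1) = 1 - (1 - q) * (1 - (1 - (1 - q) ^ T)) := by ring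
    rw [e1, ← eb_union]
    have h1 : ∀ a : Finset V, eb (1 - (1 - q) ^ T) (fun K => ind (¬ Conn G (Q ∪ (a ∪ K)))) ≤
        (61 / 64) ^ T * ((numC (Q ∪ a) (comps G (Q ∪ a)) : ℝ) - 1) := by
      intro a
      simp only [← union_assoc]
      exact ih _ (hFQ.trans subset_union_left)
    refine (eb_mono hq0.le hq1 h1).trans ?_
    rw [eb_const_mul, pow_succ, mul_assoc]
    refine mul_le_mul_of_nonneg_left ?_ (by positivity)
    refine ex_numC_le hp (hne Q hFQ) (fun f => Q ∪ supp f) (fun f => comps G (Q ∪ supp f))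
      (fun f => comps_mono subset_union_left) ?_ ?_
    · intro f x hx
      obtain ⟨y, hy, hxy⟩ := hd x
      exact ⟨y, hFQ hy, comps_adj hx (mem_union_left _ (hFQ hy)) hxy⟩
    · intro h2 x hx
      set A : Set V := {y | comps G Q x y} with hA
      have hAQ : Cut G Q A := by
        obtain ⟨y, hy, hxy⟩ := exists_of_two_le_numC h2 x
        exact ⟨⟨x, hx, Setoid.refl' (comps G Q) x⟩, ⟨y, hy, hxy⟩, fun a ha b hb hab h =>
          Setoid.trans' _ h (comps_adj ha hb hab)⟩
      have hs := hcut A (hAQ.restrict hFQ hd)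
      have hsR : (s : ℝ) ≤ #(crossing G F A) := by exact_mod_cast hs
      refine (pr_exists_ge hp (crossing G F A) (fun u f => u ∈ supp f) hq0 hq
        (hsq.trans (mul_le_mul_of_nonneg_right hsR hq0.le)) ?_ ?_).trans (pr_mono hp ?_)
      · intro u _
        have e2 := pr_subset_supp hq0.le hq1 {u}
        simp only [mem_singleton, forall_eq, card_singleton, pow_one] at e2
        rw [e2]
      · intro u _ w _ huw
        have e2 := pr_subset_supp hq0.le hq1 {u, w}
        rw [card_pair huw] at e2
        simp only [mem_insert, mem_singleton, forall_eq_or_imp, forall_eq] at e2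
        rw [e2]
        nlinarith [sq_nonneg q]
      · rintro f ⟨u, hu, huf⟩
        simp only [crossing, mem_filter, mem_univ, true_and] at hu
        obtain ⟨⟨y, hy, hyA, huy⟩, z, hz, hzA, huz⟩ := hu
        refine merged_of_rel (hFQ hy) (hFQ hz) hyA hzA ?_
        exact Setoid.trans' _
          (comps_adj (mem_union_left _ (hFQ hy)) (mem_union_right _ huf) huy.symm)
          (comps_adj (mem_union_right _ huf) (mem_union_left _ (hFQ hz)) huz)

lemma ind_not_good_le (s : ℕ) (F : Finset V) :
    ind (¬ Good G s F) ≤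
      2 ^ s * eb (1 / 2) fun Y => ind (¬ (Conn G (F ∩ Y) ∧ TotDom G (F ∩ Y))) := by
  by_cases h : Good G s F
  · rw [ind_of_not (not_not.2 h)]
    refine mul_nonneg (by positivity) ?_
    rw [← eb_const (V := V) (p := 1 / 2) (by norm_num) (by norm_num) 0]
    exact eb_mono (by norm_num) (by norm_num) fun _ => ind_nonneg _
  · rw [ind_of h]
    simp only [Good, not_forall] at h
    obtain ⟨X, hX, hbad⟩ := h
    have h1 : ∀ Y, ind (∀ v ∈ X, v ∉ Y) ≤ ind (¬ (Conn G (F ∩ Y) ∧ TotDom G (F ∩ Y))) := by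
      refine fun Y => ind_mono fun hXY hgood => hbad ?_
      have hsub : F ∩ Y ⊆ F \ X := fun v hv => by
        rw [mem_inter] at hv
        exact mem_sdiff.2 ⟨hv.1, fun h => hXY v h hv.2⟩
      exact ⟨hgood.1.superset hsub fun x _ _ => hgood.2 x, hgood.2.mono hsub⟩
    have h2 := eb_mono (p := 1 / 2) (by norm_num) (by norm_num) h1
    rw [eb_disjoint (by norm_num) (by norm_num)] at h2
    have h3 : (1 / 2 : ℝ) ^ s ≤ (1 - 1 / 2) ^ #X := by
      have := pow_le_pow_of_le_one (a := (1 / 2 : ℝ)) (by norm_num) (by norm_num) hX.le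
      norm_num at this ⊢
      exact this
    have h4 : (2 : ℝ) ^ s * (1 / 2) ^ s = 1 := by
      rw [← mul_pow]
      norm_num
    exact h4.symm.trans_le (mul_le_mul_of_nonneg_left (h3.trans h2) (by positivity))

/-- The set of neighbours of a vertex. -/
noncomputable def nbrs (G : SimpleGraph V) (v : V) : Finset V := univ.filter fun u => G.Adj v u

lemma mem_nbrs {v u : V} : u ∈ nbrs G v ↔ G.Adj v u := by simp [nbrs]

lemma le_card_nbrs {k : ℕ} (hk : k < Fintype.card V)
    (hconn : ∀ X : Finset V, #X < k → Conn G (univ \ X)) (v : V) : k ≤ #(nbrs G v) := by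
  by_contra! h
  refine (hconn _ h).2 {v} ⟨⟨v, ?_, rfl⟩, ?_, ?_⟩
  · simp [mem_nbrs]
  · have h1 : #(insert v (nbrs G v)) < #(univ : Finset V) := by
      have := card_insert_le v (nbrs G v)
      rw [card_univ]
      omega
    obtain ⟨y, hy, hy'⟩ := exists_mem_notMem_of_card_lt_card h1
    rw [mem_insert, not_or] at hy'
    exact ⟨y, mem_sdiff.2 ⟨hy, hy'.2⟩, hy'.1⟩
  · rintro x - y hy hxy rfl
    exact absurd (mem_nbrs.2 hxy) (mem_sdiff.1 hy).2

lemma eb_not_totDom_le {k : ℕ} (hdeg : ∀ v, k ≤ #(nbrs G v)) {p : ℝ} (h0 : 0 ≤ p) (h1 : p ≤ 1) :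
    eb p (fun B => ind (¬ TotDom G B)) ≤ Fintype.card V * (1 - p) ^ k := by
  have hp := isProb_pw_bern (V := V) h0 h1
  have h2 : eb p (fun B => ind (¬ TotDom G B)) ≤
      pr (pw V (bern p)) fun f => ∃ v ∈ univ, ∀ u ∈ nbrs G v, u ∉ supp f := by
    refine pr_mono hp fun f hf => ?_
    simp only [TotDom, not_forall, not_exists, not_and] at hf
    obtain ⟨v, hv⟩ := hf
    exact ⟨v, mem_univ v, fun u hu huf => hv u huf (mem_nbrs.1 hu)⟩
  refine h2.trans ((pr_exists_le hp _ _).trans ?_)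
  refine (sum_le_card_nsmul univ _ ((1 - p) ^ k) fun v _ => ?_).trans_eq ?_
  · rw [pr_disjoint_supp h0 h1]
    exact pow_le_pow_of_le_one (by linarith) (by linarith) (hdeg v)
  · rw [nsmul_eq_mul, card_univ]

lemma drift_pow_le (t : ℕ) : (61 / 64 : ℝ) ^ (16 * t) ≤ (1 / 2) ^ t := by
  rw [pow_mul]
  exact pow_le_pow_left₀ (by positivity) (by norm_num) t

/-- A random subset of a highly connected graph is robustly connected and dominating. -/
lemma eb_not_good_le [Nonempty V] {k s : ℕ} (hs : 1 ≤ s) (hsk : s * 2 ^ 17 ≤ k)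
    (hconn : ∀ X : Finset V, #X < k → Conn G (univ \ X)) (hdeg : ∀ v, k ≤ #(nbrs G v))
    {p : ℝ} (hp0 : 1 / 2 ≤ p) (hp1 : p ≤ 1) :
    eb p (fun K => ind (¬ Good G s K)) ≤ 3 * Fintype.card V * (1 / 2) ^ s := by
  have hsR : (1 : ℝ) ≤ s := by exact_mod_cast hs
  have hskR : (s : ℝ) * 2 ^ 17 ≤ k := by exact_mod_cast hsk
  have hk : 4 ≤ k := by omega
  have hkR : (0 : ℝ) < k := by linarith
  set n : ℝ := (Fintype.card V : ℝ) with hn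
  have hn0 : 0 ≤ n := by positivity
  set r₁ : ℝ := 1 / (k : ℝ) with hr₁
  set r₂ : ℝ := 1 / (8 * (128 * s : ℕ)) with hr₂
  have hr₁0 : 0 ≤ r₁ := by positivity
  have hr₂0 : 0 < r₂ := by positivity
  have hr₁s : (2080 * s : ℕ) * r₁ ≤ 1 / 60 := by
    rw [hr₁, mul_one_div, div_le_iff₀ hkR]
    push_cast
    linarith
  have hr₂s : (32 * s : ℕ) * r₂ = 1 / 32 := by
    rw [hr₂]
    push_cast
    field_simp
    norm_num
  have hr₁1 : r₁ ≤ 1 := by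
    rw [hr₁, div_le_one hkR]
    linarith
  have hr₂8 : r₂ ≤ 1 / 8 := by
    rw [hr₂]
    push_cast
    exact one_div_le_one_div_of_le (by norm_num) (by linarith)
  obtain ⟨hP0, hP1⟩ := one_sub_pow_mem hr₁0 hr₁1 (2080 * s)
  obtain ⟨hU0, hU1⟩ := one_sub_pow_mem hr₂0.le (by linarith) (32 * s)
  set P := (1 - r₁) ^ (2080 * s) with hP
  set U := (1 - r₂) ^ (32 * s) with hU
  have hPl : 59 / 60 ≤ P := by
    have := one_add_mul_le_pow (a := -r₁) (by linarith) (2080 * s)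
    rw [← sub_eq_add_neg 1 r₁] at this
    linarith
  have hUl : 31 / 32 ≤ U := by
    have := one_add_mul_le_pow (a := -r₂) (by linarith) (32 * s)
    rw [← sub_eq_add_neg 1 r₂] at this
    linarith
  have hPU : 19 / 20 ≤ P * U := by nlinarith
  have hb1 : (1 - p / 2) / (P * U) ≤ 4 / 5 := by
    rw [div_le_iff₀ (by linarith)]
    linarith
  have hb0 : 0 ≤ (1 - p / 2) / (P * U) := div_nonneg (by linarith) (by linarith)
  set b := 1 - (1 - p / 2) / (P * U) with hb
  have hpb : p / 2 = 1 - (1 - b) * (1 - (1 - (1 - (1 - P)) * (1 - (1 - U)))) := by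
    have : P * U ≠ 0 := by linarith
    rw [hb]
    field_simp
    ring
  have hhalf : ∀ t : ℕ, (0 : ℝ) ≤ (1 / 2) ^ t := fun t => by positivity
  have hfew : ∀ B, TotDom G B → eb (1 - P)
      (fun K => ind (∃ A, Cut G (B ∪ K) A ∧ #(crossing G (B ∪ K) A) < 128 * s)) ≤
      n * (1 / 2) ^ (2 * s) := by
    intro B hB
    refine (eb_few_crossing_le hk hconn (128 * s) (2080 * s) hB).trans ?_
    rw [mul_comm]
    refine mul_le_mul_of_nonneg_left ?_ hn0
    have h1 := drift_pow_le (130 * s)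
    have h2 : (2 : ℝ) ^ (128 * s) * (1 / 2) ^ (130 * s) = (1 / 2) ^ (2 * s) := by
      rw [show 130 * s = 128 * s + 2 * s by ring, pow_add, ← mul_assoc, ← mul_pow]
      norm_num
    rw [show 2080 * s = 16 * (130 * s) by ring, ← h2]
    exact mul_le_mul_of_nonneg_left h1 (by positivity)
  have hmany : ∀ F, TotDom G F → (∀ A, Cut G F A → 128 * s ≤ #(crossing G F A)) →
      eb (1 - U) (fun K => ind (¬ Conn G (F ∪ K))) ≤ n * (1 / 2) ^ (2 * s) := by
    intro F hF hcut
    have h8 : 1 / 8 ≤ ((128 * s : ℕ) : ℝ) * r₂ := by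
      rw [hr₂]
      have : ((128 * s : ℕ) : ℝ) ≠ 0 := by positivity
      field_simp
      norm_num
    refine (eb_not_conn_le hF hr₂0 hr₂8 h8 hcut (32 * s) F subset_rfl).trans ?_
    rw [mul_comm]
    have h1 : (numC F (comps G F) : ℝ) ≤ n := by
      rw [hn]
      exact_mod_cast (numC_le F (comps G F)).trans (card_le_univ F)
    refine mul_le_mul (by linarith) ?_ (by positivity) hn0
    rw [show 32 * s = 16 * (2 * s) by ring]
    exact drift_pow_le _
  have hbad : eb (p / 2) (fun F => ind (¬ (Conn G F ∧ TotDom G F))) ≤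
      3 * n * (1 / 2) ^ (2 * s) := by
    rw [hpb, ← eb_union]
    have h1 : ∀ B, eb (1 - (1 - (1 - P)) * (1 - (1 - U)))
        (fun K => ind (¬ (Conn G (B ∪ K) ∧ TotDom G (B ∪ K)))) ≤
        ind (¬ TotDom G B) + (n * (1 / 2) ^ (2 * s) + n * (1 / 2) ^ (2 * s)) := by
      intro B
      rw [← eb_union]
      by_cases hB : TotDom G B
      · rw [ind_of_not (not_not.2 hB), zero_add]
        have h2 : ∀ R, eb (1 - U) (fun K => ind (¬ (Conn G (B ∪ (R ∪ K)) ∧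
            TotDom G (B ∪ (R ∪ K))))) ≤
            ind (∃ A, Cut G (B ∪ R) A ∧ #(crossing G (B ∪ R) A) < 128 * s) +
              n * (1 / 2) ^ (2 * s) := by
          intro R
          by_cases hR : ∃ A, Cut G (B ∪ R) A ∧ #(crossing G (B ∪ R) A) < 128 * s
          · rw [ind_of hR]
            have h3 : eb (1 - U) (fun K => ind (¬ (Conn G (B ∪ (R ∪ K)) ∧
                TotDom G (B ∪ (R ∪ K))))) ≤ eb (1 - U) fun _ => (1 : ℝ) :=
              eb_mono hU0 hU1 fun _ => ind_le_one _
            rw [eb_const hU0 hU1] at h3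
            have := mul_nonneg hn0 (hhalf (2 * s))
            linarith
          · rw [ind_of_not hR, zero_add]
            push Not at hR
            refine le_trans (eb_mono hU0 hU1 fun K => ind_mono ?_)
              (hmany (B ∪ R) (hB.mono subset_union_left) hR)
            intro h hc
            rw [← union_assoc] at h
            exact h ⟨hc, hB.mono (subset_union_left.trans subset_union_left)⟩
        refine (eb_mono hP0 hP1 h2).trans ?_
        rw [eb_add, eb_const hP0 hP1]
        exact add_le_add (hfew B hB) le_rfl
      · rw [ind_of hB]
        have h3 : eb (1 - P) (fun R => eb (1 - U) (fun K => ind (¬ (Conn G (B ∪ (R ∪ K)) ∧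
            TotDom G (B ∪ (R ∪ K)))))) ≤ eb (1 - P) fun _ => eb (1 - U) fun _ => (1 : ℝ) :=
          eb_mono hP0 hP1 fun _ => eb_mono hU0 hU1 fun _ => ind_le_one _
        rw [eb_const hP0 hP1, eb_const hU0 hU1] at h3
        have := mul_nonneg hn0 (hhalf (2 * s))
        linarith
    have hb01 : 0 ≤ b := by linarith
    have hb11 : b ≤ 1 := by linarith
    refine (eb_mono hb01 hb11 h1).trans ?_
    rw [eb_add, eb_const hb01 hb11]
    have h2 := eb_not_totDom_le hdeg hb01 hb11
    have h3 : (1 - b) ^ k ≤ (1 / 2) ^ (2 * s) := by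
      have h4 : (1 - b) ^ k ≤ (4 / 5) ^ k := pow_le_pow_left₀ (by linarith) (by linarith) k
      have h5 : (4 / 5 : ℝ) ^ k ≤ (4 / 5) ^ (4 * (2 * s)) :=
        pow_le_pow_of_le_one (by norm_num) (by norm_num) (by omega)
      have h6 : (4 / 5 : ℝ) ^ (4 * (2 * s)) ≤ (1 / 2) ^ (2 * s) := by
        rw [pow_mul]
        exact pow_le_pow_left₀ (by positivity) (by norm_num) _
      linarith
    have h4 := mul_le_mul_of_nonneg_left h3 hn0
    linarith
  have h1 : eb p (fun K => ind (¬ Good G s K)) ≤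
      eb p fun K => 2 ^ s * eb (1 / 2) fun Y => ind (¬ (Conn G (K ∩ Y) ∧ TotDom G (K ∩ Y))) :=
    eb_mono (by linarith) hp1 fun K => ind_not_good_le s K
  rw [eb_const_mul, eb_inter p (1 / 2) fun F => ind (¬ (Conn G F ∧ TotDom G F)),
    mul_one_div] at h1
  refine h1.trans ((mul_le_mul_of_nonneg_left hbad (by positivity)).trans_eq ?_)
  have h2 : (2 : ℝ) ^ s * (1 / 2) ^ (2 * s) = (1 / 2) ^ s := by
    rw [two_mul, pow_add, ← mul_assoc, ← mul_pow]
    norm_num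
  rw [← h2]
  ring

end Robust

section Stage

variable {V : Type*} [Fintype V] {G : SimpleGraph V}

lemma pr_pw_indep {Λ : Type*} [Fintype Λ] {ω : Λ → ℝ} (hω : IsProb ω) {d : ℕ} {x : Fin d → V}
    (hx : Function.Injective x) (P : Fin d → Λ → Prop) :
    pr (pw V ω) (fun f => ∀ j, P j (f (x j))) = ∏ j, pr ω (P j) := by
  have h := pr_pw_forall hω (univ.image x) fun v a => ∀ j, x j = v → P j a
  rw [prod_image fun a _ b _ hab => hx hab] at h
  simp only [hx.eq_iff, forall_eq] at h
  rw [← h]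
  congr 1
  funext f
  exact propext ⟨fun h v _ j hj => hj ▸ h j,
    fun h j => h _ (mem_image_of_mem _ (mem_univ j)) j rfl⟩

/-- With probability `1 - ρ` there is no label, all labels in `Bool × Fin m` are equally likely. -/
noncomputable def stageW (m : ℕ) (ρ : ℝ) : Option (Bool × Fin m) → ℝ
  | none => 1 - ρ
  | some _ => ρ / (2 * m)

/-- The vertices with a label. -/
noncomputable def labelled {Λ : Type*} (f : V → Option Λ) : Finset V :=
  univ.filter fun v => f v ≠ none

lemma isProb_stageW {m : ℕ} (hm : 0 < m) {ρ : ℝ} (h0 : 0 ≤ ρ) (h1 : ρ ≤ 1) :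
    IsProb (stageW m ρ) where
  nonneg
    | none => by simpa [stageW] using h1
    | some _ => by simp only [stageW]; positivity
  sum_one := by
    have : (m : ℝ) ≠ 0 := by positivity
    simp only [Fintype.sum_option, stageW, sum_const, card_univ, Fintype.card_prod,
      Fintype.card_bool, Fintype.card_fin, nsmul_eq_mul]
    push_cast
    field_simp
    ring

lemma pr_stageW_true {m : ℕ} (hm : 0 < m) (ρ : ℝ) :
    pr (stageW m ρ) (fun a => ∃ j, a = some (true, j)) = ρ / 2 := by
  have : (m : ℝ) ≠ 0 := by positivity
  simp [pr, ex, ind, stageW, Fintype.sum_option, Fintype.sum_prod_type]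
  field_simp

lemma pr_stageW_false {m : ℕ} (ρ : ℝ) (i : Fin m) :
    pr (stageW m ρ) (fun a => a = some (false, i)) = ρ / (2 * m) := by
  simp [pr, ex, ind, stageW]

/-- The probability that `u` has a label `true`, `w` the label `(false, i)`, and there is no
conflict with the partners of `u` for the other values of `i`. -/
lemma pr_pair_ge {m : ℕ} (hm : 0 < m) {ρ : ℝ} (h0 : 0 ≤ ρ) (h1 : ρ ≤ 1) (i : Fin m)
    {u w : V} (huw : u ≠ w) (pt : Fin m → V) :
    ρ ^ 2 / (8 * m) ≤ pr (pw V (stageW m ρ)) (fun f => (∃ j, f u = some (true, j)) ∧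
      f w = some (false, i) ∧ ∀ i', i' ≠ i → f (pt i') ≠ some (false, i')) := by
  have hω := isProb_stageW hm h0 h1
  have hp := isProb_pw (V := V) hω
  have hmR : (1 : ℝ) ≤ m := by exact_mod_cast hm
  set E₀ : (V → Option (Bool × Fin m)) → Prop := fun f =>
    (∃ j, f u = some (true, j)) ∧ f w = some (false, i) with hE₀
  set B : Fin m → (V → Option (Bool × Fin m)) → Prop := fun i' f =>
    E₀ f ∧ i' ≠ i ∧ f (pt i') = some (false, i') with hB
  have e0 : pr (pw V (stageW m ρ)) E₀ = ρ / 2 * (ρ / (2 * m)) := by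
    have := pr_pw_indep (V := V) hω (x := ![u, w])
      (by intro a b; fin_cases a <;> fin_cases b <;> simp [huw, huw.symm])
      ![fun a => ∃ j, a = some (true, j), fun a => a = some (false, i)]
    simpa [Fin.forall_fin_two, pr_stageW_true hm, pr_stageW_false] using this
  have e1 : ∀ i', pr (pw V (stageW m ρ)) (B i') ≤ ρ / 2 * (ρ / (2 * m)) * (ρ / (2 * m)) := by
    intro i'
    by_cases hz : i' ≠ i ∧ pt i' ≠ u ∧ pt i' ≠ w
    · obtain ⟨hi, hu, hw⟩ := hz
      have := pr_pw_indep (V := V) hω (x := ![u, w, pt i'])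
        (by intro a b; fin_cases a <;> fin_cases b <;>
              simp [huw, huw.symm, hu, hu.symm, hw, hw.symm])
        ![fun a => ∃ j, a = some (true, j), fun a => a = some (false, i),
          fun a => a = some (false, i')]
      simp only [Fin.prod_univ_three, Matrix.cons_val_zero, Matrix.cons_val_one,
        Matrix.cons_val, pr_stageW_true hm, pr_stageW_false] at this
      rw [← this]
      refine pr_mono hp fun f hf j => ?_
      obtain ⟨⟨h3, h4⟩, -, h5⟩ := hf
      fin_cases j <;> simp_all
    · have : pr (pw V (stageW m ρ)) (B i') ≤ pr (pw V (stageW m ρ)) fun _ => False := by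
        refine pr_mono hp fun f hf => hz ?_
        obtain ⟨⟨⟨j, h3⟩, h4⟩, hi, h5⟩ := hf
        refine ⟨hi, ?_, ?_⟩
        · rintro h
          rw [h, h3] at h5
          simp at h5
        · rintro h
          rw [h, h4] at h5
          simp only [Option.some.injEq, Prod.mk.injEq, true_and] at h5
          exact hi h5.symm
      refine this.trans ?_
      simp only [pr, ind_of_not not_false, ex_const hp]
      positivity
  have e2 : pr (pw V (stageW m ρ)) E₀ - ∑ i', pr (pw V (stageW m ρ)) (B i') ≤
      pr (pw V (stageW m ρ)) (fun f => (∃ j, f u = some (true, j)) ∧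
      f w = some (false, i) ∧ ∀ i', i' ≠ i → f (pt i') ≠ some (false, i')) := by
    have h3 := pr_exists_le hp univ B
    refine (sub_le_sub_left h3 _).trans ?_
    unfold pr
    rw [← ex_sub]
    refine ex_mono hp fun f => ?_
    by_cases h4 : E₀ f
    · by_cases h5 : ∃ i' ∈ univ, B i' f
      · rw [ind_of h4, ind_of h5, sub_self]
        exact ind_nonneg _
      · rw [ind_of h4, ind_of_not h5, ind_of, sub_zero]
        refine ⟨h4.1, h4.2, fun i' hi h => h5 ⟨i', mem_univ _, h4, hi, h⟩⟩
    · rw [ind_of_not h4, zero_sub]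
      have := ind_nonneg (∃ i' ∈ univ, B i' f)
      have := ind_nonneg ((∃ j, f u = some (true, j)) ∧
        f w = some (false, i) ∧ ∀ i', i' ≠ i → f (pt i') ≠ some (false, i'))
      linarith
  refine le_trans ?_ e2
  have h3 := sum_le_card_nsmul univ _ _ fun i' _ => e1 i'
  rw [card_univ, Fintype.card_fin, nsmul_eq_mul] at h3
  have h4 : (m : ℝ) * (ρ / 2 * (ρ / (2 * m)) * (ρ / (2 * m))) =
      ρ / 2 * (ρ / (2 * m)) * (ρ / 2) := by
    field_simp
  have h5 : ρ ^ 2 / (8 * m) = ρ / 2 * (ρ / (2 * m)) * (1 / 2) := by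
    field_simp
    norm_num
  have h6 : 0 ≤ ρ / 2 * (ρ / (2 * m)) := by positivity
  rw [e0, h5]
  nlinarith

lemma pr_pair_pair_le {m : ℕ} (hm : 0 < m) {ρ : ℝ} (h0 : 0 ≤ ρ) (h1 : ρ ≤ 1) (i : Fin m)
    {u w u' w' : V} (hx : Function.Injective ![u, w, u', w']) :
    pr (pw V (stageW m ρ)) (fun f => ((∃ j, f u = some (true, j)) ∧ f w = some (false, i)) ∧
      (∃ j, f u' = some (true, j)) ∧ f w' = some (false, i)) ≤ 4 * (ρ ^ 2 / (8 * m)) ^ 2 := by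
  have hω := isProb_stageW hm h0 h1
  have := pr_pw_indep (V := V) hω hx
    ![fun a => ∃ j, a = some (true, j), fun a => a = some (false, i),
      fun a => ∃ j, a = some (true, j), fun a => a = some (false, i)]
  simp only [Fin.prod_univ_four, Matrix.cons_val_zero, Matrix.cons_val_one,
    Matrix.cons_val, pr_stageW_true hm, pr_stageW_false] at this
  have h2 : 4 * (ρ ^ 2 / (8 * m)) ^ 2 =
      ρ / 2 * (ρ / (2 * m)) * (ρ / 2) * (ρ / (2 * m)) := by
    field_simp
    ring
  rw [h2, ← this]
  refine pr_mono (isProb_pw hω) fun f hf j => ?_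
  obtain ⟨⟨h3, h4⟩, h5, h6⟩ := hf
  fin_cases j
  exacts [h3, h4, h5, h6]

end Stage

section Step

variable {V : Type*} [Fintype V] {G : SimpleGraph V}

/-- A class with many disjoint short connections to the other classes is merged with constant
probability. -/
lemma pr_merged_ge {m s : ℕ} (hm : 0 < m) {ρ : ℝ} (h0 : 0 < ρ) (h1 : ρ ≤ 1 / 4)
    (hms : 4 * m ≤ s * ρ ^ 2) (i : Fin m) {Q : Finset V}
    (Q' : (V → Option (Bool × Fin m)) → Finset V) (hQ : ∀ f, Q ⊆ Q' f) {x : V}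
    {J : Finset (V × V)} (hJs : s ≤ 2 * #J) (pt : V → Fin m → V)
    (hJ : ∀ p ∈ J, (∃ y ∈ Q, comps G Q x y ∧ G.Adj p.1 y) ∧
        (∃ y ∈ Q, ¬ comps G Q x y ∧ G.Adj p.2 y) ∧ (p.1 = p.2 ∨ G.Adj p.1 p.2))
    (hdisj : ∀ p ∈ J, ∀ q ∈ J, p ≠ q → p.1 ≠ q.1 ∧ p.1 ≠ q.2 ∧ p.2 ≠ q.1 ∧ p.2 ≠ q.2)
    (hfalse : ∀ f, ∀ p ∈ J, f p.2 = some (false, i) → p.2 ∈ Q' f)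
    (htrue : ∀ f, ∀ p ∈ J, p.1 ≠ p.2 → (∃ j, f p.1 = some (true, j)) → f p.2 = some (false, i) →
      (∀ i', i' ≠ i → f (pt p.1 i') ≠ some (false, i')) → p.1 ∈ Q' f) :
    3 / 32 ≤ pr (pw V (stageW m ρ)) fun f =>
      Merged Q (comps G Q) (comps G (Q' f)) (Quotient.mk _ x) := by
  have hω := isProb_stageW hm h0.le (h1.trans (by norm_num))
  have hp := isProb_pw (V := V) hω
  have hm1 : (1 : ℝ) ≤ m := by exact_mod_cast hm
  have hmerge : ∀ f, ∀ p ∈ J, p.1 ∈ Q' f → p.2 ∈ Q' f →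
      Merged Q (comps G Q) (comps G (Q' f)) (Quotient.mk _ x) := by
    intro f p hpJ hp1 hp2
    obtain ⟨⟨y, hy, hxy, hpy⟩, ⟨z, hz, hxz, hpz⟩, h12⟩ := hJ p hpJ
    refine merged_of_rel hy hz hxy hxz ?_
    have e1 := comps_adj (hQ f hy) hp1 hpy.symm
    have e2 := comps_adj hp2 (hQ f hz) hpz
    refine Setoid.trans' _ e1 (Setoid.trans' _ ?_ e2)
    rcases h12 with h12 | h12
    · rw [h12]
    · exact comps_adj hp1 hp2 h12
  have hsplit : s ≤ 4 * #(J.filter fun p => p.1 = p.2) ∨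
      s ≤ 4 * #(J.filter fun p => ¬ p.1 = p.2) := by
    have := card_filter_add_card_filter_not (s := J) fun p => p.1 = p.2
    omega
  rcases hsplit with h | h
  · have hR : (s : ℝ) ≤ 4 * #(J.filter fun p => p.1 = p.2) := by exact_mod_cast h
    set K := J.filter fun p => p.1 = p.2 with hK
    refine (pr_exists_ge hp K (fun p f => f p.2 = some (false, i)) (a := ρ / (2 * m))
      (by positivity) ?_ ?_ ?_ ?_).trans (pr_mono hp fun f => ?_)
    · rw [div_le_iff₀ (by positivity)]
      linarith
    · rw [← mul_div_assoc, le_div_iff₀ (by positivity)]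
      have h3 : ρ ^ 2 ≤ ρ * (1 / 4) := by nlinarith
      have h4 := mul_le_mul_of_nonneg_left h3 (Nat.cast_nonneg (α := ℝ) s)
      nlinarith
    · intro p hp'
      have := pr_pw_indep (V := V) hω (x := ![p.2]) (Function.injective_of_subsingleton _)
        ![fun a => a = some (false, i)]
      simp only [Fin.forall_fin_one, Matrix.cons_val_fin_one, univ_unique, prod_singleton,
        pr_stageW_false] at this
      exact this.ge
    · intro p hp' q hq hpq
      have hne := (hdisj p (mem_filter.1 hp').1 q (mem_filter.1 hq).1 hpq).2.2.2
      have := pr_pw_indep (V := V) hω (x := ![p.2, q.2])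
        (by intro a b; fin_cases a <;> fin_cases b <;> simp [hne, hne.symm])
        ![fun a => a = some (false, i), fun a => a = some (false, i)]
      simp only [Fin.forall_fin_two, Fin.prod_univ_two, Matrix.cons_val_zero, Matrix.cons_val_one,
        pr_stageW_false] at this
      rw [this]
      nlinarith [sq_nonneg (ρ / (2 * m))]
    · rintro ⟨p, hpK, hpf⟩
      obtain ⟨hpJ, h12⟩ := mem_filter.1 hpK
      have := hfalse f p hpJ hpf
      exact hmerge f p hpJ (h12 ▸ this) this
  · have hR : (s : ℝ) ≤ 4 * #(J.filter fun p => ¬ p.1 = p.2) := by exact_mod_cast h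
    set K := J.filter fun p => ¬ p.1 = p.2 with hK
    refine (pr_exists_ge hp K (fun p f => (∃ j, f p.1 = some (true, j)) ∧
      f p.2 = some (false, i) ∧ ∀ i', i' ≠ i → f (pt p.1 i') ≠ some (false, i'))
      (a := ρ ^ 2 / (8 * m)) (by positivity) ?_ ?_ ?_ ?_).trans (pr_mono hp fun f => ?_)
    · rw [div_le_iff₀ (by positivity)]
      nlinarith
    · rw [← mul_div_assoc, le_div_iff₀ (by positivity)]
      have h4 := mul_le_mul_of_nonneg_right hR (sq_nonneg ρ)
      nlinarith
    · intro p hp'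
      exact pr_pair_ge hm h0.le (h1.trans (by norm_num)) i (mem_filter.1 hp').2 _
    · intro p hp' q hq hpq
      obtain ⟨hpJ, hp12⟩ := mem_filter.1 hp'
      obtain ⟨hqJ, hq12⟩ := mem_filter.1 hq
      obtain ⟨n1, n2, n3, n4⟩ := hdisj p hpJ q hqJ hpq
      refine (pr_mono hp fun f hf => ?_).trans
        (pr_pair_pair_le hm h0.le (h1.trans (by norm_num)) i (u := p.1) (w := p.2) (u' := q.1)
          (w' := q.2) ?_)
      · exact ⟨⟨hf.1.1, hf.1.2.1⟩, hf.2.1, hf.2.2.1⟩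
      · have := Ne.symm hp12
        have := Ne.symm hq12
        intro a b
        fin_cases a <;> fin_cases b <;> simp [*, n1.symm, n2.symm, n3.symm, n4.symm]
    · rintro ⟨p, hpK, hp1, hp2, hp3⟩
      obtain ⟨hpJ, h12⟩ := mem_filter.1 hpK
      exact hmerge f p hpJ (htrue f p hpJ h12 hp1 hp2 hp3) (hfalse f p hpJ hp2)

lemma exists_links {Q A : Finset V} {s : ℕ} (hQA : Q ⊆ A) (hd : TotDom G Q)
    (hgood : Good G s (univ \ A)) :
    ∃ J : Quotient (comps G Q) → Finset (V × V),
      (∀ q, ∀ p ∈ J q, ∀ p' ∈ J q, p ≠ p' →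
        p.1 ≠ p'.1 ∧ p.1 ≠ p'.2 ∧ p.2 ≠ p'.1 ∧ p.2 ≠ p'.2) ∧
      ∀ x ∈ Q, 2 ≤ numC Q (comps G Q) → s ≤ 2 * #(J (Quotient.mk _ x)) ∧
        ∀ p ∈ J (Quotient.mk _ x), p.1 ∉ A ∧ p.2 ∉ A ∧ (∃ y ∈ Q, comps G Q x y ∧ G.Adj p.1 y) ∧
        (∃ y ∈ Q, ¬ comps G Q x y ∧ G.Adj p.2 y) ∧
        (p.1 = p.2 ∨ (G.Adj p.1 p.2 ∧ ∀ y ∈ Q, G.Adj p.1 y → comps G Q x y)) := by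
  have key : ∀ q : Quotient (comps G Q), ∃ J : Finset (V × V),
      (∀ p ∈ J, ∀ p' ∈ J, p ≠ p' → p.1 ≠ p'.1 ∧ p.1 ≠ p'.2 ∧ p.2 ≠ p'.1 ∧ p.2 ≠ p'.2) ∧
      ∀ x ∈ Q, 2 ≤ numC Q (comps G Q) → Quotient.mk _ x = q → s ≤ 2 * #J ∧
        ∀ p ∈ J, p.1 ∉ A ∧ p.2 ∉ A ∧ (∃ y ∈ Q, comps G Q x y ∧ G.Adj p.1 y) ∧
        (∃ y ∈ Q, ¬ comps G Q x y ∧ G.Adj p.2 y) ∧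
        (p.1 = p.2 ∨ (G.Adj p.1 p.2 ∧ ∀ y ∈ Q, G.Adj p.1 y → comps G Q x y)) := by
    intro q
    by_cases hq : ∃ x ∈ Q, 2 ≤ numC Q (comps G Q) ∧ Quotient.mk _ x = q
    · obtain ⟨x, hx, h2, rfl⟩ := hq
      have hdisj : Disjoint Q (univ \ A) := disjoint_of_subset_left hQA disjoint_sdiff
      obtain ⟨J, hJ, h3, h4⟩ := exists_pairs_class (s := s) le_rfl hd hdisj
        (fun X hX hXs => by
          refine (hgood X hXs).1.superset (sdiff_subset_sdiff subset_union_right subset_rfl) ?_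
          exact fun v _ _ => (hgood X hXs).2 v) h2 hx
      refine ⟨J, h4, fun x' _ _ hx' => ⟨hJ, fun p hp => ?_⟩⟩
      have hxx : ∀ y, comps G Q x y ↔ comps G Q x' y := fun y =>
        ⟨fun h => Setoid.trans' _ (Quotient.exact hx') h,
          fun h => Setoid.trans' _ (Setoid.symm' _ (Quotient.exact hx')) h⟩
      have := h3 p hp
      simp only [hxx, mem_sdiff, mem_univ, true_and] at this
      exact this
    · exact ⟨∅, by simp, fun x hx h2 hxq => (hq ⟨x, hx, h2, hxq⟩).elim⟩
  choose J hJ1 hJ2 using key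
  exact ⟨J, hJ1, fun x hx h2 => hJ2 _ x hx h2 rfl⟩

/-- One round of enlarging all classes by random labels. -/
lemma exists_stage {m s : ℕ} (hm : 0 < m) {ρ : ℝ} (h0 : 0 < ρ) (h1 : ρ ≤ 1 / 4)
    (hms : 4 * m ≤ s * ρ ^ 2) [Nonempty V] {A : Finset V} {S : Fin m → Finset V}
    (hSA : ∀ i, S i ⊆ A) (hS : Pairwise fun i j => Disjoint (S i) (S j))
    (hd : ∀ i, TotDom G (S i)) (hgood : Good G s (univ \ A)) :
    ∃ S' : (V → Option (Bool × Fin m)) → Fin m → Finset V,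
      (∀ f i, S i ⊆ S' f i) ∧ (∀ f i, S' f i ⊆ A ∪ labelled f) ∧
      (∀ f, Pairwise fun i j => Disjoint (S' f i) (S' f j)) ∧
      ∀ i, ex (pw V (stageW m ρ)) (fun f => (numC (S' f i) (comps G (S' f i)) : ℝ) - 1) ≤
        61 / 64 * ((numC (S i) (comps G (S i)) : ℝ) - 1) := by
  choose J hJ1 hJ2 using fun i => exists_links (hSA i) (hd i) hgood
  choose nb hnb1 hnb2 using hd
  have hpt : ∀ u i, ∃ w, ∀ w', u ≠ w' → (u, w') ∈ J i (Quotient.mk _ (nb i u)) → w = w' := by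
    intro u i
    by_cases h : ∃ w, u ≠ w ∧ (u, w) ∈ J i (Quotient.mk _ (nb i u))
    · obtain ⟨w, -, hw⟩ := h
      refine ⟨w, fun w' _ hw' => ?_⟩
      by_contra hne
      exact (hJ1 i _ _ hw _ hw' (by simpa using hne)).1 rfl
    · exact ⟨u, fun w' h1 h2 => (h ⟨w', h1, h2⟩).elim⟩
  choose pt hpt using hpt
  let S' : (V → Option (Bool × Fin m)) → Fin m → Finset V := fun f i =>
    univ.filter fun v => v ∈ S i ∨ v ∉ A ∧ (f v = some (false, i) ∨
      (∃ j, f v = some (true, j)) ∧ f (pt v i) = some (false, i) ∧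
        ∀ i', i' ≠ i → f (pt v i') ≠ some (false, i'))
  have hmem : ∀ f i v, v ∈ S' f i ↔ v ∈ S i ∨ v ∉ A ∧ (f v = some (false, i) ∨
      (∃ j, f v = some (true, j)) ∧ f (pt v i) = some (false, i) ∧
        ∀ i', i' ≠ i → f (pt v i') ≠ some (false, i')) := fun f i v => by simp [S']
  have hsub : ∀ f i, S i ⊆ S' f i := fun f i v hv => (hmem f i v).2 (Or.inl hv)
  refine ⟨S', hsub, ?_, ?_, ?_⟩
  · intro f i v hv
    rw [mem_union]
    rcases (hmem f i v).1 hv with h | ⟨-, h | ⟨⟨j, h⟩, -⟩⟩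
    · exact Or.inl (hSA i h)
    · exact Or.inr (by simp [labelled, h])
    · exact Or.inr (by simp [labelled, h])
  · intro f i j hij
    rw [Finset.disjoint_left]
    intro v hv hv'
    rcases (hmem f i v).1 hv with h | ⟨hA, h⟩ <;> rcases (hmem f j v).1 hv' with h' | ⟨hA', h'⟩
    · exact Finset.disjoint_left.1 (hS hij) h h'
    · exact hA' (hSA i h)
    · exact hA (hSA j h')
    · rcases h with h | ⟨⟨a, ha⟩, h, h3⟩ <;> rcases h' with h' | ⟨⟨a', ha'⟩, h', h3'⟩
      · rw [h] at h'
        simp only [Option.some.injEq, Prod.mk.injEq, true_and] at h'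
        exact hij h'
      · simp [h] at ha'
      · simp [h'] at ha
      · exact h3 j hij.symm h'
  · intro i
    refine ex_numC_le (isProb_pw (isProb_stageW hm h0.le (h1.trans (by norm_num))))
      ⟨nb i (Classical.arbitrary V), hnb1 _ _⟩ _ _ (fun f => comps_mono (hsub f i)) ?_ ?_
    · intro f x hx
      exact ⟨nb i x, hnb1 i x, comps_adj hx (hsub f i (hnb1 i x)) (hnb2 i x)⟩
    · intro h2 x hx
      obtain ⟨h3, h4⟩ := hJ2 i x hx h2
      refine pr_merged_ge hm h0 h1 hms i (fun f => S' f i) (fun f => hsub f i) h3 pt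
        (fun p hp => ?_) (hJ1 i _) ?_ ?_
      · obtain ⟨-, -, h5, h6, h7⟩ := h4 p hp
        exact ⟨h5, h6, h7.imp_right And.left⟩
      · intro f p hp hf
        exact (hmem f i _).2 (Or.inr ⟨(h4 p hp).2.1, Or.inl hf⟩)
      · intro f p hp hne hp1 hp2 hp3
        obtain ⟨h5, -, -, -, h6⟩ := h4 p hp
        refine (hmem f i _).2 (Or.inr ⟨h5, Or.inr ⟨hp1, ?_, hp3⟩⟩)
        have h7 := (h6.resolve_left hne).2 (nb i p.1) (hnb1 i _) (hnb2 i _)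
        have h8 : (Quotient.mk (comps G (S i)) (nb i p.1)) = Quotient.mk _ x :=
          Quotient.sound (Setoid.symm' _ h7)
        rw [hpt p.1 i p.2 hne (by rw [h8]; exact hp)]
        exact hp2

end Step

section Iterate

variable {V : Type*} [Fintype V] {G : SimpleGraph V}

lemma mem_labelled {Λ : Type*} {f : V → Option Λ} {v : V} : v ∈ labelled f ↔ f v ≠ none := by
  simp [labelled]

/-- The law of the set of vertices without a label. -/
lemma ex_unlabelled {Λ : Type*} [Fintype Λ] {ω : Option Λ → ℝ} (hω : IsProb ω)
    (g : Finset V → ℝ) : ex (pw V ω) (fun f => g (univ \ labelled f)) = eb (ω none) g := by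
  have h1 := hω.sum_one
  rw [Fintype.sum_option] at h1
  have := ex_pw_map (V := V) (ω := bern (ω none)) (ω₁ := ω) Option.isNone (by
    rintro (_ | _)
    · simp only [bern, Fintype.sum_option, Option.isNone_none, Option.isNone_some]
      simp
      linarith
    · simp [bern]) fun f => g (supp f)
  rw [eb, ← this]
  congr 1
  funext f
  congr 1
  ext v
  simp [mem_labelled, mem_supp]

lemma ex_eb_sdiff {Λ : Type*} [Fintype Λ] {ω : Option Λ → ℝ} (hω : IsProb ω) (q : ℝ)
    (A : Finset V) (g : Finset V → ℝ) :
    ex (pw V ω) (fun f => eb q fun K => g (K \ (A ∪ labelled f))) =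
      eb (ω none * q) fun K => g (K \ A) := by
  rw [← eb_inter, ← ex_unlabelled hω]
  congr 1
  funext f
  congr 1
  funext K
  congr 1
  ext v
  simp only [mem_sdiff, mem_union, mem_inter, mem_univ, true_and]
  tauto

lemma exists_of_eb_lt {p : ℝ} (h0 : 0 ≤ p) (h1 : p ≤ 1) {P : Finset V → Prop}
    (h : eb p (fun K => ind (¬ P K)) < 1) : ∃ K, P K := by
  obtain ⟨f, hf⟩ := exists_le_ex (isProb_pw_bern (V := V) h0 h1) fun f => ind (¬ P (supp f))
  refine ⟨supp f, ?_⟩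
  by_contra hP
  rw [ind_of hP] at hf
  exact absurd (hf.trans_lt h) (lt_irrefl 1)

lemma exists_conn {m s : ℕ} (hm : 0 < m) {ρ : ℝ} (h0 : 0 < ρ) (h1 : ρ ≤ 1 / 4)
    (hms : 4 * m ≤ s * ρ ^ 2) [Nonempty V] (t : ℕ) {A : Finset V} {S : Fin m → Finset V}
    (hSA : ∀ i, S i ⊆ A) (hS : Pairwise fun i j => Disjoint (S i) (S j))
    (hd : ∀ i, TotDom G (S i))
    (h : eb ((1 - ρ) ^ t) (fun K => ind (¬ Good G s (K \ A))) +
      (61 / 64) ^ t * ∑ i, ((numC (S i) (comps G (S i)) : ℝ) - 1) < 1) :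
    ∃ D : Fin m → Finset V, (Pairwise fun i j => Disjoint (D i) (D j)) ∧
      ∀ i, Conn G (D i) ∧ TotDom G (D i) := by
  have hρ0 : 0 ≤ 1 - ρ := by linarith
  have hρ1 : 1 - ρ ≤ 1 := by linarith
  have hne : ∀ {F : Finset V}, TotDom G F → F.Nonempty := fun hF =>
    let ⟨u, hu, _⟩ := hF (Classical.arbitrary V)
    ⟨u, hu⟩
  have hnn : ∀ {F : Finset V}, TotDom G F → 0 ≤ (numC F (comps G F) : ℝ) - 1 := fun hF =>
    sub_nonneg.2 (by exact_mod_cast numC_pos (hne hF) _)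
  induction t generalizing A S with
  | zero =>
    have h2 : 0 ≤ eb ((1 - ρ) ^ 0) (fun K => ind (¬ Good G s (K \ A))) :=
      pr_nonneg (isProb_pw_bern (by simp) (by simp)) _
    refine ⟨S, hS, fun i => ⟨conn_of_numC_le (hne (hd i)) ?_, hd i⟩⟩
    have h3 := single_le_sum (f := fun i => (numC (S i) (comps G (S i)) : ℝ) - 1)
      (fun j _ => hnn (hd j)) (mem_univ i)
    have h4 : (numC (S i) (comps G (S i)) : ℝ) < 2 := by
      simp only [pow_zero, one_mul] at h h2 h3
      linarith
    have h5 : numC (S i) (comps G (S i)) < 2 := by exact_mod_cast h4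
    omega
  | succ t ih =>
    have hω := isProb_stageW hm h0.le (h1.trans (by norm_num))
    have hp := isProb_pw (V := V) hω
    have hgood : Good G s (univ \ A) := by
      have h3 : 0 ≤ (61 / 64 : ℝ) ^ (t + 1) * ∑ i, ((numC (S i) (comps G (S i)) : ℝ) - 1) :=
        mul_nonneg (by positivity) (sum_nonneg fun i _ => hnn (hd i))
      obtain ⟨K, hK⟩ := exists_of_eb_lt (pow_nonneg hρ0 (t + 1)) (pow_le_one₀ hρ0 hρ1)
        (P := fun K => Good G s (K \ A)) (by linarith)
      exact hK.mono (sdiff_subset_sdiff (subset_univ _) subset_rfl)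
    obtain ⟨S', h2, h3, h4, h5⟩ := exists_stage hm h0 h1 hms hSA hS hd hgood
    obtain ⟨f, hf⟩ := exists_le_ex hp fun f =>
      eb ((1 - ρ) ^ t) (fun K => ind (¬ Good G s (K \ (A ∪ labelled f)))) +
        (61 / 64) ^ t * ∑ i, ((numC (S' f i) (comps G (S' f i)) : ℝ) - 1)
    refine ih (h3 f) (h4 f) (fun i => (hd i).mono (h2 f i)) (hf.trans_lt ?_)
    rw [ex_add, ex_const_mul, ex_sum,
      ex_eb_sdiff hω ((1 - ρ) ^ t) A fun K => ind (¬ Good G s K)]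
    refine lt_of_le_of_lt (add_le_add (le_of_eq ?_) ?_) h
    · rw [pow_succ']
      rfl
    · rw [pow_succ, mul_assoc, mul_sum (a := (61 / 64 : ℝ))]
      exact mul_le_mul_of_nonneg_left (sum_le_sum fun i _ => h5 i) (by positivity)

/-- With probability `3 / 4` there is no label, the labels in `Fin m` are equally likely. -/
noncomputable def baseW (m : ℕ) : Option (Fin m) → ℝ
  | none => 3 / 4
  | some _ => 1 / (4 * m)

lemma isProb_baseW {m : ℕ} (hm : 0 < m) : IsProb (baseW m) where
  nonneg
    | none => by norm_num [baseW]
    | some _ => by simp only [baseW]; positivity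
  sum_one := by
    have : (m : ℝ) ≠ 0 := by positivity
    simp only [Fintype.sum_option, baseW, sum_const, card_univ, Fintype.card_fin, nsmul_eq_mul]
    field_simp
    norm_num

lemma exists_base {m k : ℕ} (hm : 0 < m) (hdeg : ∀ v, k ≤ #(nbrs G v))
    (hmk : m * (Fintype.card V * (1 - 1 / (4 * m : ℝ)) ^ k) ≤ 1 / 4) {q : ℝ} (g : Finset V → ℝ)
    (hg : eb (3 / 4 * q) g ≤ 1 / 4) (hg0 : ∀ K, 0 ≤ g K) (hq0 : 0 ≤ q) (hq1 : q ≤ 1) :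
    ∃ S : Fin m → Finset V, ∃ A, (∀ i, S i ⊆ A) ∧ (Pairwise fun i j => Disjoint (S i) (S j)) ∧
      (∀ i, TotDom G (S i)) ∧ eb q (fun K => g (K \ A)) ≤ 1 / 2 := by
  have hω := isProb_baseW hm
  have hp := isProb_pw (V := V) hω
  have hm1 : (1 : ℝ) ≤ m := by exact_mod_cast hm
  let S : (V → Option (Fin m)) → Fin m → Finset V := fun f i => univ.filter fun v => f v = some i
  obtain ⟨f, hf⟩ := exists_le_ex hp fun f =>
    eb q (fun K => g (K \ (∅ ∪ labelled f))) +
      ind (∃ i ∈ univ, ∃ v ∈ univ, ∀ u ∈ nbrs G v, f u ≠ some i)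
  have hlast : pr (pw V (baseW m)) (fun f => ∃ i ∈ univ, ∃ v ∈ univ, ∀ u ∈ nbrs G v, f u ≠ some i)
      ≤ 1 / 4 := by
    refine ((pr_exists_le hp _ _).trans ?_).trans hmk
    refine (sum_le_card_nsmul univ _ _ fun i _ => (pr_exists_le hp _ _).trans
      (sum_le_card_nsmul univ _ ((1 - 1 / (4 * m : ℝ)) ^ k) fun v _ => ?_)).trans_eq ?_
    · rw [pr_pw_forall hω (nbrs G v) fun _ a => a ≠ some i]
      have h1 : pr (baseW m) (fun a => a ≠ some i) = 1 - 1 / (4 * m : ℝ) := by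
        have h2 := pr_compl_add hω fun a => a = some i
        have h3 : pr (baseW m) (fun a => a = some i) = 1 / (4 * m : ℝ) := by
          simp [pr, ex, ind, baseW]
        rw [h3] at h2
        linarith
      rw [h1, prod_const]
      have h4 : 1 / (4 * m : ℝ) ≤ 1 := by
        rw [div_le_one (by positivity)]
        linarith
      exact pow_le_pow_of_le_one (by linarith) (by
        have : 0 ≤ 1 / (4 * m : ℝ) := by positivity
        linarith) (hdeg v)
    · simp [nsmul_eq_mul]
  rw [ex_add, ex_eb_sdiff hω q ∅ g] at hf
  simp only [sdiff_empty, empty_union] at hf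
  have h6 : eb q (fun K => g (K \ labelled f)) +
      ind (∃ i ∈ univ, ∃ v ∈ univ, ∀ u ∈ nbrs G v, f u ≠ some i) ≤ 1 / 2 := by
    refine hf.trans ((add_le_add hg hlast).trans_eq (by norm_num))
  have h7 : 0 ≤ eb q (fun K => g (K \ labelled f)) := by
    have := eb_mono (V := V) hq0 hq1 (g := fun _ => 0) fun K => hg0 (K \ labelled f)
    rwa [eb_const hq0 hq1] at this
  refine ⟨S f, labelled f, fun i v hv => ?_, fun i j hij => ?_, fun i v => ?_, ?_⟩
  · rw [mem_labelled, (mem_filter.1 hv).2]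
    simp
  · refine Finset.disjoint_left.2 fun v hv hv' => ?_
    have := (mem_filter.1 hv).2.symm.trans (mem_filter.1 hv').2
    exact hij (Option.some_injective _ this)
  · by_contra hbad
    push Not at hbad
    rw [ind_of] at h6
    · linarith
    · exact ⟨i, mem_univ i, v, mem_univ v, fun u hu hfu =>
        hbad u (mem_filter.2 ⟨mem_univ u, hfu⟩) (mem_nbrs.1 hu)⟩
  · have := ind_nonneg (∃ i ∈ univ, ∃ v ∈ univ, ∀ u ∈ nbrs G v, f u ≠ some i)
    linarith

end Iterate

section Induce

variable {V : Type*} {G : SimpleGraph V}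

lemma conn_of_induce {F : Finset V} (h : (G.induce (F : Set V)).Connected) : Conn G F := by
  obtain ⟨⟨x, hx⟩⟩ := h.nonempty
  refine ⟨⟨x, hx⟩, ?_⟩
  rintro A ⟨⟨a, ha, haA⟩, ⟨b, hb, hbA⟩, h3⟩
  obtain ⟨p⟩ := h.preconnected ⟨a, ha⟩ ⟨b, hb⟩
  have key : ∀ u v : (F : Set V), (G.induce (F : Set V)).Walk u v → u.1 ∈ A → v.1 ∈ A := by
    intro u v p
    induction p with
    | nil => exact id
    | cons hadj _ ih => exact fun hu => ih (h3 _ (Subtype.prop _) _ (Subtype.prop _) hadj hu)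
  exact hbA (key _ _ p haA)

lemma Conn.induce {F : Finset V} (h : Conn G F) : (G.induce (F : Set V)).Connected := by
  obtain ⟨x, hx⟩ := h.1
  refine (SimpleGraph.connected_iff_exists_forall_reachable _).2 ⟨⟨x, hx⟩, ?_⟩
  by_contra! hne
  obtain ⟨⟨y, hy⟩, hxy⟩ := hne
  refine h.2 {z | ∃ hz : z ∈ (F : Set V), (G.induce (F : Set V)).Reachable ⟨x, hx⟩ ⟨z, hz⟩}
    ⟨⟨x, hx, hx, SimpleGraph.Reachable.refl _⟩, ⟨y, hy, fun ⟨_, h⟩ => hxy h⟩, ?_⟩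
  rintro a ha b hb hab ⟨ha', hra⟩
  exact ⟨hb, hra.trans (SimpleGraph.Adj.reachable (by exact hab))⟩

end Induce

section Main

variable {V : Type*} [Fintype V] {G : SimpleGraph V}

lemma one_sub_inv_pow_le {N : ℕ} (hN : 0 < N) : (1 - 1 / (N : ℝ)) ^ N ≤ 1 / 2 := by
  have hN1 : (1 : ℝ) ≤ N := by exact_mod_cast hN
  have h0 : (0 : ℝ) ≤ 1 / N := by positivity
  have h1 : 1 / (N : ℝ) ≤ 1 := by
    rw [div_le_one (by positivity)]
    exact hN1
  have h2 := one_add_mul_le_pow (a := 1 / (N : ℝ)) (by linarith) N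
  rw [mul_one_div_cancel (by positivity)] at h2
  have h3 : (1 - 1 / (N : ℝ)) ^ N * (1 + 1 / (N : ℝ)) ^ N ≤ 1 := by
    rw [← mul_pow]
    exact pow_le_one₀ (mul_nonneg (by linarith) (by linarith)) (by nlinarith)
  have h4 : 0 ≤ (1 - 1 / (N : ℝ)) ^ N := pow_nonneg (by linarith) N
  nlinarith

lemma sum_numC_le {m : ℕ} {S : Fin m → Finset V} (hS : Pairwise fun i j => Disjoint (S i) (S j)) :
    ∑ i, ((numC (S i) (comps G (S i)) : ℝ) - 1) ≤ Fintype.card V := by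
  have h1 : ∑ i, #(S i) ≤ Fintype.card V := by
    rw [← card_biUnion fun i _ j _ hij => hS hij]
    exact card_le_univ _
  calc ∑ i, ((numC (S i) (comps G (S i)) : ℝ) - 1) ≤ ∑ i, (#(S i) : ℝ) := by
        refine sum_le_sum fun i _ => ?_
        have : (numC (S i) (comps G (S i)) : ℝ) ≤ #(S i) := by exact_mod_cast numC_le _ _
        linarith
    _ ≤ Fintype.card V := by exact_mod_cast h1

/-- A highly connected graph has many disjoint connected total dominating sets. -/
lemma exists_disjoint_conn {k m t : ℕ} (hm : 0 < m) (hn : 2 ≤ Fintype.card V)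
    (hk : k < Fintype.card V) (hconn : ∀ X : Finset V, #X < k → Conn G (univ \ X))
    (ht : 4 * Fintype.card V ≤ 2 ^ t) (hmk : 256 * m * (16 * t) ^ 2 * 2 ^ 17 ≤ k) :
    ∃ D : Fin m → Finset V, (Pairwise fun i j => Disjoint (D i) (D j)) ∧
      ∀ i, Conn G (D i) ∧ TotDom G (D i) := by
  have : Nonempty V := Fintype.card_pos_iff.1 (by omega)
  have hdeg := le_card_nbrs hk hconn
  have ht1 : 1 ≤ t := by
    by_contra! h
    interval_cases t
    omega
  have htt : t ≤ t ^ 2 := Nat.le_self_pow two_ne_zero t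
  have hmt : t ≤ m * t ^ 2 := htt.trans (Nat.le_mul_of_pos_left _ hm)
  set n := Fintype.card V with hn'
  have hnR : (2 : ℝ) ≤ n := by exact_mod_cast hn
  have htR : (4 * n : ℝ) ≤ 2 ^ t := by exact_mod_cast ht
  have ht1R : (1 : ℝ) ≤ t := by exact_mod_cast ht1
  have hmn : (m : ℝ) ≤ n := by
    have h : m ≤ m * t ^ 2 := Nat.le_mul_of_pos_right _ (by positivity)
    have : m ≤ n := by nlinarith
    exact_mod_cast this
  have hhalf : (1 / 2 : ℝ) ^ t * (4 * n) ≤ 1 := by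
    rw [one_div, inv_pow, inv_mul_le_iff₀ (by positivity), mul_one]
    exact htR
  have hh0 : (0 : ℝ) ≤ (1 / 2) ^ t := by positivity
  set ρ : ℝ := 1 / (8 * (16 * t : ℕ)) with hρ
  have hρ0 : 0 < ρ := by positivity
  have hρ1 : ρ ≤ 1 / 4 := by
    rw [hρ, div_le_div_iff₀ (by positivity) (by norm_num)]
    push_cast
    linarith
  have hρL : 7 / 8 ≤ (1 - ρ) ^ (16 * t) := by
    have h := one_add_mul_le_pow (a := -ρ) (by linarith) (16 * t)
    have h2 : ((16 * t : ℕ) : ℝ) * ρ = 1 / 8 := by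
      rw [hρ]
      push_cast
      field_simp
    rw [← sub_eq_add_neg] at h
    linarith
  have hρL1 : (1 - ρ) ^ (16 * t) ≤ 1 := pow_le_one₀ (by linarith) (by linarith)
  set s := 256 * m * (16 * t) ^ 2 with hs
  have hs2t : t * 2 ≤ s := by
    rw [hs]
    nlinarith
  have hms : (4 * m : ℝ) ≤ s * ρ ^ 2 := by
    rw [hs, hρ]
    push_cast
    refine le_of_eq ?_
    field_simp
    norm_num
  have hg : eb (3 / 4 * (1 - ρ) ^ (16 * t)) (fun K => ind (¬ Good G s K)) ≤ 1 / 4 := by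
    refine (eb_not_good_le (by omega) hmk hconn hdeg (by linarith) (by linarith)).trans ?_
    have h1 : (1 / 2 : ℝ) ^ s ≤ ((1 / 2) ^ t) ^ 2 := by
      rw [← pow_mul]
      exact pow_le_pow_of_le_one (by norm_num) (by norm_num) hs2t
    have h2 := mul_le_mul_of_nonneg_left h1 (by positivity : (0 : ℝ) ≤ 3 * n)
    refine h2.trans ?_
    have h3 : ((1 / 2 : ℝ) ^ t) ≤ 1 / 8 := by nlinarith
    nlinarith
  have hbase : m * (n * (1 - 1 / (4 * m : ℝ)) ^ k) ≤ 1 / 4 := by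
    have h1 := one_sub_inv_pow_le (N := 4 * m) (by positivity)
    push_cast at h1
    have hm1 : (1 : ℝ) ≤ m := by exact_mod_cast hm
    have h4 : 1 / (4 * m : ℝ) ≤ 1 := by
      rw [div_le_one (by positivity)]
      linarith
    have h5 : 0 ≤ 1 / (4 * m : ℝ) := by positivity
    have h2 : (1 - 1 / (4 * m : ℝ)) ^ k ≤ (1 - 1 / (4 * m : ℝ)) ^ (4 * m * (t * 2)) :=
      pow_le_pow_of_le_one (by linarith) (by linarith) (by nlinarith)
    rw [pow_mul] at h2
    have h3 := h2.trans (pow_le_pow_left₀ (pow_nonneg (by linarith) _) h1 (t * 2))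
    rw [pow_mul] at h3
    calc m * (n * (1 - 1 / (4 * m : ℝ)) ^ k) ≤ n * (n * ((1 / 2) ^ t) ^ 2) := by
          refine mul_le_mul hmn (mul_le_mul_of_nonneg_left h3 (by positivity)) ?_ (by positivity)
          exact mul_nonneg (by positivity) (pow_nonneg (by linarith) _)
      _ = ((1 / 2) ^ t * (4 * n)) ^ 2 / 16 := by ring
      _ ≤ 1 ^ 2 / 16 := by gcongr
      _ ≤ 1 / 4 := by norm_num
  obtain ⟨S, A, hSA, hS, hd, hA⟩ := exists_base hm hdeg hbase _ hg (fun K => ind_nonneg _)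
    (by linarith) hρL1
  refine exists_conn hm hρ0 hρ1 hms (16 * t) hSA hS hd ?_
  have h1 := mul_le_mul (drift_pow_le t) (sum_numC_le (G := G) hS)
    (sum_nonneg fun i _ => ?_) hh0
  · linarith
  · obtain ⟨u, hu, -⟩ := hd i (Classical.arbitrary V)
    have : (1 : ℝ) ≤ numC (S i) (comps G (S i)) := by exact_mod_cast numC_pos ⟨u, hu⟩ _
    linarith

/-- Disjoint connected total dominating sets extend to a partition. -/
lemma exists_partition {m : ℕ} (hm : 0 < m) {D : Fin m → Finset V}
    (hD : Pairwise fun i j => Disjoint (D i) (D j)) (hc : ∀ i, Conn G (D i) ∧ TotDom G (D i)) :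
    ∃ E : Fin m → Finset V, (Pairwise fun i j => Disjoint (E i) (E j)) ∧
      (∀ v, ∃ i, v ∈ E i) ∧ ∀ i, Conn G (E i) ∧ TotDom G (E i) := by
  let E : Fin m → Finset V := fun i =>
    univ.filter fun v => v ∈ D i ∨ i = ⟨0, hm⟩ ∧ ∀ j, v ∉ D j
  have hmem : ∀ i v, v ∈ E i ↔ v ∈ D i ∨ i = ⟨0, hm⟩ ∧ ∀ j, v ∉ D j := fun i v => by simp [E]
  have hsub : ∀ i, D i ⊆ E i := fun i v hv => (hmem i v).2 (Or.inl hv)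
  refine ⟨E, fun i j hij => Finset.disjoint_left.2 fun v hv hv' => ?_, fun v => ?_, fun i =>
    ⟨(hc i).1.superset (hsub i) fun x _ _ => (hc i).2 x, (hc i).2.mono (hsub i)⟩⟩
  · rcases (hmem i v).1 hv with h | ⟨rfl, h⟩ <;> rcases (hmem j v).1 hv' with h' | ⟨rfl, h'⟩
    · exact Finset.disjoint_left.1 (hD hij) h h'
    · exact h' i h
    · exact h j h'
    · exact hij rfl
  · by_cases h : ∃ j, v ∈ D j
    · exact h.imp fun j hj => hsub j hj
    · push Not at h
      exact ⟨_, (hmem _ v).2 (Or.inr ⟨rfl, h⟩)⟩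

lemma exists_two_pow {n : ℕ} (hn : 2 ≤ n) :
    ∃ t : ℕ, 4 * n ≤ 2 ^ t ∧ (t : ℝ) ≤ 6 * Real.log n := by
  refine ⟨Nat.clog 2 (4 * n), Nat.le_pow_clog one_lt_two _, ?_⟩
  have h1 := Nat.pow_pred_clog_lt_self (b := 2) one_lt_two (x := 4 * n) (by omega)
  have hpos : 0 < Nat.clog 2 (4 * n) := Nat.clog_pos one_lt_two (by omega)
  set t := Nat.clog 2 (4 * n) with ht
  have h2 : (2 : ℕ) ^ t ≤ n ^ 4 := by
    have h3 : 2 ^ t = 2 * 2 ^ t.pred := by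
      rw [← pow_succ', Nat.pred_eq_sub_one, Nat.sub_add_cancel hpos]
    have h4 : 2 ^ 3 ≤ n ^ 3 := Nat.pow_le_pow_left hn 3
    calc 2 ^ t ≤ 2 ^ 3 * n := by omega
      _ ≤ n ^ 3 * n := Nat.mul_le_mul_right _ h4
      _ = n ^ 4 := by ring
  have h5 : (2 : ℝ) ^ t ≤ (n : ℝ) ^ 4 := by exact_mod_cast h2
  have h6 := Real.log_le_log (by positivity) h5
  rw [Real.log_pow, Real.log_pow] at h6
  have h7 := Real.log_two_gt_d9
  have h8 : (0 : ℝ) ≤ t := Nat.cast_nonneg t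
  push_cast at h6
  nlinarith

end Main

end CDS

/-- Every `k`-connected graph on `n ≥ 2` vertices admits a CDS partition of size
`m` for every positive integer `m ≤ c · k / (log n)²`, for some absolute constant `c > 0`. -/
theorem cds_partition_of_kConnected :
    ∃ c : ℝ, 0 < c ∧
      ∀ (V : Type) [Fintype V] (G : SimpleGraph V) (k : ℕ),
        2 ≤ Fintype.card V → KConnected G k →
        ∀ m : ℕ, 0 < m →
          (m : ℝ) ≤ c * (k : ℝ) / (Real.log (Fintype.card V)) ^ 2 →
          HasCDSPartition G m := by
  refine ⟨1 / 10 ^ 12, by positivity, ?_⟩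
  intro V _ G k hn ⟨hk, hG⟩ m hm hmk
  classical
  obtain ⟨t, ht, htl⟩ := CDS.exists_two_pow hn
  have hconn : ∀ X : Finset V, X.card < k → CDS.Conn G (Finset.univ \ X) := by
    intro X hX
    refine CDS.conn_of_induce ?_
    have := hG X hX
    rwa [Finset.coe_sdiff, Finset.coe_univ, ← Set.compl_eq_univ_sdiff]
  have hlog : 0 < Real.log (Fintype.card V) := Real.log_pos (by exact_mod_cast hn)
  have hmt : 256 * m * (16 * t) ^ 2 * 2 ^ 17 ≤ k := by
    rw [le_div_iff₀ (by positivity)] at hmk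
    have h1 : (t : ℝ) ^ 2 ≤ (6 * Real.log (Fintype.card V)) ^ 2 := by gcongr
    have h2 := mul_le_mul_of_nonneg_left h1 (Nat.cast_nonneg (α := ℝ) m)
    have h3 : (0 : ℝ) ≤ k := Nat.cast_nonneg k
    have h4 : ((256 * m * (16 * t) ^ 2 * 2 ^ 17 : ℕ) : ℝ) ≤ k := by
      push_cast
      nlinarith
    exact_mod_cast h4
  obtain ⟨D, hD, hc⟩ := CDS.exists_disjoint_conn hm hn hk hconn ht hmt
  obtain ⟨E, hE, hcov, hc⟩ := CDS.exists_partition hm hD hc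
  refine ⟨fun i => E i, fun i j hij => Finset.disjoint_coe.2 (hE hij), ?_, fun i =>
    ⟨(hc i).1.induce, fun v => Or.inr ?_⟩⟩
  · exact Set.eq_univ_of_forall fun v => Set.mem_iUnion.2 (hcov v)
  · obtain ⟨u, hu, hvu⟩ := (hc i).2 v
    exact ⟨u, hu, hvu⟩
end

section
/- Let G be a graph, let c_1, …, c_k be k distinct vertices, let n_1, …, n_k be positive integers with n_1 + … + n_k = |V(G)|, and let T_1, …, T_k be pairwise vertex-disjoint dominating trees of G such that {c_1,…,c_k} ⊆ V(T_1). Then there exist pairwise disjoint vertex sets V_1, …, V_k such that for every i ∈ {1,…,k}: c_i ∈ V_i and G[V_i] is connected; moreover V(T_1) ⊆ V_1 ∪ … ∪ V_k. -/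
/-- A subgraph `T` of `G` is a dominating tree: it is a tree, and every vertex
of `G` is in `T` or adjacent (in `G`) to a vertex of `T`. -/
def IsDominatingTree {V : Type} (G : SimpleGraph V) (T : G.Subgraph) : Prop :=
  T.coe.IsTree ∧ ∀ v : V, v ∈ T.verts ∨ ∃ u ∈ T.verts, G.Adj v u

/-- In a connected graph every vertex other than `r` has a neighbour closer to `r`. -/
theorem SimpleGraph.Connected.exists_adj_dist_lt {α : Type*} {H : SimpleGraph α}
    (hH : H.Connected) {r v : α} (hv : v ≠ r) : ∃ u, H.Adj v u ∧ H.dist u r < H.dist v r := by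
  obtain ⟨p, hp⟩ := hH.exists_walk_length_eq_dist v r
  cases p with
  | nil => exact absurd rfl hv
  | cons h q =>
    refine ⟨_, h, ?_⟩
    have := H.dist_le q
    simp only [Walk.length_cons] at hp
    omega

/-- The vertices of a connected graph can be partitioned into connected classes, one around each
member of a given nonempty family of distinct vertices. -/
theorem SimpleGraph.Connected.exists_connected_fibers {α ι : Type*} [Nonempty ι]
    {H : SimpleGraph α} (hH : H.Connected) {c : ι → α} (hc : Function.Injective c) :
    ∃ f : α → ι, (∀ i, f (c i) = i) ∧ ∀ i, (H.induce {v | f v = i}).Connected := by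
  classical
  let r : α := c (Classical.arbitrary ι)
  have hpar : ∀ v, v ∉ Set.range c → ∃ u, H.Adj v u ∧ H.dist u r < H.dist v r := fun v hv =>
    hH.exists_adj_dist_lt fun h => hv ⟨_, h.symm⟩
  choose p hadj hlt using hpar
  have wf : WellFounded fun u v : α => H.dist u r < H.dist v r :=
    (measure fun v => H.dist v r).wf
  let f : α → ι := wf.fix fun v rec =>
    if hv : v ∈ Set.range c then hv.choose else rec (p v hv) (hlt v hv)
  have hf : ∀ v, f v = if hv : v ∈ Set.range c then hv.choose else f (p v hv) := fun v =>
    wf.fix_eq _ v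
  have hfc : ∀ i, f (c i) = i := fun i => by
    have hi : c i ∈ Set.range c := ⟨i, rfl⟩
    rw [hf, dif_pos hi]
    exact hc hi.choose_spec
  refine ⟨f, hfc, fun i => ?_⟩
  have key : ∀ v (hv : f v = i),
      (H.induce {v | f v = i}).Reachable ⟨v, hv⟩ ⟨c i, hfc i⟩ := fun v => by
    induction v using wf.induction with
    | _ v ih =>
      intro hv
      by_cases hr : v ∈ Set.range c
      · obtain ⟨j, rfl⟩ := hr
        obtain rfl : j = i := (hfc j).symm.trans hv
        exact .rfl
      · have hp : f (p v hr) = i := by rw [← hv, hf v, dif_neg hr]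
        have hstep : (H.induce {v | f v = i}).Adj ⟨v, hv⟩ ⟨p v hr, hp⟩ := hadj v hr
        exact hstep.reachable.trans (ih _ (hlt v hr) hp)
  have : Nonempty {v | f v = i} := ⟨⟨c i, hfc i⟩⟩
  exact ⟨fun u v => (key u u.2).trans (key v v.2).symm⟩

/-- Given `k` pairwise vertex-disjoint dominating trees of `G` with all the terminals
`c 0, …, c (k-1)` contained in the first tree, there exist pairwise disjoint connected
vertex sets, each containing its terminal, whose union covers the first tree. -/
theorem gl_aux_all_terminals_on_one_tree {V : Type} [Fintype V] [DecidableEq V]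
    (G : SimpleGraph V) (k : ℕ) (hk : 0 < k)
    (c : Fin k → V) (hc : Function.Injective c)
    (n : Fin k → ℕ) (hpos : ∀ i, 0 < n i)
    (hsum : ∑ i, n i = Fintype.card V)
    (T : Fin k → G.Subgraph) (hT : ∀ i, IsDominatingTree G (T i))
    (hTdisj : Pairwise fun i j => Disjoint (T i).verts (T j).verts)
    (hcT : ∀ i, c i ∈ (T ⟨0, hk⟩).verts) :
    ∃ W : Fin k → Set V,
      (Pairwise fun i j => Disjoint (W i) (W j)) ∧
      (∀ i, c i ∈ W i ∧ (G.induce (W i)).Connected) ∧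
      (T ⟨0, hk⟩).verts ⊆ ⋃ i, W i := by
  have : Nonempty (Fin k) := ⟨⟨0, hk⟩⟩
  obtain ⟨f, hfc, hconn⟩ := (hT ⟨0, hk⟩).1.connected.exists_connected_fibers
    (c := fun i => ⟨c i, hcT i⟩) fun i j h => hc (congrArg Subtype.val h)
  refine ⟨fun i => Subtype.val '' {v | f v = i}, fun i j hij => ?_,
    fun i => ⟨⟨_, hfc i, rfl⟩, ?_⟩, fun v hv => Set.mem_iUnion.2 ⟨f ⟨v, hv⟩, _, rfl, rfl⟩⟩
  · refine (Set.disjoint_image_iff Subtype.val_injective).2 (Set.disjoint_left.2 ?_)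
    exact fun v hi hj => hij (hi.symm.trans hj)
  · let φ : ((T ⟨0, hk⟩).coe.induce {v | f v = i}) →g
        G.induce (Subtype.val '' {v | f v = i}) :=
      ⟨fun v => ⟨v.1, v.1, v.2, rfl⟩, fun h => (T ⟨0, hk⟩).adj_sub h⟩
    refine (hconn i).map φ ?_
    rintro ⟨_, v, hv, rfl⟩
    exact ⟨⟨v, hv⟩, rfl⟩
end
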